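/- The factor complexity of every pure morphic sequence belongs to exactly one of the five classes Θ(1), Θ(n), Θ(n log log n), Θ(n log n), Θ(n²). -/

import Mathlib

open Filter Asymptotics

variable {A : Type*}

/-- Extension of a morphism, given on letters, to words. -/
def wordMap (φ : A → List A) (w : List A) : List A := w.flatMap φ

/-- The factor of the infinite word α of length n starting at position i. -/
def factorAt (α : ℕ → A) (i n : ℕ) : List A := (List.range n).map (fun j => α (i + j))

/-- w is a factor (contiguous subword) of the infinite word α. -/
def IsFactor (α : ℕ → A) (w : List A) : Prop := ∃ i, w = factorAt α i w.length

/-- The factor complexity of α: the number of distinct factors of length n. -/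
noncomputable def complexity (α : ℕ → A) (n : ℕ) : ℕ :=
  Set.ncard {w : List A | w.length = n ∧ IsFactor α w}

def UltimatelyPeriodic (α : ℕ → A) : Prop :=
  ∃ N p : ℕ, 1 ≤ p ∧ ∀ i, N ≤ i → α (i + p) = α i

/-- φ is prolongable on a: φ(a) = a·w with w nonempty and |φ^n(a)| → ∞. -/
def Prolongable (φ : A → List A) (a : A) : Prop :=
  (∃ w, w ≠ [] ∧ φ a = a :: w) ∧
    Tendsto (fun n => ((wordMap φ)^[n] [a]).length) atTop atTop

/-- α is the pure morphic sequence φ^∞(a): every iterate φ^n(a) is a prefix of α. -/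
def IsFixedSeq (φ : A → List A) (a : A) (α : ℕ → A) : Prop :=
  ∀ n, factorAt α 0 ((wordMap φ)^[n] [a]).length = (wordMap φ)^[n] [a]

/-- The letter b is growing for φ: |φ^k(b)| → ∞. -/
def GrowingLetter (φ : A → List A) (b : A) : Prop :=
  Tendsto (fun k => ((wordMap φ)^[k] [b]).length) atTop atTop

def BoundedLetter (φ : A → List A) (b : A) : Prop := ¬ GrowingLetter φ b

/-- φ is growing: every letter is growing. -/
def Growing (φ : A → List A) : Prop := ∀ b, GrowingLetter φ b

/-- The five Pansiot complexity classes: Θ(1), Θ(n), Θ(n log log n), Θ(n log n), Θ(n²). -/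
noncomputable def classFun : Fin 5 → ℕ → ℝ :=
  ![fun _ => 1, fun n => n, fun n => n * Real.log (Real.log n),
    fun n => n * Real.log n, fun n => (n : ℝ) ^ 2]

/-! ### Factors and complexity -/

@[simp] theorem factorAt_length (α : ℕ → A) (i n : ℕ) : (factorAt α i n).length = n := by
  simp [factorAt]

@[simp] theorem factorAt_zero (α : ℕ → A) (i : ℕ) : factorAt α i 0 = [] := rfl

theorem factorAt_eq_iff (α : ℕ → A) (i j n : ℕ) :
    factorAt α i n = factorAt α j n ↔ ∀ r < n, α (i + r) = α (j + r) := by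
  simp [factorAt]

theorem factorAt_add (α : ℕ → A) (i m n : ℕ) :
    factorAt α i (m + n) = factorAt α i m ++ factorAt α (i + m) n := by
  simp [factorAt, List.range_add, Function.comp_def, add_assoc]

theorem factorAt_one (α : ℕ → A) (i : ℕ) : factorAt α i 1 = [α i] := by
  simp [factorAt]

theorem factorAt_succ (α : ℕ → A) (i n : ℕ) :
    factorAt α i (n + 1) = factorAt α i n ++ [α (i + n)] := by
  rw [factorAt_add, factorAt_one]

theorem mem_factorAt {α : ℕ → A} {i n : ℕ} {t : A} :
    t ∈ factorAt α i n ↔ ∃ s, i ≤ s ∧ s < i + n ∧ α s = t := by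
  simp only [factorAt, List.mem_map, List.mem_range]
  constructor
  · rintro ⟨r, hr, rfl⟩
    exact ⟨i + r, by omega, by omega, rfl⟩
  · rintro ⟨s, h1, h2, rfl⟩
    exact ⟨s - i, by omega, by rw [Nat.add_sub_cancel' h1]⟩

theorem complexity_eq (α : ℕ → A) (n : ℕ) :
    complexity α n = (Set.range fun i => factorAt α i n).ncard := by
  unfold complexity
  congr 1
  ext w
  constructor
  · rintro ⟨rfl, i, hi⟩
    exact ⟨i, hi.symm⟩
  · rintro ⟨i, rfl⟩
    exact ⟨by simp, i, by simp⟩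

theorem finite_factors [Finite A] (α : ℕ → A) (n : ℕ) :
    (Set.range fun i => factorAt α i n).Finite := by
  refine (List.finite_length_eq A n).subset ?_
  rintro _ ⟨i, rfl⟩
  simp

theorem card_le_complexity [Finite A] (α : ℕ → A) (n : ℕ) {ι : Type*} (s : Finset ι)
    (pos : ι → ℕ) (h : Set.InjOn (fun x => factorAt α (pos x) n) s) :
    s.card ≤ complexity α n := by
  classical
  rw [complexity_eq, ← Finset.card_image_of_injOn h, ← Set.ncard_coe_finset]
  refine Set.ncard_le_ncard ?_ (finite_factors α n)
  intro w hw
  simp only [Finset.coe_image, Set.mem_image] at hw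
  obtain ⟨x, -, rfl⟩ := hw
  exact ⟨pos x, rfl⟩

theorem complexity_le_card (α : ℕ → A) (n : ℕ) {ι : Type*} (s : Finset ι)
    (f : ι → List A) (h : ∀ i, ∃ x ∈ s, f x = factorAt α i n) :
    complexity α n ≤ s.card := by
  classical
  rw [complexity_eq]
  calc _ ≤ (s.image f : Set (List A)).ncard := by
        refine Set.ncard_le_ncard ?_ (Finset.finite_toSet _)
        rintro _ ⟨i, rfl⟩
        obtain ⟨x, hx, h⟩ := h i
        simpa using ⟨x, hx, h⟩
    _ ≤ s.card := by
        rw [Set.ncard_coe_finset]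
        exact Finset.card_image_le

/-- Comparison of the complexities of two words, each factor of length `m` of `β` being
determined by a bounded parameter and a factor of length `n` of `α`. -/
theorem complexity_le_mul {B : Type*} [Finite A] (α : ℕ → A) (β : ℕ → B) (m n C : ℕ)
    (r q : ℕ → ℕ) (hr : ∀ i, r i < C)
    (h : ∀ i j, r i = r j → factorAt α (q i) n = factorAt α (q j) n →
      factorAt β i m = factorAt β j m) :
    complexity β m ≤ C * complexity α n := by
  classical
  have hfin := finite_factors α n
  have key : ∀ x : ℕ × List A, ∃ w : List B,
      ∀ i, r i = x.1 → factorAt α (q i) n = x.2 → factorAt β i m = w := by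
    intro x
    by_cases hx : ∃ i, r i = x.1 ∧ factorAt α (q i) n = x.2
    · obtain ⟨i, h1, h2⟩ := hx
      exact ⟨factorAt β i m, fun j h3 h4 => h _ _ (h3.trans h1.symm) (h4.trans h2.symm)⟩
    · exact ⟨[], fun i h1 h2 => (hx ⟨i, h1, h2⟩).elim⟩
  choose f hf using key
  have := complexity_le_card β m (Finset.range C ×ˢ hfin.toFinset) f (fun i =>
    ⟨(r i, factorAt α (q i) n), by simp [hr i], (hf _ i rfl rfl).symm⟩)
  rwa [Finset.card_product, Finset.card_range, ← Set.ncard_eq_toFinset_card _ hfin,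
    ← complexity_eq] at this

theorem complexity_mono [Finite A] (α : ℕ → A) : Monotone (complexity α) := by
  intro m n hmn
  have := complexity_le_mul α α m n 1 (fun _ => 0) id (by simp) (by
    intro i j _ h
    simp only [id, factorAt_eq_iff] at h ⊢
    exact fun r hr => h r (by omega))
  simpa using this

theorem complexity_pos [Finite A] (α : ℕ → A) (n : ℕ) : 1 ≤ complexity α n := by
  have := card_le_complexity α n {0} (id : ℕ → ℕ) (by simp)
  simpa using this

/-- Right special factors force the complexity to increase. -/
theorem complexity_add_card_le [Finite A] (α : ℕ → A) (n : ℕ) {ι : Type*} (s : Finset ι)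
    (pos pos' : ι → ℕ) (hinj : Set.InjOn (fun x => factorAt α (pos x) n) s)
    (heq : ∀ x ∈ s, factorAt α (pos x) n = factorAt α (pos' x) n)
    (hne : ∀ x ∈ s, α (pos x + n) ≠ α (pos' x + n)) :
    complexity α n + s.card ≤ complexity α (n + 1) := by
  classical
  have hfin := finite_factors α n
  have hsec : ∀ w : List A, ∃ i, w ∈ hfin.toFinset → factorAt α i n = w := by
    intro w
    by_cases hw : w ∈ hfin.toFinset
    · obtain ⟨i, hi⟩ := hfin.mem_toFinset.1 hw
      exact ⟨i, fun _ => hi⟩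
    · exact ⟨0, fun h => (hw h).elim⟩
  choose idx hidx using hsec
  have hmem : ∀ i, factorAt α i n ∈ hfin.toFinset := fun i => hfin.mem_toFinset.2 ⟨i, rfl⟩
  have hch : ∀ x, ∃ i, x ∈ s → factorAt α i n = factorAt α (pos x) n ∧
      α (i + n) ≠ α (idx (factorAt α (pos x) n) + n) := by
    intro x
    by_cases hx : x ∈ s
    · by_cases h : α (pos x + n) = α (idx (factorAt α (pos x) n) + n)
      · exact ⟨pos' x, fun _ => ⟨(heq x hx).symm, fun h' => hne x hx (h.trans h'.symm)⟩⟩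
      · exact ⟨pos x, fun _ => ⟨rfl, h⟩⟩
    · exact ⟨0, fun h => (hx h).elim⟩
  choose p hp using hch
  have := card_le_complexity α (n + 1) (hfin.toFinset.disjSum s) (Sum.elim idx p) (by
    rintro (w | x) hx (w' | x') hx' h
    · simp only [Finset.mem_coe, Finset.inl_mem_disjSum] at hx hx'
      simp only [Sum.elim_inl, factorAt_succ] at h
      have := (List.append_inj' h rfl).1
      rw [hidx w hx, hidx w' hx'] at this
      rw [this]
    · exfalso
      simp only [Finset.mem_coe, Finset.inl_mem_disjSum, Finset.inr_mem_disjSum] at hx hx'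
      simp only [Sum.elim_inl, Sum.elim_inr, factorAt_succ] at h
      obtain ⟨h1, h2⟩ := List.append_inj' h rfl
      rw [hidx w hx, (hp x' hx').1] at h1
      subst h1
      exact (hp x' hx').2 (by simpa using h2.symm)
    · exfalso
      simp only [Finset.mem_coe, Finset.inl_mem_disjSum, Finset.inr_mem_disjSum] at hx hx'
      simp only [Sum.elim_inl, Sum.elim_inr, factorAt_succ] at h
      obtain ⟨h1, h2⟩ := List.append_inj' h rfl
      rw [hidx w' hx', (hp x hx).1] at h1
      subst h1
      exact (hp x hx).2 (by simpa using h2)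
    · simp only [Finset.mem_coe, Finset.inr_mem_disjSum] at hx hx'
      simp only [Sum.elim_inr, factorAt_succ] at h
      have := (List.append_inj' h rfl).1
      rw [(hp x hx).1, (hp x' hx').1] at this
      rw [hinj hx hx' this])
  rwa [Finset.card_disjSum, ← Set.ncard_eq_toFinset_card _ hfin, ← complexity_eq] at this

/-- The Morse–Hedlund alternative. -/
theorem complexity_bounded_or_gt [Finite A] (α : ℕ → A) :
    (∃ C, ∀ n, complexity α n ≤ C) ∨ ∀ n, n + 1 ≤ complexity α n := by
  by_cases h : ∀ n, complexity α n + 1 ≤ complexity α (n + 1)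
  · right
    intro n
    induction n with
    | zero => exact complexity_pos α 0
    | succ n ih => exact (Nat.succ_le_succ ih).trans (h n)
  · left
    push Not at h
    obtain ⟨n, hn⟩ := h
    have hext : ∀ i j, factorAt α i n = factorAt α j n → α (i + n) = α (j + n) := by
      intro i j hij
      by_contra hne
      have := complexity_add_card_le α n {0} (fun _ : ℕ => i) (fun _ => j) (by simp)
        (fun _ _ => hij) (fun _ _ => hne)
      simp at this
      omega
    have hall : ∀ m, ∀ i j, factorAt α i n = factorAt α j n →
        factorAt α i (n + m) = factorAt α j (n + m) := by
      intro m
      induction m with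
      | zero => exact fun i j h => h
      | succ m ih =>
        intro i j hij
        have h1 := ih i j hij
        rw [← add_assoc, factorAt_succ, factorAt_succ, h1]
        congr 2
        have := hext (i + m) (j + m) (by
          rw [factorAt_eq_iff] at h1 ⊢
          intro r hr
          have := h1 (m + r) (by omega)
          rwa [← add_assoc, ← add_assoc] at this)
        rwa [add_assoc, add_assoc, add_comm m n] at this
    refine ⟨complexity α n, fun m => ?_⟩
    rcases le_total m n with hm | hm
    · exact complexity_mono α hm
    · obtain ⟨k, rfl⟩ := Nat.exists_eq_add_of_le hm
      simpa using complexity_le_mul α α (n + k) n 1 (fun _ => 0) id (by simp)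
        (fun i j _ h => hall k i j h)

/-! ### Iterates of a morphism -/

/-- The image of the letter `t` under the `k`-th iterate of `φ`. -/
def img (φ : A → List A) (k : ℕ) (t : A) : List A := (wordMap φ)^[k] [t]

@[simp] theorem wordMap_nil (φ : A → List A) : wordMap φ [] = [] := rfl

@[simp] theorem wordMap_append (φ : A → List A) (u v : List A) :
    wordMap φ (u ++ v) = wordMap φ u ++ wordMap φ v := by
  simp [wordMap]

@[simp] theorem wordMap_singleton (φ : A → List A) (t : A) : wordMap φ [t] = φ t := by
  simp [wordMap]

@[simp] theorem wordMap_cons (φ : A → List A) (t : A) (u : List A) :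
    wordMap φ (t :: u) = φ t ++ wordMap φ u := by
  simp [wordMap]

@[simp] theorem mem_wordMap {φ : A → List A} {u : List A} {s : A} :
    s ∈ wordMap φ u ↔ ∃ t ∈ u, s ∈ φ t := by
  simp [wordMap]

theorem wordMap_img (φ : A → List A) (k : ℕ) : wordMap (img φ k) = (wordMap φ)^[k] := by
  funext w
  induction w with
  | nil =>
    have : ∀ k, (wordMap φ)^[k] [] = [] := fun k => by
      induction k with
      | zero => rfl
      | succ k ih => rw [Function.iterate_succ_apply', ih, wordMap_nil]
    rw [this, wordMap_nil]
  | cons t u ih =>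
    have : ∀ k u v, (wordMap φ)^[k] (u ++ v) = (wordMap φ)^[k] u ++ (wordMap φ)^[k] v :=
      fun k => by
        induction k with
        | zero => exact fun u v => rfl
        | succ k ih => intro u v; simp only [Function.iterate_succ_apply, wordMap_append, ih]
    rw [wordMap_cons, ih, ← List.singleton_append, this]
    rfl

@[simp] theorem img_zero (φ : A → List A) (t : A) : img φ 0 t = [t] := rfl

@[simp] theorem img_one (φ : A → List A) : img φ 1 = φ := by
  funext t; simp [img]

theorem img_add (φ : A → List A) (k l : ℕ) (t : A) :
    img φ (k + l) t = wordMap (img φ l) (img φ k t) := by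
  rw [wordMap_img, img, img, ← Function.iterate_add_apply, add_comm]

theorem img_succ (φ : A → List A) (k : ℕ) (t : A) :
    img φ (k + 1) t = wordMap φ (img φ k t) := by
  rw [img_add, img_one]

theorem img_succ' (φ : A → List A) (k : ℕ) (t : A) :
    img φ (k + 1) t = wordMap (img φ k) (φ t) := by
  rw [add_comm, img_add, img_one]

theorem img_img (φ : A → List A) (p k : ℕ) : img (img φ p) k = img φ (p * k) := by
  funext t
  rw [img, wordMap_img, ← Function.iterate_mul]
  rfl

theorem wordMap_wordMap (φ : A → List A) (k l : ℕ) (u : List A) :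
    wordMap (img φ l) (wordMap (img φ k) u) = wordMap (img φ (k + l)) u := by
  rw [wordMap_img, wordMap_img, wordMap_img, ← Function.iterate_add_apply, add_comm]

theorem length_wordMap_le {φ : A → List A} {W : ℕ} {u : List A}
    (h : ∀ t ∈ u, (φ t).length ≤ W) : (wordMap φ u).length ≤ u.length * W := by
  induction u with
  | nil => simp
  | cons t u ih =>
    have h1 := h t (by simp)
    have h2 := ih fun s hs => h s (by simp [hs])
    simp only [wordMap_cons, List.length_append, List.length_cons]
    linarith

theorem le_length_wordMap {φ : A → List A} {W : ℕ} {u : List A}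
    (h : ∀ t ∈ u, W ≤ (φ t).length) : u.length * W ≤ (wordMap φ u).length := by
  induction u with
  | nil => simp
  | cons t u ih =>
    have h1 := h t (by simp)
    have h2 := ih fun s hs => h s (by simp [hs])
    simp only [wordMap_cons, List.length_append, List.length_cons]
    linarith

theorem length_le_wordMap_of_mem {φ : A → List A} {u : List A} {t : A} (h : t ∈ u) :
    (φ t).length ≤ (wordMap φ u).length := by
  obtain ⟨x, y, rfl⟩ := List.append_of_mem h
  simp
  omega

theorem exists_length_le [Finite A] (φ : A → List A) : ∃ W, 1 ≤ W ∧ ∀ t, (φ t).length ≤ W := by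
  obtain ⟨W, hW⟩ := (Set.finite_range fun t => (φ t).length).bddAbove
  exact ⟨W + 1, by omega, fun t => (hW ⟨t, rfl⟩).trans (by omega)⟩

/-- A deterministic sequence in a finite set has an idempotent index. -/
theorem exists_idempotent_index {Y : Type*} (X : ℕ → Y) (hfin : (Set.range X).Finite)
    (hdet : ∀ k l, X k = X l → X (k + 1) = X (l + 1)) (N : ℕ) :
    ∃ p, N ≤ p ∧ 1 ≤ p ∧ X (p + p) = X p := by
  obtain ⟨k, -, l, -, hne, hkl⟩ := Set.infinite_univ.exists_ne_map_eq_of_mapsTo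
    (f := X) (t := Set.range X) (fun k _ => ⟨k, rfl⟩) hfin
  wlog hlt : k < l generalizing k l
  · exact this l k hne.symm hkl.symm (by omega)
  obtain ⟨q, rfl⟩ := Nat.exists_eq_add_of_lt hlt
  have hshift : ∀ m, X (k + m) = X (k + m + (q + 1)) := by
    intro m
    induction m with
    | zero => simpa [add_assoc] using hkl
    | succ m ih => convert hdet _ _ ih using 2 <;> omega
  have hmul : ∀ c m, X (k + m) = X (k + m + c * (q + 1)) := by
    intro c
    induction c with
    | zero => simp
    | succ c ih =>
      intro m
      rw [hshift m, add_assoc k m, ih (m + (q + 1))]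
      congr 1
      ring
  refine ⟨(N + k + 1) * (q + 1), by nlinarith, by nlinarith, ?_⟩
  have hk : k ≤ (N + k + 1) * (q + 1) := by nlinarith
  obtain ⟨m, hm⟩ := Nat.exists_eq_add_of_le hk
  have := hmul (N + k + 1) m
  rw [← hm] at this
  exact this.symm

/-! ### Fixed points -/

/-- `α` is fixed by `φ`; the image of the letter at position `i` starts at position `D i`. -/
structure FixedBy (φ : A → List A) (α : ℕ → A) (D : ℕ → ℕ) : Prop where
  zero : D 0 = 0
  succ : ∀ i, D (i + 1) = D i + (φ (α i)).length
  step : ∀ i, factorAt α (D i) (φ (α i)).length = φ (α i)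

theorem self_lt_iterate {D : ℕ → ℕ} (hD : ∀ j, 1 ≤ j → j < D j) {k : ℕ} (hk : 1 ≤ k) :
    ∀ j, 1 ≤ j → j < D^[k] j := by
  intro j hj
  induction k, hk using Nat.le_induction with
  | base => exact hD j hj
  | succ k hk ih =>
    rw [Function.iterate_succ_apply']
    exact ih.trans (hD _ (by omega))

theorem le_iterate {D : ℕ → ℕ} (hD : ∀ j, 1 ≤ j → j < D j) (k j : ℕ) :
    j ≤ D^[k] j := by
  rcases Nat.eq_zero_or_pos k with rfl | hk
  · rfl
  · rcases Nat.eq_zero_or_pos j with rfl | hj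
    · exact Nat.zero_le _
    · exact (self_lt_iterate hD hk j hj).le

theorem add_le_iterate {D : ℕ → ℕ} (hD : ∀ j, 1 ≤ j → j < D j) {j : ℕ} (hj : 1 ≤ j)
    (k : ℕ) : j + k ≤ D^[k] j := by
  induction k with
  | zero => rfl
  | succ k ih =>
    rw [Function.iterate_succ_apply']
    have := hD (D^[k] j) (by omega)
    omega

namespace FixedBy
variable {φ : A → List A} {α : ℕ → A} {D : ℕ → ℕ}

theorem add (h : FixedBy φ α D) (i m : ℕ) :
    D (i + m) = D i + (wordMap φ (factorAt α i m)).length := by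
  induction m with
  | zero => simp
  | succ m ih =>
    rw [← add_assoc, h.succ, ih, factorAt_succ]
    simp [add_assoc]

theorem map_factorAt (h : FixedBy φ α D) (i m : ℕ) :
    wordMap φ (factorAt α i m) = factorAt α (D i) (wordMap φ (factorAt α i m)).length := by
  induction m with
  | zero => simp
  | succ m ih =>
    rw [factorAt_succ, wordMap_append, List.length_append, factorAt_add, ← ih, ← h.add,
      wordMap_singleton, h.step]

theorem map_factorAt' (h : FixedBy φ α D) (i m : ℕ) :
    wordMap φ (factorAt α i m) = factorAt α (D i) (D (i + m) - D i) := by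
  rw [h.map_factorAt, h.add]
  simp

theorem mono (h : FixedBy φ α D) : Monotone D :=
  monotone_nat_of_le_succ fun i => by rw [h.succ]; omega

theorem iterate (h : FixedBy φ α D) (k : ℕ) : FixedBy (img φ k) α (D^[k]) := by
  induction k with
  | zero => exact ⟨rfl, fun i => rfl, fun i => by simp [factorAt_one]⟩
  | succ k ih =>
    have hs : ∀ i, D^[k + 1] (i + 1) = D^[k + 1] i + (img φ (k + 1) (α i)).length := by
      intro i
      rw [Function.iterate_succ_apply', Function.iterate_succ_apply', ih.succ, h.add, ih.step,
        img_succ]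
    refine ⟨?_, hs, fun i => ?_⟩
    · rw [Function.iterate_succ_apply', ih.zero, h.zero]
    · rw [img_succ, ← ih.step i, Function.iterate_succ_apply', ← h.map_factorAt]

theorem sub_eq (h : FixedBy φ α D) (i : ℕ) : D (i + 1) - D i = (φ (α i)).length := by
  rw [h.succ]; omega

/-- Equal factors have equal images. -/
theorem congr (h : FixedBy φ α D) {i j m : ℕ} (hij : ∀ r < m, α (i + r) = α (j + r)) :
    D (i + m) - D i = D (j + m) - D j ∧
      ∀ s < D (i + m) - D i, α (D i + s) = α (D j + s) := by
  have hw := (factorAt_eq_iff α i j m).2 hij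
  have hl : D (i + m) - D i = D (j + m) - D j := by rw [h.add, h.add, hw]; omega
  refine ⟨hl, ?_⟩
  rw [← factorAt_eq_iff, ← h.map_factorAt', hw, h.map_factorAt', hl]

theorem mem_image (h : FixedBy φ α D) {i : ℕ} {t : A} :
    t ∈ φ (α i) ↔ ∃ s, D i ≤ s ∧ s < D (i + 1) ∧ α s = t := by
  rw [← h.step, mem_factorAt, h.succ]

/-- Every position lies in the image of a letter. -/
theorem exists_block (h : FixedBy φ α D) (hD : ∀ j, 1 ≤ j → j < D j) (k x : ℕ) :
    ∃ j, D^[k] j ≤ x ∧ x < D^[k] (j + 1) := by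
  have hex : ∃ j, x < D^[k] j := ⟨x + 1, (le_iterate hD k (x + 1))⟩
  classical
  have h0 : Nat.find hex ≠ 0 := by
    intro h0
    have := Nat.find_spec hex
    rw [h0, (h.iterate k).zero] at this
    omega
  refine ⟨Nat.find hex - 1, ?_, ?_⟩
  · exact not_lt.1 (Nat.find_min hex (by omega))
  · rw [Nat.sub_add_cancel (by omega)]
    exact Nat.find_spec hex

theorem exists_block_one (h : FixedBy φ α D) (hD : ∀ j, 1 ≤ j → j < D j) (x : ℕ) :
    ∃ j, D j ≤ x ∧ x < D (j + 1) :=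
  h.exists_block hD 1 x

end FixedBy

theorem IsFixedSeq.exists_fixedBy {φ : A → List A} {a : A} {α : ℕ → A}
    (hpro : Prolongable φ a) (hfix : IsFixedSeq φ a α) :
    ∃ D, FixedBy φ α D ∧ ∀ j, 1 ≤ j → j < D j := by
  have hpre : ∀ j, factorAt α 0 (wordMap φ (factorAt α 0 j)).length
      = wordMap φ (factorAt α 0 j) := by
    intro j
    obtain ⟨n, hn⟩ := (hpro.2.eventually_ge_atTop j).exists
    have h1 := hfix n
    have h2 := hfix (n + 1)
    rw [Function.iterate_succ_apply'] at h2
    obtain ⟨m, hm⟩ := Nat.exists_eq_add_of_le hn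
    rw [hm, factorAt_add] at h1
    rw [← h1, wordMap_append, List.length_append, factorAt_add] at h2
    exact (List.append_inj h2 (by simp)).1
  set D : ℕ → ℕ := fun j => (wordMap φ (factorAt α 0 j)).length with hDdef
  have hF : FixedBy φ α D := by
    refine ⟨by simp [hDdef], fun i => by simp [hDdef, factorAt_succ], fun i => ?_⟩
    have h1 := hpre (i + 1)
    rw [factorAt_succ, wordMap_append, List.length_append, factorAt_add, hpre i,
      wordMap_singleton, zero_add, zero_add] at h1
    exact List.append_cancel_left h1
  have ha : α 0 = a := by
    have := hfix 0
    simpa [factorAt_one] using this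
  have hlen : ∀ n, D^[n] 1 = ((wordMap φ)^[n] [a]).length := by
    intro n
    have := (hF.iterate n).succ 0
    rw [(hF.iterate n).zero, ha, zero_add, zero_add] at this
    exact this
  refine ⟨D, hF, fun j hj => ?_⟩
  by_contra hle
  have hb : ∀ n, D^[n] 1 ≤ j := by
    intro n
    induction n with
    | zero => exact hj
    | succ n ih =>
      rw [Function.iterate_succ_apply']
      exact (hF.mono ih).trans (not_lt.1 hle)
  obtain ⟨n, hn⟩ := (hpro.2.eventually_ge_atTop (j + 1)).exists
  have := hb n
  rw [hlen] at this
  omega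

/-! ### Stabilization of prefixes of iterated images -/

theorem take_append_congr {n : ℕ} {x x' y y' : List A} (hx : x.take n = x'.take n)
    (hy : y.take n = y'.take n) : (x ++ y).take n = (x' ++ y').take n := by
  have hl := congrArg List.length hx
  simp only [List.length_take] at hl
  have hs : n - x.length = n - x'.length := by omega
  rw [List.take_append, List.take_append, hx, hs]
  congr 1
  have := congrArg (List.take (n - x'.length)) hy
  rwa [List.take_take, List.take_take, min_eq_left (by omega)] at this

theorem take_congr_of_le {m n : ℕ} {x y : List A} (h : x.take n = y.take n) (hm : m ≤ n) :
    x.take m = y.take m := by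
  have := congrArg (List.take m) h
  rwa [List.take_take, List.take_take, min_eq_left hm] at this

theorem take_append_append_congr {m n : ℕ} {x y y' s s' : List A} (h : y.take m = y'.take m)
    (hy : m ≤ y.length) (hy' : m ≤ y'.length) (hn : n ≤ x.length + m) :
    (x ++ (y ++ s)).take n = (x ++ (y' ++ s')).take n := by
  have hcut : ∀ y s : List A, m ≤ y.length →
      (x ++ (y ++ s)).take n = x.take n ++ y.take (n - x.length) := fun y s hy => by
    rw [List.take_append, List.take_append_of_le_length (by omega)]
  rw [hcut y s hy, hcut y' s' hy', take_congr_of_le h (by omega)]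

theorem take_wordMap_congr {n : ℕ} {φ ψ : A → List A} (h : ∀ t, (φ t).take n = (ψ t).take n)
    (u : List A) : (wordMap φ u).take n = (wordMap ψ u).take n := by
  induction u with
  | nil => rfl
  | cons t u ih =>
    rw [wordMap_cons, wordMap_cons]
    exact take_append_congr (h t) ih

theorem length_img_mono {φ : A → List A} (hne : ∀ t, φ t ≠ []) (t : A) :
    Monotone fun k => (img φ k t).length := by
  refine monotone_nat_of_le_succ fun k => ?_
  rw [img_succ]
  simpa using le_length_wordMap (W := 1) (u := img φ k t)
    fun s _ => List.length_pos_iff.2 (hne s)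

/-- Prefixes stabilize as soon as all images are long enough, provided that the first letter map
is idempotent. -/
theorem take_img_of_long {φ : A → List A} (hne : ∀ t, φ t ≠ []) {e : A → A}
    (he : ∀ t, ∃ z, φ t = e t :: z) (hee : ∀ t, e (e t) = e t) {n K : ℕ}
    (hK : ∀ t, n ≤ (img φ K t).length) {K' : ℕ} (hK' : K + 1 ≤ K') (t : A) :
    (img φ K' t).take n = (img φ (K + 1) t).take n := by
  have hstep : ∀ k, K ≤ k → ∀ t, (img φ (k + 1) t).take n = (img φ k (e t)).take n := by
    intro k hk t
    obtain ⟨z, hz⟩ := he t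
    rw [img_succ', hz, wordMap_cons, List.take_append_of_le_length]
    exact (hK _).trans (length_img_mono hne _ hk)
  induction K', hK' using Nat.le_induction with
  | base => rfl
  | succ k hk ih =>
    obtain ⟨k, rfl⟩ : ∃ l, k = l + 1 := ⟨k - 1, by omega⟩
    rw [← ih, hstep _ (by omega), hstep _ (by omega), hstep _ (by omega), hee]

/-- Prefixes stabilize linearly fast, provided that `φ` is idempotent on the bounded letters and
so is the map to the first growing letter. -/
theorem take_img_of_idempotent {φ : A → List A} (hne : ∀ t, φ t ≠ []) {G : A → Prop}
    (hB : ∀ t, ¬ G t → wordMap φ (φ t) = φ t) {e : A → A} (hG : ∀ t, G t → G (e t))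
    (he : ∀ t, G t → ∃ v z, φ t = v ++ e t :: z ∧ ∀ s ∈ v, ¬ G s)
    (hee : ∀ t, G t → e (e t) = e t) (hfix : ∀ t, G t → φ t ≠ [t]) (n : ℕ) {K : ℕ}
    (hK : n + 2 ≤ K) (t : A) : (img φ K t).take n = (img φ (n + 2) t).take n := by
  have hBimg : ∀ k t, ¬ G t → img φ (k + 1) t = φ t := by
    intro k t ht
    induction k with
    | zero => simp
    | succ k ih => rw [img_succ, ih, hB t ht]
  have hBword : ∀ k v, (∀ s ∈ v, ¬ G s) → wordMap (img φ (k + 1)) v = wordMap φ v := by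
    intro k v hv
    induction v with
    | nil => rfl
    | cons s v ih =>
      rw [wordMap_cons, wordMap_cons, ih fun r hr => hv r (by simp [hr]),
        hBimg _ _ (hv s (by simp))]
  have hlen : ∀ k g, G g → e g = g → k + 1 ≤ (img φ k g).length := by
    intro k g hg heg
    induction k with
    | zero => simp
    | succ k ih =>
      obtain ⟨v, z, hz, -⟩ := he g hg
      rw [heg] at hz
      have hvz : 1 ≤ v.length + z.length := by
        by_contra hcon
        have h1 : v = [] := List.length_eq_zero_iff.1 (by omega)
        have h2 : z = [] := List.length_eq_zero_iff.1 (by omega)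
        exact hfix g hg (by simp [hz, h1, h2])
      have hpos : ∀ s, 1 ≤ (img φ k s).length :=
        fun s => length_img_mono hne s (Nat.zero_le k)
      have hv := le_length_wordMap (u := v) (fun s _ => hpos s)
      have hz' := le_length_wordMap (u := z) (fun s _ => hpos s)
      rw [img_succ', hz]
      simp only [wordMap_append, wordMap_cons, List.length_append]
      omega
  have hself : ∀ n k g, n + 1 ≤ k → G g → e g = g →
      (img φ k g).take n = (img φ (k + 1) g).take n := by
    intro n
    induction n with
    | zero => intros; simp
    | succ n ih =>
      intro k g hk hg heg
      obtain ⟨k, rfl⟩ : ∃ l, k = l + 2 := ⟨k - 2, by omega⟩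
      obtain ⟨v, z, hz, hv⟩ := he g hg
      rw [heg] at hz
      rcases eq_or_ne v [] with rfl | hv0
      · rw [img_succ' φ (k + 2), hz, List.nil_append, wordMap_cons,
          List.take_append_of_le_length]
        exact (by omega : n + 1 ≤ k + 2 + 1).trans (hlen _ g hg heg)
      · rw [img_succ' φ (k + 2), img_succ' φ (k + 1), hz]
        simp only [wordMap_append, wordMap_cons]
        rw [hBword _ _ hv, hBword _ _ hv]
        refine take_append_append_congr (m := n) (ih _ g (by omega) hg heg)
          ((by omega : n ≤ k + 1 + 1).trans (hlen _ g hg heg))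
          ((by omega : n ≤ k + 2 + 1).trans (hlen _ g hg heg)) ?_
        have h1 := le_length_wordMap (φ := φ) (W := 1) (u := v)
          fun s _ => List.length_pos_iff.2 (hne s)
        have h2 := List.length_pos_iff.2 hv0
        omega
  induction K, hK using Nat.le_induction with
  | base => rfl
  | succ k hk ih =>
    obtain ⟨k, rfl⟩ : ∃ l, k = l + 2 := ⟨k - 2, by omega⟩
    rw [← ih]
    by_cases hg : G t
    · obtain ⟨v, z, hz, hv⟩ := he t hg
      rw [img_succ' φ (k + 2), img_succ' φ (k + 1), hz]
      simp only [wordMap_append, wordMap_cons]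
      rw [hBword _ _ hv, hBword _ _ hv]
      exact take_append_append_congr (m := n)
        (hself n _ _ (by omega) (hG _ hg) (hee _ hg)).symm
        ((by omega : n ≤ k + 2 + 1).trans (hlen _ _ (hG _ hg) (hee _ hg)))
        ((by omega : n ≤ k + 1 + 1).trans (hlen _ _ (hG _ hg) (hee _ hg))) (by omega)
    · rw [hBimg _ _ hg, hBimg _ _ hg]

theorem wordMap_reverse (φ : A → List A) (u : List A) :
    wordMap (fun t => (φ t).reverse) u.reverse = (wordMap φ u).reverse := by
  induction u with
  | nil => rfl
  | cons t u ih => simp [ih]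

theorem img_reverse (φ : A → List A) (k : ℕ) (t : A) :
    img (fun t => (φ t).reverse) k t = (img φ k t).reverse := by
  induction k with
  | zero => rfl
  | succ k ih => rw [img_succ, ih, wordMap_reverse, img_succ]

/-! ### The general upper bound -/

theorem take_factorAt (α : ℕ → A) (i : ℕ) {m n : ℕ} (h : m ≤ n) :
    (factorAt α i n).take m = factorAt α i m := by
  obtain ⟨k, rfl⟩ := Nat.exists_eq_add_of_le h
  rw [factorAt_add, List.take_left' (by simp)]

theorem reverse_take_reverse_factorAt (α : ℕ → A) (i m o : ℕ) :
    ((factorAt α i (m + o)).reverse.take o).reverse = factorAt α (i + m) o := by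
  rw [factorAt_add, List.reverse_append, List.take_left' (by simp), List.reverse_reverse]

theorem drop_factorAt (α : ℕ → A) (i m n : ℕ) :
    (factorAt α i (m + n)).drop m = factorAt α (i + m) n := by
  rw [factorAt_add, List.drop_left' (by simp)]

/-- The letters of length-`n` prefixes and suffixes of iterated images no longer change from
the `Q`-th iterate on. -/
def StableFrom (φ : A → List A) (n Q : ℕ) : Prop :=
  ∀ K, Q ≤ K → ∀ t, (img φ K t).take n = (img φ Q t).take n ∧
    (img φ K t).reverse.take n = (img φ Q t).reverse.take n

open Classical in
/-- Each factor of length `n` is cut by the image boundaries of a last level `K`, and is determined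
by `K`, the letter one level up, and the position of the boundary. -/
theorem FixedBy.exists_complexity_le [Finite A] {φ : A → List A} {α : ℕ → A} {D : ℕ → ℕ}
    (h : FixedBy φ α D) (hD : ∀ j, 1 ≤ j → j < D j) :
    ∃ C, ∀ n Q, StableFrom φ n Q → complexity α n ≤ C * (n + 1) *
      (1 + ((Finset.range Q).filter fun K => ∃ t, n ≤ (img φ (K + 1) t).length).card) := by
  obtain ⟨W, hW1, hW⟩ := exists_length_le φ
  refine ⟨1 + Nat.card A * W, fun n Q hQ => ?_⟩
  set S := (Finset.range Q).filter fun K => ∃ t, n ≤ (img φ (K + 1) t).length with hS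
  have := Fintype.ofFinite A
  rw [Nat.card_eq_fintype_card]
  let f : Option (ℕ × A × ℕ × ℕ) → List A := fun x => x.elim (factorAt α 0 n) fun y =>
    ((wordMap (img φ y.1) ((φ y.2.1).take y.2.2.1)).reverse.take y.2.2.2).reverse ++
      (wordMap (img φ y.1) ((φ y.2.1).drop y.2.2.1)).take (n - y.2.2.2)
  have key := complexity_le_card α n
    (Finset.insertNone (insert Q S ×ˢ Finset.univ ×ˢ Finset.range W ×ˢ Finset.range (n + 1))) f ?_
  · refine key.trans ?_
    simp only [Finset.card_insertNone, Finset.card_product, Finset.card_range, Finset.card_univ]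
    have h1 : (insert Q S).card ≤ 1 + S.card := by
      rw [add_comm]
      exact Finset.card_insert_le _ _
    have h2 := Nat.mul_le_mul_right (Fintype.card A * (W * (n + 1))) h1
    nlinarith [Nat.zero_le (n * S.card), Nat.zero_le S.card, Nat.zero_le n]
  · intro i
    rcases Nat.eq_zero_or_pos i with rfl | hi
    · exact ⟨none, by simp, rfl⟩
    let P : ℕ → Prop := fun K => ∃ j, 1 ≤ j ∧ i ≤ D^[K] j ∧ D^[K] j ≤ i + n
    have hP0 : P 0 := ⟨i, hi, le_rfl, by simp⟩
    have hPb : ∀ K, P K → K ≤ i + n := by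
      rintro K ⟨j, hj, -, h2⟩
      have := add_le_iterate hD hj K
      omega
    set K := Nat.findGreatest P (i + n) with hK
    have hPK : P K := Nat.findGreatest_spec (P := P) (Nat.zero_le _) hP0
    have hPK1 : ¬ P (K + 1) := fun hc => by
      have := Nat.le_findGreatest (hPb _ hc) hc
      omega
    obtain ⟨j, hj, hj1, hj2⟩ := hPK
    obtain ⟨l, hl1, hl2⟩ := h.exists_block hD (K + 1) i
    have hl3 : D^[K + 1] l < i := by
      rcases Nat.eq_zero_or_pos l with rfl | hl
      · rw [(h.iterate _).zero]; exact hi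
      · exact lt_of_le_of_ne hl1 fun hc => hPK1 ⟨l, hl, hc.ge, by omega⟩
    have hl4 : i + n < D^[K + 1] (l + 1) := by
      by_contra hc
      exact hPK1 ⟨l + 1, by omega, hl2.le, by omega⟩
    have hlen := (h.iterate (K + 1)).succ l
    rw [Function.iterate_succ_apply] at hl3 hl4
    have hm := (h.iterate K).mono
    have hlj : D l < j := hm.reflect_lt (hl3.trans_le hj1)
    have hjl : j < D (l + 1) := hm.reflect_lt (hj2.trans_lt hl4)
    obtain ⟨r, rfl⟩ := Nat.exists_eq_add_of_lt hlj
    obtain ⟨q, hq⟩ := Nat.exists_eq_add_of_lt hjl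
    have hφl : (φ (α l)).length = r + 1 + (q + 1) := by
      have := h.succ l
      omega
    have htake : (φ (α l)).take (r + 1) = factorAt α (D l) (r + 1) := by
      rw [← h.step l, hφl, take_factorAt _ _ (by omega)]
    have hdrop : (φ (α l)).drop (r + 1) = factorAt α (D l + r + 1) (q + 1) := by
      rw [← h.step l, hφl, drop_factorAt, add_assoc]
    have hw : f (some (K, α l, r + 1, D^[K] (D l + r + 1) - i)) = factorAt α i n := by
      simp only [f, Option.elim, htake, hdrop]
      rw [(h.iterate K).map_factorAt', (h.iterate K).map_factorAt', ← add_assoc (D l) r 1,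
        ← add_assoc (D l + r + 1) q 1, ← hq]
      obtain ⟨o, ho⟩ := Nat.exists_eq_add_of_le hj1
      obtain ⟨m, hm'⟩ := Nat.exists_eq_add_of_lt hl3
      rw [take_factorAt _ _ (by omega)]
      have e1 : D^[K] (D l + r + 1) - D^[K] (D l) = (m + 1) + o := by omega
      have e2 : D^[K] (D l + r + 1) - i = o := by omega
      rw [e1, e2, reverse_take_reverse_factorAt]
      have e3 : n = o + (n - o) := by omega
      conv_rhs => rw [e3, factorAt_add]
      rw [ho, hm']
      simp [add_assoc]
    have hmem : r + 1 < W ∧ D^[K] (D l + r + 1) - i < n + 1 := by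
      have := hW (α l)
      omega
    by_cases hKQ : K < Q
    · refine ⟨some (K, α l, r + 1, D^[K] (D l + r + 1) - i), ?_, hw⟩
      simp only [Finset.some_mem_insertNone, Finset.mem_product, Finset.mem_insert, hS,
        Finset.mem_filter, Finset.mem_range, Finset.mem_univ, true_and]
      refine ⟨Or.inr ⟨hKQ, α l, ?_⟩, hmem⟩
      rw [Function.iterate_succ_apply, Function.iterate_succ_apply] at hlen
      omega
    · refine ⟨some (Q, α l, r + 1, D^[K] (D l + r + 1) - i), ?_, ?_⟩
      · simp only [Finset.some_mem_insertNone, Finset.mem_product, Finset.mem_insert,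
          Finset.mem_range, Finset.mem_univ, true_and, true_or]
        exact hmem
      · rw [← hw]
        simp only [f, Option.elim]
        refine congrArg₂ (· ++ ·) (congrArg List.reverse ?_) ?_
        · rw [← wordMap_reverse, ← wordMap_reverse]
          refine take_congr_of_le (n := n) (take_wordMap_congr (fun t => ?_) _) (by omega)
          exact (hQ K (by omega) t).2.symm
        · exact take_congr_of_le (n := n)
            (take_wordMap_congr (fun t => (hQ K (by omega) t).1.symm) _) (by omega)

/-! ### Recoding a fixed point along the occurrences of a set of letters -/

section Recoding
open Classical
open Nat (nth count count_succ count_add count_monotone count_strict_mono nth_mem_of_infinite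
  nth_strictMono nth_le_nth le_nth_count count_nth_of_infinite nth_count nth_zero_of_zero
  count_iff_forall_not count_ne_iff_exists nth_lt_of_lt_count)

theorem nth_count_add_of_agree {α : ℕ → A} {F : A → Prop}
    (hinf : {i | F (α i)}.Infinite) {x y m i : ℕ} (hxy : ∀ r < m, α (x + r) = α (y + r))
    (hi : nth (fun i => F (α i)) (count (fun i => F (α i)) x + i) < x + m) :
    x ≤ nth (fun i => F (α i)) (count (fun i => F (α i)) x + i) ∧
    nth (fun i => F (α i)) (count (fun i => F (α i)) y + i) =
      nth (fun i => F (α i)) (count (fun i => F (α i)) x + i) - x + y := by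
  set p : ℕ → Prop := fun i => F (α i) with hp
  set s := nth p (count p x + i) with hs
  have hxs : x ≤ s := (le_nth_count hinf x).trans ((nth_le_nth hinf).2 (by omega))
  refine ⟨hxs, ?_⟩
  have hps : p s := nth_mem_of_infinite hinf _
  have hcs : count p s = count p x + i := count_nth_of_infinite hinf _
  have hag : ∀ r ≤ m, count (fun k => p (x + k)) r = count (fun k => p (y + k)) r := by
    intro r hr
    induction r with
    | zero => simp
    | succ r ih =>
      rw [count_succ, count_succ, ih (by omega)]
      simp only [hp, hxy r (by omega)]
  have h1 : count p (s - x + y) = count p y + i := by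
    have h2 := count_add p x (s - x)
    have h3 := count_add p y (s - x)
    rw [hag (s - x) (by omega), Nat.add_sub_cancel' hxs] at h2
    rw [add_comm (s - x) y]
    omega
  have h2 : p (s - x + y) := by
    have := hxy (s - x) (by omega)
    rw [Nat.add_sub_cancel' hxs] at this
    simp only [hp] at hps ⊢
    rw [add_comm, ← this]
    exact hps
  rw [← h1, nth_count h2]

/-- If the letters satisfying `F` occur in `α` with bounded gaps, and `F` is compatible with `φ`,
then coding `α` by the words between occurrences gives the fixed point of a nonerasing morphism
of comparable complexity. -/
theorem FixedBy.exists_recoding [Finite A] {φ : A → List A} {α : ℕ → A} {D : ℕ → ℕ}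
    (h : FixedBy φ α D) (hD : ∀ j, 1 ≤ j → j < D j) {F : A → Prop} (h0 : F (α 0))
    (hF : ∀ i, F (α i) → ∃ s ∈ φ (α i), F s) (hS : ∀ i, ¬ F (α i) → ∀ s ∈ φ (α i), ¬ F s)
    {R : ℕ} (hR : ∀ i, ∃ s, i ≤ s ∧ s < i + R ∧ F (α s)) :
    ∃ (T : Set (List A)) (ψ : T → List T) (β : ℕ → T) (E q : ℕ → ℕ), T.Finite ∧ FixedBy ψ β E ∧
      (∀ j, 1 ≤ j → j < E j) ∧ (∀ t, ψ t ≠ []) ∧ Function.Surjective β ∧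
      (∀ j, F (α (q j)) ∧
        ∀ k, (img φ k (α (q j))).length ≤ R * (img ψ k (β j)).length + R) ∧
      (∀ n, complexity α n ≤ (R + 1) * complexity β n) ∧
      (∀ n, complexity β n ≤ complexity α (R * n + 1)) := by
  have hinf : {i | F (α i)}.Infinite := Set.infinite_of_not_bddAbove fun ⟨b, hb⟩ => by
    obtain ⟨s, h1, -, h3⟩ := hR (b + 1)
    have := hb h3
    omega
  set p : ℕ → Prop := fun i => F (α i) with hp
  set q : ℕ → ℕ := nth p with hq
  have hqmono : StrictMono q := nth_strictMono hinf
  have hqF : ∀ j, p (q j) := nth_mem_of_infinite hinf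
  have hcq : ∀ j, count p (q j) = j := count_nth_of_infinite hinf
  have hqle : ∀ X s, X ≤ s → p s → q (count p X) ≤ s := by
    intro X s hXs hs
    have := hqmono.monotone (count_monotone p hXs)
    rwa [hq, nth_count hs] at this
  have hgap : ∀ j, q (j + 1) ≤ q j + R := by
    intro j
    obtain ⟨s, h1, h2, h3⟩ := hR (q j + 1)
    have := hqle (q j + 1) s h1 h3
    rw [count_succ, if_pos (hqF j), hcq] at this
    omega
  have hgaps : ∀ j s, q (j + s) ≤ q j + R * s := by
    intro j s
    induction s with
    | zero => simp
    | succ s ih => have := hgap (j + s); rw [← add_assoc]; linarith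
  have hstep : ∀ j s, q j + s ≤ q (j + s) := by
    intro j s
    induction s with
    | zero => simp
    | succ s ih =>
      have := hqmono (Nat.lt_succ_self (j + s))
      rw [← add_assoc j s 1]
      simp only [Nat.succ_eq_add_one] at this
      omega
  set E : ℕ → ℕ := fun j => count p (D (q j)) with hE
  set b : ℕ → List A := fun j => factorAt α (q j) (q (j + 1) - q j + 1) with hb
  have hbeq : ∀ j j', b j = b j' → q (j + 1) - q j = q (j' + 1) - q j' ∧
      ∀ r < q (j + 1) - q j + 1, α (q j + r) = α (q j' + r) := by
    intro j j' hjj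
    have hl : q (j + 1) - q j = q (j' + 1) - q j' := by
      have := congrArg List.length hjj
      simpa [hb] using this
    refine ⟨hl, ?_⟩
    rw [← factorAt_eq_iff]
    simp only [hb, ← hl] at hjj
    exact hjj
  -- images of equal blocks
  have hblock : ∀ j j', b j = b j' → E (j + 1) - E j = E (j' + 1) - E j' ∧
      ∀ r < E (j + 1) - E j, b (E j + r) = b (E j' + r) := by
    intro j j' hjj
    obtain ⟨hl, hag⟩ := hbeq j j' hjj
    have hlt := hqmono (Nat.lt_succ_self j)
    have hlt' := hqmono (Nat.lt_succ_self j')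
    simp only [Nat.succ_eq_add_one] at hlt hlt'
    obtain ⟨hc1, hc2⟩ := h.congr hag
    obtain ⟨hc3, -⟩ := h.congr (m := q (j + 1) - q j) (fun r hr => hag r (by omega))
    have e1 : q j + (q (j + 1) - q j) = q (j + 1) := by omega
    have e2 : q j' + (q (j + 1) - q j) = q (j' + 1) := by omega
    rw [← add_assoc, ← add_assoc, e1, e2] at hc1
    rw [← add_assoc, e1] at hc2
    rw [e1, e2] at hc3
    have hm1 := h.mono hlt.le
    have hm1' := h.mono hlt'.le
    obtain ⟨t, ht, htF⟩ := hF _ (hqF (j + 1))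
    obtain ⟨s, hs1, hs2, rfl⟩ := h.mem_image.1 ht
    have hm2 : D (q (j + 1)) ≤ D (q (j + 1) + 1) := h.mono (by omega)
    have hlast : q (E (j + 1)) < D (q j) + (D (q (j + 1) + 1) - D (q j)) :=
      (hqle _ s hs1 htF).trans_lt (by omega)
    have hEle : E j ≤ E (j + 1) := count_monotone p hm1
    have key : ∀ r ≤ E (j + 1) - E j, D (q j) ≤ q (E j + r) ∧
        q (E j + r) < D (q j) + (D (q (j + 1) + 1) - D (q j)) ∧
        q (E j' + r) = q (E j + r) - D (q j) + D (q j') := by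
      intro r hr
      have h1 : q (E j + r) < D (q j) + (D (q (j + 1) + 1) - D (q j)) :=
        (hqmono.monotone (by omega)).trans_lt hlast
      obtain ⟨h2, h3⟩ := nth_count_add_of_agree hinf hc2 h1
      exact ⟨h2, h1, h3⟩
    have hcount : ∀ d ≤ D (q (j + 1)) - D (q j), count p (D (q j) + d) - E j =
        count p (D (q j') + d) - E j' := by
      intro d hd
      rw [count_add, count_add]
      simp only [hE, Nat.add_sub_cancel_left]
      induction d with
      | zero => simp
      | succ d ih =>
        rw [count_succ, count_succ, ih (by omega)]
        simp only [hp, hc2 d (by omega)]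
    refine ⟨?_, fun r hr => ?_⟩
    · have := hcount _ le_rfl
      rw [Nat.add_sub_cancel' hm1, hc3, Nat.add_sub_cancel' hm1'] at this
      exact this
    · obtain ⟨k1, k2, k3⟩ := key r (by omega)
      obtain ⟨l1, l2, l3⟩ := key (r + 1) (by omega)
      have hlt1 := hqmono (Nat.lt_succ_self (E j + r))
      simp only [Nat.succ_eq_add_one] at hlt1
      rw [← add_assoc] at l1 l2 l3
      rw [← add_assoc] at l3
      simp only [hb]
      rw [l3, k3]
      have e3 : q (E j + r + 1) - D (q j) + D (q j') - (q (E j + r) - D (q j) + D (q j')) + 1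
        = q (E j + r + 1) - q (E j + r) + 1 := by omega
      rw [e3, factorAt_eq_iff]
      intro x hx
      have := hc2 (q (E j + r) - D (q j) + x) (by omega)
      convert this using 2 <;> omega
  have hElt : ∀ j, E j < E (j + 1) := by
    intro j
    obtain ⟨t, ht, htF⟩ := hF _ (hqF j)
    obtain ⟨s, hs1, hs2, rfl⟩ := h.mem_image.1 ht
    have hlt := hqmono (Nat.lt_succ_self j)
    calc E j ≤ count p s := count_monotone p hs1
      _ < count p (s + 1) := count_strict_mono htF (by omega)
      _ ≤ count p (D (q j + 1)) := count_monotone p hs2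
      _ ≤ E (j + 1) := count_monotone p (h.mono hlt)
  let β : ℕ → Set.range b := fun j => ⟨b j, j, rfl⟩
  let ψ : Set.range b → List (Set.range b) := fun t =>
    factorAt β (E t.2.choose) (E (t.2.choose + 1) - E t.2.choose)
  have hψ : ∀ j, ψ (β j) = factorAt β (E j) (E (j + 1) - E j) := by
    intro j
    have hch : b (β j).2.choose = b j := (β j).2.choose_spec
    obtain ⟨h1, h2⟩ := hblock _ _ hch
    change factorAt β (E (β j).2.choose) (E ((β j).2.choose + 1) - E (β j).2.choose) = _
    rw [h1, factorAt_eq_iff]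
    intro r hr
    exact Subtype.ext (h2 r (by omega))
  have hsurj : Function.Surjective β := by
    rintro ⟨-, j, rfl⟩
    exact ⟨j, rfl⟩
  have hFix : FixedBy ψ β E := by
    refine ⟨?_, fun j => ?_, fun j => ?_⟩
    · simp only [hE]
      rw [hq, nth_zero_of_zero h0, h.zero]
      simp
    · rw [hψ, factorAt_length]
      have := hElt j
      omega
    · rw [hψ, factorAt_length]
  have hEiter : ∀ k j, E^[k] j = count p (D^[k] (q j)) := by
    intro k
    induction k with
    | zero => intro j; simp [hcq]
    | succ k ih =>
      intro j
      rw [Function.iterate_succ_apply', Function.iterate_succ_apply', ih]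
      set X := D^[k] (q j)
      have h1 : X ≤ q (count p X) := le_nth_count hinf X
      obtain ⟨d, hd⟩ := Nat.exists_eq_add_of_le (h.mono h1)
      simp only [hE]
      rw [hd, count_add]
      simp only [Nat.add_eq_left]
      rw [count_iff_forall_not]
      intro m hm hpm
      obtain ⟨y, hy1, hy2⟩ := h.exists_block_one hD (D X + m)
      have hXy : X ≤ y := by
        by_contra hlt
        have := h.mono (show y + 1 ≤ X by omega)
        omega
      have hyq : y < q (count p X) := by
        by_contra hlt
        have := h.mono (show q (count p X) ≤ y by omega)
        omega
      by_cases hpy : p y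
      · exact absurd (hqle X y hXy hpy) (by omega)
      · exact hS y hpy _ (h.mem_image.2 ⟨_, hy1, hy2, rfl⟩) hpm
  have hcountR : ∀ x m, m ≤ R * (count p (x + m) - count p x) + R := by
    intro x m
    rcases Nat.lt_or_ge m R with hm | hm
    · omega
    have h1 : ∀ c x, c ≤ count p (x + R * c) - count p x := by
      intro c
      induction c with
      | zero => simp
      | succ c ih =>
        intro x
        have h1 := ih (x + R)
        obtain ⟨s, hs1, hs2, hs3⟩ := hR x
        have h2 : count p x ≤ count p s := count_monotone p hs1
        have h3 : count p s < count p (x + R) := count_strict_mono hs3 hs2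
        have e : x + R * (c + 1) = x + R + R * c := by ring
        rw [e]
        have h4 : count p (x + R) ≤ count p (x + R + R * c) := count_monotone p (by omega)
        omega
    have h2 := h1 (m / R) x
    have h3 : count p (x + R * (m / R)) ≤ count p (x + m) :=
      count_monotone p (by have := Nat.mul_div_le m R; omega)
    have hR0 : 0 < R := by obtain ⟨s, _, _, _⟩ := hR 0; omega
    have h4 := Nat.div_add_mod m R
    have h5 := Nat.mod_lt m hR0
    have h6 : R * (m / R) ≤ R * (count p (x + m) - count p x) :=
      Nat.mul_le_mul_left _ (by omega)
    omega
  have hfin : (Set.range b).Finite := by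
    refine (List.finite_length_le A (R + 1)).subset ?_
    rintro - ⟨j, rfl⟩
    have := hgap j
    simp only [hb, Set.mem_ofPred_eq, factorAt_length]
    omega
  have := hfin.to_subtype
  refine ⟨Set.range b, ψ, β, E, q, hfin, hFix, ?_, ?_, hsurj, fun j => ⟨hqF j, fun k => ?_⟩, ?_, ?_⟩
  · intro j hj
    have h1 : 1 ≤ q j := by have := hstep 0 j; rw [zero_add] at this; omega
    calc j = count p (q j) := (hcq j).symm
      _ < count p (D (q j)) := count_strict_mono (hqF j) (hD _ h1)
  · intro t
    obtain ⟨j, rfl⟩ := hsurj t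
    rw [hψ, ← List.length_pos_iff, factorAt_length]
    have := hElt j
    omega
  · rw [← (h.iterate k).sub_eq, ← (hFix.iterate k).sub_eq, hEiter, hEiter]
    have hlt := hqmono (Nat.lt_succ_self j)
    have h1 := (h.iterate k).mono (show q j ≤ q j + 1 by omega)
    have h2 : count p (D^[k] (q j + 1)) ≤ count p (D^[k] (q (j + 1))) :=
      count_monotone p ((h.iterate k).mono hlt)
    have h3 := hcountR (D^[k] (q j)) (D^[k] (q j + 1) - D^[k] (q j))
    rw [Nat.add_sub_cancel' h1] at h3
    exact h3.trans (Nat.add_le_add_right (Nat.mul_le_mul_left _ (Nat.sub_le_sub_right h2 _)) _)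
  · intro n
    have hidx : ∀ i, ∃ j, q j ≤ i ∧ i < q (j + 1) := by
      intro i
      refine ⟨count p (i + 1) - 1, ?_, ?_⟩
      · have hpos : 0 < count p (i + 1) := by
          rw [Nat.pos_iff_ne_zero, count_ne_iff_exists]
          exact ⟨0, by omega, h0⟩
        have := nth_lt_of_lt_count (p := p) (show count p (i + 1) - 1 < count p (i + 1) by omega)
        simp only [hq]
        omega
      · have hpos : 0 < count p (i + 1) := by
          rw [Nat.pos_iff_ne_zero, count_ne_iff_exists]
          exact ⟨0, by omega, h0⟩
        rw [Nat.sub_add_cancel hpos]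
        exact le_nth_count hinf (i + 1)
    choose g hg1 hg2 using hidx
    refine complexity_le_mul β α n n (R + 1) (fun i => i - q (g i)) g (fun i => ?_) ?_
    · have := hgap (g i)
      have := hg2 i
      omega
    intro i i' hr hw
    rw [factorAt_eq_iff] at hw
    rcases Nat.eq_zero_or_pos n with rfl | hn
    · simp
    have key : ∀ s ≤ n, q (g i + s) - q (g i) = q (g i' + s) - q (g i') ∧
        ∀ r < q (g i + s) - q (g i) + (if s = 0 then 0 else 1),
          α (q (g i) + r) = α (q (g i') + r) := by
      intro s hs
      induction s with
      | zero => simp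
      | succ s ih =>
        obtain ⟨h1, h2⟩ := ih (by omega)
        have h3 : b (g i + s) = b (g i' + s) := congrArg Subtype.val (hw s (by omega))
        obtain ⟨h4, h5⟩ := hbeq _ _ h3
        have a1 := hqmono.monotone (show g i ≤ g i + s by omega)
        have a2 := hqmono.monotone (show g i + s ≤ g i + s + 1 by omega)
        have a3 := hqmono.monotone (show g i' ≤ g i' + s by omega)
        have a4 := hqmono.monotone (show g i' + s ≤ g i' + s + 1 by omega)
        rw [← add_assoc, ← add_assoc]
        refine ⟨by omega, fun r hr => ?_⟩
        simp only [Nat.add_eq_zero_iff, one_ne_zero, and_false, if_false] at hr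
        rcases Nat.lt_or_ge r (q (g i + s) - q (g i)) with hlt | hge
        · exact h2 r (by omega)
        · have := h5 (r - (q (g i + s) - q (g i))) (by omega)
          convert this using 2 <;> omega
    obtain ⟨k1, k2⟩ := key n le_rfl
    rw [if_neg (by omega)] at k2
    rw [factorAt_eq_iff]
    intro r hr
    have b1 := hg1 i
    have b2 := hg2 i
    have b3 := hg1 i'
    have b4 := hstep (g i + 1) (n - 1)
    rw [show g i + 1 + (n - 1) = g i + n by omega] at b4
    have := k2 (i - q (g i) + r) (by omega)
    convert this using 2 <;> omega
  · intro n
    have := complexity_le_mul α β n (R * n + 1) 1 (fun _ => 0) q (fun _ => by simp) ?_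
    · simpa using this
    intro i i' _ hw
    rw [factorAt_eq_iff] at hw ⊢
    have key : ∀ s ≤ n, q (i' + s) = q (i + s) - q i + q i' := by
      intro s hs
      have h1 : q (count p (q i) + s) < q i + (R * n + 1) := by
        rw [hcq]
        have := hgaps i s
        have := Nat.mul_le_mul_left R hs
        omega
      have := (nth_count_add_of_agree hinf hw h1).2
      change q (count p (q i') + s) = q (count p (q i) + s) - q i + q i' at this
      rwa [hcq, hcq] at this
    intro s hs
    apply Subtype.ext
    change b (i + s) = b (i' + s)
    have c1 := key s (by omega)
    have c2 := key (s + 1) (by omega)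
    rw [← add_assoc, ← add_assoc] at c2
    have a1 := hqmono.monotone (show i ≤ i + s by omega)
    have a2 := hqmono.monotone (show i + s ≤ i + s + 1 by omega)
    simp only [hb]
    rw [c1, c2, show q (i + s + 1) - q i + q i' - (q (i + s) - q i + q i') + 1
      = q (i + s + 1) - q (i + s) + 1 by omega, factorAt_eq_iff]
    intro r hr
    have d1 := hgaps i (s + 1)
    have d2 := Nat.mul_le_mul_left R (show s + 1 ≤ n by omega)
    rw [← add_assoc] at d1
    have := hw (q (i + s) - q i + r) (by omega)
    convert this using 2 <;> omega

end Recoding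

/-! ### The five classes -/

theorem eventually_le_log (B : ℝ) : ∀ᶠ n : ℕ in atTop, B ≤ Real.log n :=
  (Real.tendsto_log_atTop.comp tendsto_natCast_atTop_atTop).eventually_ge_atTop B

theorem eventually_le_log_log (B : ℝ) : ∀ᶠ n : ℕ in atTop, B ≤ Real.log (Real.log n) :=
  (Real.tendsto_log_atTop.comp (Real.tendsto_log_atTop.comp tendsto_natCast_atTop_atTop)
    ).eventually_ge_atTop B

theorem eventually_classFun_pos (i : Fin 5) : ∀ᶠ n in atTop, 0 < classFun i n := by
  filter_upwards [eventually_le_log_log 1, eventually_le_log 1, eventually_ge_atTop 1]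
    with n h1 h2 h3
  have h3 : (0 : ℝ) < n := by exact_mod_cast h3
  fin_cases i <;> simp [classFun] <;> positivity

theorem isTheta_classFun_iff {i : Fin 5} {p : ℕ → ℕ} :
    (fun n => (p n : ℝ)) =Θ[atTop] classFun i ↔
      (∃ C : ℝ, ∀ᶠ n in atTop, (p n : ℝ) ≤ C * classFun i n) ∧
      ∃ C : ℝ, ∀ᶠ n in atTop, classFun i n ≤ C * p n := by
  have hpos := eventually_classFun_pos i
  rw [IsTheta, isBigO_iff, isBigO_iff]
  refine and_congr (exists_congr fun C => ?_) (exists_congr fun C => ?_)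
  · refine eventually_congr (hpos.mono fun n hn => ?_)
    rw [Real.norm_of_nonneg hn.le, Real.norm_of_nonneg (by positivity)]
  · refine eventually_congr (hpos.mono fun n hn => ?_)
    rw [Real.norm_of_nonneg hn.le, Real.norm_of_nonneg (by positivity)]

theorem classFun_doubling (i : Fin 5) (R : ℕ) : ∃ C : ℝ, 0 < C ∧ ∀ᶠ m : ℕ in atTop, ∀ n : ℕ, m ≤ n →
    n ≤ R * (m + 1) → classFun i n ≤ C * classFun i m := by
  have hbase : ∀ᶠ m : ℕ in atTop, ∀ n : ℕ, m ≤ n → n ≤ R * (m + 1) →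
      (1 : ℝ) ≤ n ∧ (n : ℝ) ≤ 2 * R * m ∧ 1 ≤ Real.log m ∧ 1 ≤ Real.log (Real.log m) ∧
      Real.log n ≤ 2 * Real.log m ∧ Real.log (Real.log n) ≤ 2 * Real.log (Real.log m) ∧
      1 ≤ Real.log n ∧ 1 ≤ Real.log (Real.log n) := by
    filter_upwards [eventually_le_log_log 1, eventually_le_log 1, eventually_ge_atTop 1,
      eventually_ge_atTop (2 * R)] with m h1 h2 h3 h4 n hmn hn
    have hm1 : (1 : ℝ) ≤ m := by exact_mod_cast h3
    have hn' : (n : ℝ) ≤ R * (m + 1) := by exact_mod_cast hn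
    have h4' : 2 * (R : ℝ) ≤ m := by exact_mod_cast h4
    have hmn' : (m : ℝ) ≤ n := by exact_mod_cast hmn
    have hR : (0 : ℝ) ≤ R := by positivity
    have hn2 : (n : ℝ) ≤ 2 * R * m := by nlinarith
    have hnm2 : (n : ℝ) ≤ (m : ℝ) ^ 2 := by nlinarith
    have hl : Real.log n ≤ 2 * Real.log m := by
      have := Real.log_le_log (by linarith) hnm2
      rwa [Real.log_pow, Nat.cast_ofNat] at this
    have hl1 : Real.log m ≤ Real.log n := Real.log_le_log (by linarith) hmn'
    have hll1 : Real.log (Real.log m) ≤ Real.log (Real.log n) :=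
      Real.log_le_log (by linarith) hl1
    have hll : Real.log (Real.log n) ≤ 2 * Real.log (Real.log m) := by
      have h5 := Real.log_le_log (by linarith) hl
      rw [Real.log_mul (by norm_num) (by linarith)] at h5
      have : Real.log 2 ≤ 1 := by
        have := Real.log_two_lt_d9; linarith
      linarith
    exact ⟨by linarith, hn2, h2, h1, hl, hll, by linarith, by linarith⟩
  refine ⟨4 * R ^ 2 + 4 * R + 1, by positivity, hbase.mono fun m hm n hmn hn => ?_⟩
  obtain ⟨h1, h2, h3, h4, h5, h6, h7, h8⟩ := hm n hmn hn
  have hR : (0 : ℝ) ≤ R := by positivity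
  have hm0 : (0 : ℝ) ≤ m := by positivity
  have key : ∀ x y : ℝ, 0 ≤ y → 0 ≤ x → x ≤ 2 * y →
      n * x ≤ (4 * (R : ℝ) ^ 2 + 4 * R + 1) * (m * y) := by
    intro x y hy hx hxy
    have : (n : ℝ) * x ≤ 2 * R * m * (2 * y) := mul_le_mul h2 hxy hx (by positivity)
    nlinarith [mul_nonneg hm0 hy, mul_nonneg (mul_nonneg hm0 hy) (sq_nonneg (R : ℝ))]
  fin_cases i
  · simp [classFun]; positivity
  · simp [classFun]
    have := key 1 1 (by norm_num) (by norm_num) (by norm_num)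
    simpa using this
  · simpa [classFun] using key _ _ (by linarith) (by linarith) h6
  · simpa [classFun] using key _ _ (by linarith) (by linarith) h5
  · simp [classFun]
    have : (n : ℝ) ^ 2 ≤ (2 * R * m) ^ 2 := by gcongr
    nlinarith [mul_nonneg hm0 hm0, mul_nonneg (mul_nonneg hm0 hm0) hR]

/-- Transfer of the class between words of comparable complexity. -/
theorem isTheta_of_comparable {p p' : ℕ → ℕ} {C R : ℕ} (hmono : Monotone p) (hR : 1 ≤ R)
    (h1 : ∀ n, p n ≤ C * p' n) (h2 : ∀ n, p' n ≤ p (R * n + 1)) {i : Fin 5}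
    (h : (fun n => (p' n : ℝ)) =Θ[atTop] classFun i) :
    (fun n => (p n : ℝ)) =Θ[atTop] classFun i := by
  rw [isTheta_classFun_iff] at h ⊢
  obtain ⟨⟨K, hK⟩, L, hL⟩ := h
  refine ⟨⟨C * K, hK.mono fun n hn => ?_⟩, ?_⟩
  · calc (p n : ℝ) ≤ C * p' n := by exact_mod_cast h1 n
      _ ≤ C * (K * classFun i n) := by gcongr
      _ = _ := by ring
  · obtain ⟨M, hM, hd⟩ := classFun_doubling i (2 * R)
    refine ⟨M * |L|, ?_⟩
    have ht : Tendsto (fun n => (n - 1) / R) atTop atTop :=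
      (Nat.tendsto_div_const_atTop (by omega)).comp (tendsto_sub_atTop_nat 1)
    filter_upwards [ht.eventually hL, ht.eventually hd, eventually_ge_atTop 1] with n a1 a2 a3
    have e1 := Nat.div_add_mod (n - 1) R
    have e2 := Nat.mod_lt (n - 1) (show R > 0 by omega)
    set m := (n - 1) / R
    have e3 : m ≤ R * m := Nat.le_mul_of_pos_left m (by omega)
    have e4 : 2 * R * (m + 1) = 2 * (R * m) + 2 * R := by ring
    have hmn : m ≤ n := by omega
    have hn : n ≤ 2 * R * (m + 1) := by omega
    have h3 : p' m ≤ p n := (h2 m).trans (hmono (by omega))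
    calc classFun i n ≤ M * classFun i m := a2 n hmn hn
      _ ≤ M * (L * p' m) := by gcongr
      _ ≤ M * (|L| * p n) := by
        gcongr
        · exact le_abs_self L
      _ = _ := by ring

theorem classFun_isLittleO {i j : Fin 5} (hij : i < j) :
    classFun i =o[atTop] classFun j := by
  have hlog : Tendsto (fun n : ℕ => Real.log n) atTop atTop :=
    Real.tendsto_log_atTop.comp tendsto_natCast_atTop_atTop
  have hll : Tendsto (fun n : ℕ => Real.log (Real.log n)) atTop atTop :=
    Real.tendsto_log_atTop.comp hlog
  have a0 : classFun 0 =o[atTop] classFun 1 := by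
    simp only [classFun]
    exact (isLittleO_const_left.2 (Or.inr (tendsto_norm_atTop_atTop.comp
      tendsto_natCast_atTop_atTop)))
  have mulO : ∀ f g : ℕ → ℝ, f =o[atTop] g →
      (fun n : ℕ => (n : ℝ) * f n) =o[atTop] fun n : ℕ => (n : ℝ) * g n := fun f g h =>
    (isBigO_refl _ _).mul_isLittleO h
  have a1 : classFun 1 =o[atTop] classFun 2 := by
    simpa [classFun] using mulO (fun _ => 1) (fun n => Real.log (Real.log n))
      (isLittleO_const_left.2 (Or.inr (tendsto_norm_atTop_atTop.comp hll)))
  have a2 : classFun 2 =o[atTop] classFun 3 := by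
    simpa [classFun] using mulO (fun n => Real.log (Real.log n)) (fun n => Real.log n)
      (Real.isLittleO_log_id_atTop.comp_tendsto hlog)
  have a3 : classFun 3 =o[atTop] classFun 4 := by
    simpa [classFun, sq] using mulO (fun n => Real.log n) (fun n => (n : ℝ))
      (Real.isLittleO_log_id_atTop.comp_tendsto tendsto_natCast_atTop_atTop)
  fin_cases i <;> fin_cases j <;> first | (exact absurd hij (by decide)) | skip
  exacts [a0, a0.trans a1, (a0.trans a1).trans a2, ((a0.trans a1).trans a2).trans a3, a1,
    a1.trans a2, (a1.trans a2).trans a3, a2, a2.trans a3, a3]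

theorem classFun_unique {p : ℕ → ℝ} {i j : Fin 5} (hi : p =Θ[atTop] classFun i)
    (hj : p =Θ[atTop] classFun j) : i = j := by
  wlog hlt : i < j generalizing i j
  · rcases lt_trichotomy i j with h | h | h
    · exact this hi hj h
    · exact h
    · exact (this hj hi h).symm
  have h1 : classFun j =O[atTop] classFun i := (hj.symm.trans hi).1
  have h2 := (classFun_isLittleO hlt).trans_isBigO h1
  exact (isLittleO_irrefl ((eventually_classFun_pos i).frequently.mono fun n hn => hn.ne') h2).elim

theorem isTheta_one_of_bounded {p : ℕ → ℕ} {C : ℕ} (h : ∀ n, p n ≤ C) (h1 : ∀ n, 1 ≤ p n) :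
    (fun n => (p n : ℝ)) =Θ[atTop] classFun 0 := by
  rw [isTheta_classFun_iff]
  refine ⟨⟨C, Eventually.of_forall fun n => ?_⟩, 1, Eventually.of_forall fun n => ?_⟩
  · simpa [classFun] using (by exact_mod_cast h n : (p n : ℝ) ≤ C)
  · simpa [classFun] using h1 n

/-! ### Passing to a power -/

theorem find?_wordMap {φ : A → List A} {P : A → Bool}
    (hB : ∀ s, P s = false → (φ s).find? P = none) (hG : ∀ s, P s = true → (φ s).find? P ≠ none)
    (w : List A) : (wordMap φ w).find? P = (w.find? P).bind fun s => (φ s).find? P := by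
  induction w with
  | nil => rfl
  | cons t w ih =>
    rw [wordMap_cons, List.find?_append, ih]
    cases ht : P t with
    | false => simp [hB t ht, ht]
    | true =>
      obtain ⟨s, hs⟩ := Option.ne_none_iff_exists'.1 (hG t ht)
      simp [ht, hs]

open Classical in
/-- Some power of `φ` is idempotent on the letters outside `G`, on the first and last letter of `G`
occurring in an image, and on the sets of letters. -/
theorem exists_idempotent_power [Finite A] {φ : A → List A} {G : A → Prop}
    (hG : ∀ t, G t → ∃ s ∈ φ t, G s) (hB : ∀ t, ¬ G t → ∀ s ∈ φ t, ¬ G s)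
    {M : ℕ} (hM : ∀ t, ¬ G t → ∀ k, (img φ k t).length ≤ M) (N : ℕ) :
    ∃ p, N ≤ p ∧ 1 ≤ p ∧ (∀ t, ¬ G t → wordMap (img φ p) (img φ p t) = img φ p t) ∧
      (∀ t s, s ∈ wordMap (img φ p) (img φ p t) ↔ s ∈ img φ p t) ∧
      ∃ e e' : A → A, ∀ t, G t → (G (e t) ∧ e (e t) = e t ∧
          ∃ v z, img φ p t = v ++ e t :: z ∧ ∀ s ∈ v, ¬ G s) ∧
        G (e' t) ∧ e' (e' t) = e' t ∧
          ∃ v z, (img φ p t).reverse = v ++ e' t :: z ∧ ∀ s ∈ v, ¬ G s := by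
  let P : A → Bool := fun t => decide (G t)
  have hP : ∀ t, P t = true ↔ G t := fun t => by simp [P]
  have hP' : ∀ t, P t = false ↔ ¬ G t := fun t => by simp [P]
  have hGk : ∀ k t, G t → ∃ s ∈ img φ k t, G s := by
    intro k t ht
    induction k with
    | zero => exact ⟨t, by simp, ht⟩
    | succ k ih =>
      obtain ⟨s, hs, hsG⟩ := ih
      obtain ⟨r, hr, hrG⟩ := hG s hsG
      exact ⟨r, by rw [img_succ, mem_wordMap]; exact ⟨s, hs, hr⟩, hrG⟩
  have hBk : ∀ k t, ¬ G t → ∀ s ∈ img φ k t, ¬ G s := by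
    intro k t ht
    induction k with
    | zero => intro s hs; simp at hs; rwa [hs]
    | succ k ih =>
      intro s hs
      rw [img_succ, mem_wordMap] at hs
      obtain ⟨r, hr, hsr⟩ := hs
      exact hB r (ih r hr) s hsr
  have hfind : ∀ k w, (wordMap (img φ k) w).find? P
      = (w.find? P).bind fun s => (img φ k s).find? P := by
    intro k w
    refine find?_wordMap (fun s hs => ?_) (fun s hs => ?_) w
    · rw [List.find?_eq_none]
      intro r hr
      rw [hP]
      exact hBk k s ((hP' s).1 hs) r hr
    · obtain ⟨r, hr, hrG⟩ := hGk k s ((hP s).1 hs)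
      rw [Ne, List.find?_eq_none]
      exact fun h => h r hr ((hP r).2 hrG)
  have hfindr : ∀ k w, (wordMap (img φ k) w).reverse.find? P
      = (w.reverse.find? P).bind fun s => (img φ k s).reverse.find? P := by
    intro k w
    rw [← wordMap_reverse]
    refine find?_wordMap (fun s hs => ?_) (fun s hs => ?_) _
    · rw [List.find?_eq_none]
      intro r hr
      rw [hP]
      exact hBk k s ((hP' s).1 hs) r (List.mem_reverse.1 hr)
    · obtain ⟨r, hr, hrG⟩ := hGk k s ((hP s).1 hs)
      rw [Ne, List.find?_eq_none]
      exact fun h => h r (List.mem_reverse.2 hr) ((hP r).2 hrG)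
  let X : ℕ → A → List A × Option A × Option A × Set A := fun k t =>
    (if G t then [] else img φ k t, (img φ k t).find? P, (img φ k t).reverse.find? P,
      {s | s ∈ img φ k t})
  have hfin : (Set.range X).Finite := by
    have hf : ({l : List A | l.length ≤ M} ×ˢ
        (Set.univ : Set (Option A × Option A × Set A))).Finite :=
      (List.finite_length_le A M).prod Set.finite_univ
    refine (Set.Finite.pi' fun _ : A => hf).subset ?_
    rintro - ⟨k, rfl⟩ t
    refine ⟨?_, trivial⟩
    by_cases ht : G t
    · simp [X, ht]
    · simpa [X, ht] using hM t ht k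
  have hdet : ∀ k l, X k = X l → X (k + 1) = X (l + 1) := by
    intro k l hkl
    funext t
    have ht := congrFun hkl t
    simp only [X, Prod.mk.injEq] at ht ⊢
    obtain ⟨h1, h2, h3, h4⟩ := ht
    have f1 := hfind 1
    have f2 := hfindr 1
    rw [img_one] at f1 f2
    rw [img_succ, img_succ]
    refine ⟨?_, ?_, ?_, ?_⟩
    · by_cases ht : G t
      · simp [ht]
      · simp only [ht, if_false] at h1 ⊢
        rw [h1]
    · rw [f1, f1, h2]
    · rw [f2, f2, h3]
    · ext s
      simp only [Set.mem_ofPred_eq, mem_wordMap]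
      have h5 : ∀ r, r ∈ img φ k t ↔ r ∈ img φ l t := fun r => Set.ext_iff.1 h4 r
      simp only [h5]
  obtain ⟨p, hp1, hp2, hpp⟩ := exists_idempotent_index X hfin hdet N
  have hX : ∀ t, X (p + p) t = X p t := fun t => congrFun hpp t
  simp only [X, Prod.mk.injEq, img_add] at hX
  refine ⟨p, hp1, hp2, fun t ht => ?_, fun t s => Set.ext_iff.1 (hX t).2.2.2 s, ?_⟩
  · simpa [ht] using (hX t).1
  let e : A → A := fun t => ((img φ p t).find? P).getD t
  let e' : A → A := fun t => ((img φ p t).reverse.find? P).getD t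
  have he : ∀ t, G t → (img φ p t).find? P = some (e t) := by
    intro t ht
    obtain ⟨r, hr, hrG⟩ := hGk p t ht
    have : (img φ p t).find? P ≠ none := by
      rw [Ne, List.find?_eq_none]
      exact fun h => h r hr ((hP r).2 hrG)
    obtain ⟨s, hs⟩ := Option.ne_none_iff_exists'.1 this
    simp [e, hs]
  have he' : ∀ t, G t → (img φ p t).reverse.find? P = some (e' t) := by
    intro t ht
    obtain ⟨r, hr, hrG⟩ := hGk p t ht
    have : (img φ p t).reverse.find? P ≠ none := by
      rw [Ne, List.find?_eq_none]
      exact fun h => h r (List.mem_reverse.2 hr) ((hP r).2 hrG)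
    obtain ⟨s, hs⟩ := Option.ne_none_iff_exists'.1 this
    simp [e', hs]
  refine ⟨e, e', fun t ht => ?_⟩
  have h1 := he t ht
  have h2 := he' t ht
  obtain ⟨g1, v, z, hv, hv'⟩ := List.find?_eq_some_iff_append.1 h1
  obtain ⟨g2, v', z', hw, hw'⟩ := List.find?_eq_some_iff_append.1 h2
  rw [hP] at g1 g2
  have h3 := (hX t).2.1
  have h4 := (hX t).2.2.1
  rw [hfind, h1, Option.bind_some, he _ g1, Option.some_inj] at h3
  rw [hfindr, h2, Option.bind_some, he' _ g2, Option.some_inj] at h4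
  exact ⟨⟨g1, h3, v, z, hv, fun s hs => by simpa [P] using hv' s hs⟩,
    g2, h4, v', z', hw, fun s hs => by simpa [P] using hw' s hs⟩

/-! ### Growing letters -/

/-- The iterated images of `t` are arbitrarily long. -/
def Grows (φ : A → List A) (t : A) : Prop := ∀ N, ∃ k, N ≤ (img φ k t).length

theorem exists_bound_of_not_grows [Finite A] (φ : A → List A) :
    ∃ M, ∀ t, ¬ Grows φ t → ∀ k, (img φ k t).length ≤ M := by
  have : ∀ t, ∃ M, ¬ Grows φ t → ∀ k, (img φ k t).length ≤ M := by
    intro t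
    by_cases ht : Grows φ t
    · exact ⟨0, fun h => (h ht).elim⟩
    · simp only [Grows, not_forall, not_exists, not_le] at ht
      obtain ⟨N, hN⟩ := ht
      exact ⟨N, fun _ k => (hN k).le⟩
  choose M hM using this
  obtain ⟨B, hB⟩ := (Set.finite_range M).bddAbove
  exact ⟨B, fun t ht k => (hM t ht k).trans (hB ⟨t, rfl⟩)⟩

theorem Grows.exists_mem [Finite A] {φ : A → List A} {t : A} (h : Grows φ t) :
    ∃ s ∈ φ t, Grows φ s := by
  by_contra! hc
  obtain ⟨M, hM⟩ := exists_bound_of_not_grows φ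
  obtain ⟨k, hk⟩ := h ((φ t).length * M + 2)
  cases k with
  | zero => simp at hk
  | succ k =>
    rw [img_succ'] at hk
    have := length_wordMap_le (φ := img φ k) (u := φ t) (W := M) fun s hs => hM s (hc s hs) k
    omega

theorem not_grows_of_mem {φ : A → List A} {t : A} (h : ¬ Grows φ t) :
    ∀ s ∈ φ t, ¬ Grows φ s := by
  intro s hs hsG
  refine h fun N => ?_
  obtain ⟨k, hk⟩ := hsG N
  refine ⟨k + 1, hk.trans ?_⟩
  rw [img_succ']
  exact length_le_wordMap_of_mem hs

theorem grows_img_iff {φ : A → List A} (hne : ∀ t, φ t ≠ []) {p : ℕ} (hp : 1 ≤ p) {t : A} :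
    Grows (img φ p) t ↔ Grows φ t := by
  constructor
  · intro h N
    obtain ⟨k, hk⟩ := h N
    exact ⟨p * k, by rwa [img_img] at hk⟩
  · intro h N
    obtain ⟨k, hk⟩ := h N
    refine ⟨k, ?_⟩
    rw [img_img]
    exact hk.trans (length_img_mono hne t (Nat.le_mul_of_pos_left k hp))

theorem img_ne_nil {φ : A → List A} (hne : ∀ t, φ t ≠ []) (k : ℕ) (t : A) : img φ k t ≠ [] := by
  have := length_img_mono hne t (Nat.zero_le k)
  rw [← List.length_pos_iff]
  exact this

theorem FixedBy.grows_zero {φ : A → List A} {α : ℕ → A} {D : ℕ → ℕ}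
    (h : FixedBy φ α D) (hD : ∀ j, 1 ≤ j → j < D j) : Grows φ (α 0) := by
  intro N
  refine ⟨N, ?_⟩
  have := (h.iterate N).sub_eq 0
  rw [(h.iterate N).zero, zero_add] at this
  have := add_le_iterate hD (le_refl 1) N
  omega

/-! ### Unbounded runs of bounded letters: constant or quadratic complexity -/

theorem complexity_le_of_periodic (α : ℕ → A) {N P : ℕ} (hP : 1 ≤ P)
    (h : ∀ i, N ≤ i → α (i + P) = α i) (n : ℕ) : complexity α n ≤ N + P := by
  have := complexity_le_card α n (Finset.range (N + P)) (fun i => factorAt α i n) ?_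
  · simpa using this
  intro i
  induction i using Nat.strong_induction_on with
  | _ i ih =>
    rcases Nat.lt_or_ge i (N + P) with hi | hi
    · exact ⟨i, by simpa using hi, rfl⟩
    · obtain ⟨j, hj, hj'⟩ := ih (i - P) (by omega)
      refine ⟨j, hj, hj'.symm ▸ ?_⟩
      rw [factorAt_eq_iff]
      intro r hr
      rw [← h (i - P + r) (by omega)]
      congr 1
      omega

theorem wordMap_comp_eq {φ : A → List A} {w : List A}
    (h : ∀ t ∈ w, wordMap φ (φ t) = φ t) : wordMap φ (wordMap φ w) = wordMap φ w := by
  induction w with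
  | nil => rfl
  | cons t w ih =>
    rw [wordMap_cons, wordMap_append, h t (by simp), ih fun s hs => h s (by simp [hs])]

/-- If no letter of `α` past the first grows, then `α` is ultimately periodic. -/
theorem FixedBy.exists_complexity_le_of_bounded {φ : A → List A} {α : ℕ → A} {D : ℕ → ℕ}
    (h : FixedBy φ α D) (hD : ∀ j, 1 ≤ j → j < D j)
    (hB : ∀ i, 1 ≤ i → i < D 1 → wordMap φ (φ (α i)) = φ (α i)) :
    ∃ C, ∀ n, complexity α n ≤ C := by
  have h1 := hD 1 le_rfl
  have h2 := hD (D 1) (by omega)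
  set w := factorAt α 1 (D 1 - 1) with hw
  set P := D (D 1) - D 1 with hP
  have hww : wordMap φ (wordMap φ w) = wordMap φ w := by
    refine wordMap_comp_eq fun t ht => ?_
    obtain ⟨s, hs1, hs2, rfl⟩ := mem_factorAt.1 ht
    exact hB s hs1 (by omega)
  have hv : wordMap φ w = factorAt α (D 1) P := by
    rw [hw, h.map_factorAt', show 1 + (D 1 - 1) = D 1 by omega]
  have hlen : (wordMap φ w).length = P := by rw [hv, factorAt_length]
  have key : ∀ k, factorAt α (D 1 + k * P) P = wordMap φ w ∧
      D (D 1 + k * P) = D 1 + (k + 1) * P := by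
    intro k
    induction k with
    | zero => exact ⟨by simp [hv], by simp; omega⟩
    | succ k ih =>
      obtain ⟨a1, a2⟩ := ih
      have a3 := h.add (D 1 + k * P) P
      have a4 := h.map_factorAt (D 1 + k * P) P
      rw [a1, hww, hlen, a2] at a3 a4
      rw [show D 1 + k * P + P = D 1 + (k + 1) * P by ring] at a3
      exact ⟨a4.symm, by rw [a3]; ring⟩
  refine ⟨D 1 + P, fun n => complexity_le_of_periodic α (by omega) (fun i hi => ?_) n⟩
  have a1 := (key ((i - D 1) / P)).1.trans (key ((i - D 1) / P + 1)).1.symm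
  rw [factorAt_eq_iff] at a1
  have a2 := a1 ((i - D 1) % P) (Nat.mod_lt _ (by omega))
  have a3 := Nat.div_add_mod (i - D 1) P
  have e1 : D 1 + (i - D 1) / P * P + (i - D 1) % P = i := by rw [mul_comm]; omega
  have e2 : D 1 + ((i - D 1) / P + 1) * P + (i - D 1) % P = i + P := by
    rw [add_mul, mul_comm]; omega
  rw [e1, e2] at a2
  exact a2.symm

section Quadratic

variable {φ : A → List A} {α : ℕ → A} {D : ℕ → ℕ}

/-- `x < y` are consecutive occurrences of letters of `G`. -/
def Consecutive (α : ℕ → A) (G : A → Prop) (x y : ℕ) : Prop :=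
  G (α x) ∧ G (α y) ∧ x < y ∧ ∀ z, x < z → z < y → ¬ G (α z)

/-- The structure of long runs of letters outside `G`. -/
theorem FixedBy.exists_runs [Finite A] (h : FixedBy φ α D) (hD : ∀ j, 1 ≤ j → j < D j)
    (hne : ∀ t, φ t ≠ []) {G : A → Prop} (hG0 : G (α 0)) (hG : ∀ t, G t → ∃ s ∈ φ t, G s)
    (hB : ∀ t, ¬ G t → ∀ s ∈ φ t, ¬ G s) (hBB : ∀ t, ¬ G t → wordMap φ (φ t) = φ t)
    (hinf : ∀ i, ∃ s, i ≤ s ∧ G (α s))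
    (hgap : ∀ R, ∃ i, ∀ s, i ≤ s → s < i + R → ¬ G (α s)) :
    ∃ K, 1 ≤ K ∧ ∀ m, K ≤ m → ∃ x y, Consecutive α G x y ∧ m ≤ D y - D (x + 1) ∧
      D y - D (x + 1) ≤ m + K ∧ D y - D (x + 1) ≤ K * (x + 1) ∧
      D y - D (x + 1) ≤ K * (y - x - 1) ∧ y - x - 1 ≤ D y - D (x + 1) := by
  classical
  obtain ⟨W, hW1, hW⟩ := exists_length_le φ
  have hDle : ∀ i m, D (i + m) ≤ D i + W * m := by
    intro i m
    induction m with
    | zero => simp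
    | succ m ih =>
      rw [← add_assoc, h.succ]
      have := hW (α (i + m))
      rw [mul_add]
      omega
  have hDge : ∀ i m, D i + m ≤ D (i + m) := by
    intro i m
    induction m with
    | zero => simp
    | succ m ih =>
      rw [← add_assoc i m 1, h.succ]
      have := List.length_pos_iff.2 (hne (α (i + m)))
      omega
  -- the run following position `0`
  have hnext : ∀ x, G (α x) → ∃ y, Consecutive α G x y := by
    intro x hx
    have hex : ∃ y, x < y ∧ G (α y) := by
      obtain ⟨s, hs, hs'⟩ := hinf (x + 1)
      exact ⟨s, hs, hs'⟩
    refine ⟨Nat.find hex, hx, (Nat.find_spec hex).2, (Nat.find_spec hex).1, fun z hz1 hz2 hz3 => ?_⟩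
    exact Nat.find_min hex hz2 ⟨hz1, hz3⟩
  have huniq : ∀ x y y', Consecutive α G x y → Consecutive α G x y' → y = y' := by
    intro x y y' h1 h2
    rcases lt_trichotomy y y' with hlt | rfl | hlt
    · exact (h2.2.2.2 y h1.2.2.1 hlt h1.2.1).elim
    · rfl
    · exact (h1.2.2.2 y' h2.2.2.1 hlt h2.2.1).elim
  obtain ⟨y1, hy1⟩ := hnext 0 hG0
  -- ancestors
  have hanc : ∀ x y, 1 ≤ x → Consecutive α G x y → D y - D (x + 1) ≤ W * W ∨
      ∃ x0 y0, x0 < x ∧ Consecutive α G x0 y0 ∧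
        D y - D (x + 1) ≤ D y0 - D (x0 + 1) + 2 * (W * W) := by
    intro x y hx hxy
    obtain ⟨x0, a1, a2⟩ := h.exists_block_one hD x
    obtain ⟨y0, b1, b2⟩ := h.exists_block_one hD y
    obtain ⟨gx, gy, hlt, hno⟩ := hxy
    have hWx := hDle x0 1
    have hWy := hDle y0 1
    have hle : x0 ≤ y0 := by
      by_contra hc
      have := h.mono (show y0 + 1 ≤ x0 by omega)
      omega
    rcases hle.eq_or_lt with rfl | hlt0
    · left
      have c1 := hDle (x + 1) (y - (x + 1))
      rw [Nat.add_sub_cancel' hlt] at c1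
      have c2 : W * (y - (x + 1)) ≤ W * W := Nat.mul_le_mul_left _ (by omega)
      omega
    right
    have hx0 : x0 < x := by
      rcases Nat.eq_zero_or_pos x0 with rfl | hp
      · exact hx
      · exact (hD x0 hp).trans_le a1
    have hcons : Consecutive α G x0 y0 := by
      refine ⟨?_, ?_, hlt0, fun z hz1 hz2 hz => ?_⟩
      · by_contra hc
        exact hB _ hc _ (h.mem_image.2 ⟨x, a1, a2, rfl⟩) gx
      · by_contra hc
        exact hB _ hc _ (h.mem_image.2 ⟨y, b1, b2, rfl⟩) gy
      · obtain ⟨s, hs, hsG⟩ := hG _ hz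
        obtain ⟨r, r1, r2, rfl⟩ := h.mem_image.1 hs
        have c1 := h.mono (show x0 + 1 ≤ z by omega)
        have c2 := h.mono (show z + 1 ≤ y0 by omega)
        exact hno r (by omega) (by omega) hsG
    refine ⟨x0, y0, hx0, hcons, ?_⟩
    have hDD : D (D y0) - D (D (x0 + 1)) = D y0 - D (x0 + 1) := by
      have c1 := h.map_factorAt' (x0 + 1) (y0 - (x0 + 1))
      rw [Nat.add_sub_cancel' hlt0] at c1
      have c2 := wordMap_comp_eq (φ := φ) (w := factorAt α (x0 + 1) (y0 - (x0 + 1)))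
        fun t ht => by
          obtain ⟨s, s1, s2, rfl⟩ := mem_factorAt.1 ht
          exact hBB _ (hcons.2.2.2 s (by omega) (by omega))
      rw [c1, h.map_factorAt', Nat.add_sub_cancel' (h.mono hlt0)] at c2
      simpa using congrArg List.length c2
    have d1 := hDle (D y0) (y - D y0)
    rw [Nat.add_sub_cancel' b1] at d1
    have d2 : W * (y - D y0) ≤ W * W := Nat.mul_le_mul_left _ (by omega)
    have d3 := hDle (x + 1) (D (x0 + 1) - (x + 1))
    rw [Nat.add_sub_cancel' a2] at d3
    have d4 : W * (D (x0 + 1) - (x + 1)) ≤ W * W := Nat.mul_le_mul_left _ (by omega)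
    omega
  set K := D y1 + 2 * (W * W) + W + 1 with hK
  refine ⟨K, by omega, fun m hm => ?_⟩
  have hlin : ∀ x y, Consecutive α G x y → D y - D (x + 1) ≤ K * (x + 1) := by
    intro x
    induction x using Nat.strong_induction_on with
    | _ x ih =>
      intro y hxy
      rcases Nat.eq_zero_or_pos x with rfl | hx
      · rw [huniq 0 y y1 hxy hy1]
        omega
      · rcases hanc x y hx hxy with h1 | ⟨x0, y0, h1, h2, h3⟩
        · have : K ≤ K * (x + 1) := Nat.le_mul_of_pos_right K (by omega)
          omega
        · have h4 := ih x0 h1 y0 h2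
          have h5 : K * (x0 + 1) ≤ K * x := Nat.mul_le_mul_left _ h1
          rw [mul_add]
          omega
  have hex : ∃ x y, Consecutive α G x y ∧ m ≤ D y - D (x + 1) := by
    obtain ⟨i, hi⟩ := hgap m
    have hi0 : 0 < i := by
      rcases Nat.eq_zero_or_pos i with rfl | hi0
      · exact (hi 0 le_rfl (by omega) hG0).elim
      · exact hi0
    have hx := Nat.findGreatest_spec (P := fun x => G (α x)) (Nat.zero_le (i - 1)) hG0
    set x := Nat.findGreatest (fun x => G (α x)) (i - 1) with hxdef
    have hxi : x ≤ i - 1 := Nat.findGreatest_le _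
    obtain ⟨y, hy⟩ := hnext x hx
    refine ⟨x, y, hy, ?_⟩
    have hyi : i + m ≤ y := by
      by_contra hc
      rcases Nat.lt_or_ge y i with hlt | hge
      · have := Nat.le_findGreatest (P := fun x => G (α x)) (show y ≤ i - 1 by omega) hy.2.1
        have := hy.2.2.1
        omega
      · exact hi y hge (by omega) hy.2.1
    have := hDge (x + 1) (y - (x + 1))
    rw [Nat.add_sub_cancel' hy.2.2.1] at this
    omega
  obtain ⟨y, hxy, hmv⟩ := Nat.find_spec hex
  set x := Nat.find hex with hxdef
  have hgapW : D y - D (x + 1) ≤ K * (y - x - 1) := by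
    have := hDle (x + 1) (y - (x + 1))
    rw [Nat.add_sub_cancel' hxy.2.2.1] at this
    have : W * (y - (x + 1)) ≤ K * (y - (x + 1)) := Nat.mul_le_mul_right _ (by omega)
    rw [Nat.sub_sub]
    omega
  have hgap1 : y - x - 1 ≤ D y - D (x + 1) := by
    have := hDge (x + 1) (y - (x + 1))
    rw [Nat.add_sub_cancel' hxy.2.2.1] at this
    omega
  refine ⟨x, y, hxy, hmv, ?_, hlin x y hxy, hgapW, hgap1⟩
  rcases Nat.eq_zero_or_pos x with hx | hx
  · rw [hx] at hxy ⊢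
    rw [huniq 0 y y1 hxy hy1]
    omega
  · rcases hanc x y hx hxy with h1 | ⟨x0, y0, h1, h2, h3⟩
    · omega
    · have := Nat.find_min hex h1
      simp only [not_exists, not_and, not_le] at this
      have := this y0 h2
      omega

theorem FixedBy.sq_le_complexity [Finite A] (h : FixedBy φ α D) {G : A → Prop} {K : ℕ} (hK1 : 1 ≤ K)
    (hK : ∀ m, K ≤ m → ∃ x y, Consecutive α G x y ∧ m ≤ D y - D (x + 1) ∧
      D y - D (x + 1) ≤ m + K ∧ D y - D (x + 1) ≤ K * (x + 1) ∧
      D y - D (x + 1) ≤ K * (y - x - 1) ∧ y - x - 1 ≤ D y - D (x + 1))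
    {n s : ℕ} (hn : 5 * K * s ≤ n) : s * s ≤ complexity α n := by
  rcases Nat.eq_zero_or_pos s with rfl | hs
  · simp
  have hKs : K ≤ K * s := Nat.le_mul_of_pos_right K hs
  have hsK : s ≤ K * s := Nat.le_mul_of_pos_left s hK1
  have hex : ∀ l, ∃ x y, Consecutive α G x y ∧ K * s + l * (K + 1) ≤ D y - D (x + 1) ∧
      D y - D (x + 1) ≤ K * s + l * (K + 1) + K ∧ D y - D (x + 1) ≤ K * (x + 1) ∧
      D y - D (x + 1) ≤ K * (y - x - 1) ∧ y - x - 1 ≤ D y - D (x + 1) :=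
    fun l => hK _ (by omega)
  choose x y hc h1 h2 h3 h4 h5 using hex
  have hx : ∀ l, s ≤ x l + 1 := fun l =>
    Nat.le_of_mul_le_mul_left ((show K * s ≤ _ by have := h1 l; omega).trans (h3 l)) hK1
  have hy : ∀ l, s ≤ y l - x l - 1 := fun l =>
    Nat.le_of_mul_le_mul_left ((show K * s ≤ _ by have := h1 l; omega).trans (h4 l)) hK1
  have hyle : ∀ l < s, s + (y l - x l) < n := by
    intro l hl
    have a1 : l * (K + 1) + (K + 1) ≤ s * (K + 1) := by
      have := Nat.mul_le_mul_right (K + 1) (show l + 1 ≤ s from hl)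
      linarith
    have a2 := h2 l
    have a3 := h5 l
    have a4 : s * (K + 1) = K * s + s := by ring
    have a5 : 5 * K * s = 5 * (K * s) := by ring
    omega
  have hcard := card_le_complexity α n (Finset.range s ×ˢ Finset.range s)
    (fun p => x p.1 - p.2) ?_
  · simpa using hcard
  have hlt : ∀ l l' t t', t < s → t' < s → l < s →
      (∀ r < n, α (x l - t + r) = α (x l' - t' + r)) → ¬ t < t' := by
    intro l l' t t' ht ht' hl hr hlt
    have a1 := hr t' (by have := hyle l hl; omega)
    have := hx l
    have := hx l'
    have := hy l
    rw [show x l' - t' + t' = x l' by omega] at a1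
    exact (hc l).2.2.2 (x l - t + t') (by omega) (by omega) (a1 ▸ (hc l').1)
  have hgaplt : ∀ l l' t, t < s → l < s → (∀ r < n, α (x l - t + r) = α (x l' - t + r)) →
      ¬ (y l - x l < y l' - x l') := by
    intro l l' t ht hl hr hlt
    have a1 := hr (t + (y l - x l)) (by have := hyle l hl; omega)
    have := hx l
    have := hx l'
    have := hy l
    have := (hc l).2.2.1
    have := (hc l').2.2.1
    rw [show x l - t + (t + (y l - x l)) = y l by omega] at a1
    exact (hc l').2.2.2 (x l' - t + (t + (y l - x l))) (by omega) (by omega) (a1 ▸ (hc l).2.1)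
  rintro ⟨l, t⟩ hlt1 ⟨l', t'⟩ hlt2 hw
  simp only [Finset.coe_product, Finset.coe_range, Set.mem_prod, Set.mem_Iio] at hlt1 hlt2
  simp only [factorAt_eq_iff] at hw
  obtain ⟨hl, ht⟩ := hlt1
  obtain ⟨hl', ht'⟩ := hlt2
  have e1 : t = t' := by
    have a1 := hlt l l' t t' ht ht' hl hw
    have a2 := hlt l' l t' t ht' ht hl' fun r hr => (hw r hr).symm
    omega
  subst e1
  have e2 : y l - x l = y l' - x l' := by
    have a1 := hgaplt l l' t ht hl hw
    have a2 := hgaplt l' l t ht hl' fun r hr => (hw r hr).symm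
    omega
  have b1 := (hc l).2.2.1
  have b2 := (hc l').2.2.1
  have b3 := hx l
  have b4 := hx l'
  have e3 := (h.congr (i := x l + 1) (j := x l' + 1) (m := y l - x l - 1) fun r hr => by
    have := hw (t + 1 + r) (by have := hyle l hl; omega)
    convert this using 2 <;> omega).1
  rw [show x l + 1 + (y l - x l - 1) = y l by omega,
    show x l' + 1 + (y l - x l - 1) = y l' by omega] at e3
  have c1 := h1 l
  have c2 := h2 l
  have c3 := h1 l'
  have c4 := h2 l'
  have e4 : l = l' := by
    have noLt : ∀ a b : ℕ, a < b → b * (K + 1) ≤ a * (K + 1) + K → False := by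
      intro a b hab hle
      have := Nat.mul_le_mul_right (K + 1) (show a + 1 ≤ b from hab)
      linarith
    rcases lt_trichotomy l l' with hh | hh | hh
    · exact (noLt l l' hh (by omega)).elim
    · exact hh
    · exact (noLt l' l hh (by omega)).elim
  rw [e4]

end Quadratic

theorem stableFrom_of_idempotent {φ : A → List A} (hne : ∀ t, φ t ≠ []) {G : A → Prop}
    (hB : ∀ t, ¬ G t → wordMap φ (φ t) = φ t) (hfix : ∀ t, G t → φ t ≠ [t]) {e e' : A → A}
    (he : ∀ t, G t → (G (e t) ∧ e (e t) = e t ∧ ∃ v z, φ t = v ++ e t :: z ∧ ∀ s ∈ v, ¬ G s) ∧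
        G (e' t) ∧ e' (e' t) = e' t ∧
          ∃ v z, (φ t).reverse = v ++ e' t :: z ∧ ∀ s ∈ v, ¬ G s) (n : ℕ) :
    StableFrom φ n (n + 2) := by
  intro K hK t
  refine ⟨take_img_of_idempotent hne hB (fun t ht => (he t ht).1.1) (fun t ht => (he t ht).1.2.2)
    (fun t ht => (he t ht).1.2.1) hfix n hK t, ?_⟩
  rw [← img_reverse, ← img_reverse]
  refine take_img_of_idempotent (φ := fun t => (φ t).reverse) (fun t => by simpa using hne t)
    (fun t ht => ?_) (fun t ht => (he t ht).2.1) (fun t ht => (he t ht).2.2.2)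
    (fun t ht => (he t ht).2.2.1) (fun t ht => ?_) n hK t
  · rw [wordMap_reverse, hB t ht]
  · intro hc
    exact hfix t ht (by simpa using congrArg List.reverse hc)

theorem Grows.ne_singleton {φ : A → List A} {t : A} (h : Grows φ t) : φ t ≠ [t] := by
  intro hc
  obtain ⟨k, hk⟩ := h 2
  have : ∀ k, img φ k t = [t] := fun k => by
    induction k with
    | zero => rfl
    | succ k ih => rw [img_succ, ih, wordMap_singleton, hc]
  rw [this] at hk
  simp at hk

/-- A fixed point with unbounded runs of bounded letters has constant or quadratic complexity. -/
theorem FixedBy.exists_isTheta_of_unbounded_runs [Finite A] {φ : A → List A} {α : ℕ → A}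
    {D : ℕ → ℕ} (h : FixedBy φ α D) (hD : ∀ j, 1 ≤ j → j < D j) (hne : ∀ t, φ t ≠ [])
    (hgap : ∀ R, ∃ i, ∀ s, i ≤ s → s < i + R → ¬ Grows φ (α s)) :
    ∃ i, (fun n => (complexity α n : ℝ)) =Θ[atTop] classFun i := by
  classical
  obtain ⟨M, hM⟩ := exists_bound_of_not_grows φ
  obtain ⟨p, -, hp, hBB, -, e, e', he⟩ := exists_idempotent_power
    (fun t (ht : Grows φ t) => ht.exists_mem) (fun t ht => not_grows_of_mem ht) hM 0
  have hG : Grows (img φ p) = Grows φ := funext fun t => propext (grows_img_iff hne hp)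
  have h' := h.iterate p
  have hD' := self_lt_iterate hD hp
  have hne' := img_ne_nil hne p
  rw [← hG] at hBB he hgap
  generalize img φ p = ψ at *
  generalize D^[p] = E at *
  clear hM h hD hne hG
  by_cases hB : ∀ i, 1 ≤ i → i < E 1 → ¬ Grows ψ (α i)
  · obtain ⟨C, hC⟩ := h'.exists_complexity_le_of_bounded hD' fun i h1 h2 => hBB _ (hB i h1 h2)
    exact ⟨0, isTheta_one_of_bounded hC (complexity_pos α)⟩
  push Not at hB
  obtain ⟨x, hx1, -, hxG⟩ := hB
  refine ⟨4, isTheta_classFun_iff.2 ⟨?_, ?_⟩⟩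
  · obtain ⟨C, hC⟩ := h'.exists_complexity_le hD'
    refine ⟨C * 8, (eventually_ge_atTop 1).mono fun n hn => ?_⟩
    have h1 := hC n (n + 2) (stableFrom_of_idempotent hne' hBB (fun t ht => ht.ne_singleton) he n)
    have h2 := (Finset.card_filter_le (Finset.range (n + 2))
      fun K => ∃ t, n ≤ (img ψ (K + 1) t).length)
    rw [Finset.card_range] at h2
    have h3 : complexity α n ≤ C * 8 * n ^ 2 := by
      refine h1.trans ?_
      calc _ ≤ C * (n + 1) * (1 + (n + 2)) :=
            Nat.mul_le_mul_left _ (by convert Nat.add_le_add_left h2 1)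
        _ ≤ C * (2 * n) * (4 * n) := by gcongr <;> omega
        _ = _ := by ring
    change (complexity α n : ℝ) ≤ C * 8 * (n : ℝ) ^ 2
    exact_mod_cast h3
  · have hinf : ∀ i, ∃ s, i ≤ s ∧ Grows ψ (α s) := by
      intro i
      have hk : ∀ k, ∃ s, x + k ≤ s ∧ Grows ψ (α s) := by
        intro k
        induction k with
        | zero => exact ⟨x, le_rfl, hxG⟩
        | succ k ih =>
          obtain ⟨s, hs, hsG⟩ := ih
          obtain ⟨t, ht, htG⟩ := hsG.exists_mem
          obtain ⟨r, hr, -, rfl⟩ := h'.mem_image.1 ht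
          have := hD' s (by omega)
          exact ⟨r, by omega, htG⟩
      obtain ⟨s, hs, hsG⟩ := hk i
      exact ⟨s, by omega, hsG⟩
    obtain ⟨K, hK1, hK⟩ := h'.exists_runs hD' hne' (h'.grows_zero hD')
      (fun t ht => ht.exists_mem) (fun t ht => not_grows_of_mem ht) hBB hinf hgap
    refine ⟨(10 * K) ^ 2, (eventually_ge_atTop (5 * K)).mono fun n hn => ?_⟩
    have h1 := h'.sq_le_complexity hK1 hK (n := n) (s := n / (5 * K)) (Nat.mul_div_le _ _)
    have h2 := Nat.lt_div_mul_add (a := n) (b := 5 * K) (by omega)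
    have h3 : 1 ≤ n / (5 * K) := (Nat.one_le_div_iff (by omega)).2 hn
    have h4 : n ≤ 10 * K * (n / (5 * K)) := by nlinarith
    have h5 : n ^ 2 ≤ (10 * K) ^ 2 * complexity α n := by
      calc n ^ 2 ≤ (10 * K * (n / (5 * K))) ^ 2 := by gcongr
        _ = (10 * K) ^ 2 * (n / (5 * K) * (n / (5 * K))) := by ring
        _ ≤ _ := by gcongr
    change (n : ℝ) ^ 2 ≤ _
    exact_mod_cast h5

/-! ### Reduction to growing nonerasing morphisms -/

/-- The class exists for fixed points of nonerasing morphisms if it does for those of growing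
nonerasing morphisms. -/
theorem FixedBy.exists_isTheta_of_nonerasing.{u} {A : Type u}
    (hgrow : ∀ (B : Type u) [Finite B] (ψ : B → List B) (β : ℕ → B) (E : ℕ → ℕ), FixedBy ψ β E →
      (∀ j, 1 ≤ j → j < E j) → (∀ t, ψ t ≠ []) → Function.Surjective β → (∀ t, Grows ψ t) →
      ∃ i, (fun n => (complexity β n : ℝ)) =Θ[atTop] classFun i)
    [Finite A] {φ : A → List A} {α : ℕ → A} {D : ℕ → ℕ} (h : FixedBy φ α D)
    (hD : ∀ j, 1 ≤ j → j < D j) (hne : ∀ t, φ t ≠ []) :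
    ∃ i, (fun n => (complexity α n : ℝ)) =Θ[atTop] classFun i := by
  by_cases hgap : ∀ R, ∃ i, ∀ s, i ≤ s → s < i + R → ¬ Grows φ (α s)
  · exact h.exists_isTheta_of_unbounded_runs hD hne hgap
  push Not at hgap
  obtain ⟨R, hR⟩ := hgap
  obtain ⟨T, ψ, β, E, q, hT, h1, h2, h3, h4, h5, h6, h7⟩ := h.exists_recoding hD
    (h.grows_zero hD) (fun i hi => hi.exists_mem) (fun i hi => not_grows_of_mem hi) hR
  have hR0 : 0 < R := by obtain ⟨s, _, _, _⟩ := hR 0; omega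
  have := hT.to_subtype
  obtain ⟨i, hi⟩ := hgrow T ψ β E h1 h2 h3 h4 fun t N => by
    obtain ⟨j, rfl⟩ := h4 t
    obtain ⟨k, hk⟩ := (h5 j).1 (R * N + R)
    refine ⟨k, ?_⟩
    have := hk.trans ((h5 j).2 k)
    exact Nat.le_of_mul_le_mul_left (show R * N ≤ R * (img ψ k (β j)).length by omega) hR0
  exact ⟨i, isTheta_of_comparable (complexity_mono α) hR0 h6 h7 hi⟩

theorem FixedBy.exists_isTheta_of_growing.{u} {A : Type u}
    (hgrow : ∀ (B : Type u) [Finite B] (ψ : B → List B) (β : ℕ → B) (E : ℕ → ℕ), FixedBy ψ β E →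
      (∀ j, 1 ≤ j → j < E j) → (∀ t, ψ t ≠ []) → Function.Surjective β → (∀ t, Grows ψ t) →
      ∃ i, (fun n => (complexity β n : ℝ)) =Θ[atTop] classFun i)
    [Finite A] {φ : A → List A} {α : ℕ → A} {D : ℕ → ℕ} (h : FixedBy φ α D)
    (hD : ∀ j, 1 ≤ j → j < D j) :
    ∃ i, (fun n => (complexity α n : ℝ)) =Θ[atTop] classFun i := by
  have hnil : ∀ {k l t}, k ≤ l → img φ k t = [] → img φ l t = [] := by
    intro k l t hkl hk
    obtain ⟨m, rfl⟩ := Nat.exists_eq_add_of_le hkl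
    rw [img_add, hk, wordMap_nil]
  obtain ⟨K, hK⟩ : ∃ K, ∀ t, (∃ k, img φ k t = []) → img φ K t = [] := by
    have : ∀ t, ∃ K, (∃ k, img φ k t = []) → img φ K t = [] := by
      intro t
      by_cases ht : ∃ k, img φ k t = []
      · exact ⟨ht.choose, fun _ => ht.choose_spec⟩
      · exact ⟨0, fun h => (ht h).elim⟩
    choose f hf using this
    obtain ⟨B, hB⟩ := (Set.finite_range f).bddAbove
    exact ⟨B, fun t ht => hnil (hB ⟨t, rfl⟩) (hf t ht)⟩
  set F : A → Prop := fun t => ∀ k, img φ k t ≠ [] with hFdef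
  have hFnot : ∀ t, ¬ F t ↔ img φ K t = [] := fun t =>
    ⟨fun ht => hK t (by simpa [hFdef] using ht), fun ht hF => hF K ht⟩
  have hF : ∀ t, F t → ∃ s ∈ φ t, F s := by
    intro t ht
    by_contra! hc
    refine ht (K + 1) ?_
    rw [img_succ', wordMap, List.flatMap_eq_nil_iff]
    exact fun s hs => (hFnot s).1 (hc s hs)
  have hS : ∀ t, ¬ F t → ∀ s ∈ φ t, ¬ F s := by
    intro t ht s hs
    have h1 := hnil (Nat.le_succ K) ((hFnot t).1 ht)
    rw [Nat.succ_eq_add_one, img_succ', wordMap, List.flatMap_eq_nil_iff] at h1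
    exact (hFnot s).2 (h1 s hs)
  have hFk : ∀ k t, F t → ∃ s ∈ img φ k t, F s := by
    intro k t ht
    induction k with
    | zero => exact ⟨t, by simp, ht⟩
    | succ k ih =>
      obtain ⟨s, hs, hsF⟩ := ih
      obtain ⟨r, hr, hrF⟩ := hF s hsF
      exact ⟨r, by rw [img_succ, mem_wordMap]; exact ⟨s, hs, hr⟩, hrF⟩
  have h0 : F (α 0) := by
    intro k hk
    have h1 := (h.iterate k).sub_eq 0
    have h2 := add_le_iterate hD (le_refl 1) k
    rw [(h.iterate k).zero, hk, zero_add] at h1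
    simp at h1
    omega
  obtain ⟨W, hW1, hW⟩ := exists_length_le (img φ K)
  have hR : ∀ i, ∃ s, i ≤ s ∧ s < i + 2 * W ∧ F (α s) := by
    intro i
    obtain ⟨j, hj1, hj2⟩ := h.exists_block hD K (i + W)
    have hj3 := (h.iterate K).succ j
    have hFj : F (α j) := by
      by_contra hc
      rw [(hFnot _).1 hc] at hj3
      simp at hj3
      omega
    obtain ⟨t, ht, htF⟩ := hFk K _ hFj
    obtain ⟨s, hs1, hs2, rfl⟩ := (h.iterate K).mem_image.1 ht
    have := hW (α j)
    exact ⟨s, by omega, by omega, htF⟩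
  obtain ⟨T, ψ, β, E, q, hT, h1, h2, h3, h4, -, h6, h7⟩ := h.exists_recoding hD h0
    (fun i => hF _) (fun i => hS _) hR
  have := hT.to_subtype
  obtain ⟨i, hi⟩ := h1.exists_isTheta_of_nonerasing hgrow h2 h3
  exact ⟨i, isTheta_of_comparable (complexity_mono α) (by omega) h6 h7 hi⟩

/-! ### Right special factors from letters of different growth -/

section RightSpecial

variable {φ : A → List A} {α : ℕ → A} {D : ℕ → ℕ}

theorem two_mul_length_img_le (h2 : ∀ t, 2 ≤ (φ t).length) (k : ℕ) (t : A) :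
    2 * (img φ k t).length ≤ (img φ (k + 1) t).length := by
  rw [img_succ, mul_comm]
  exact le_length_wordMap fun s _ => h2 s

theorem length_img_succ_le {W : ℕ} (hW : ∀ t, (φ t).length ≤ W) (k : ℕ) (t : A) :
    (img φ (k + 1) t).length ≤ W * (img φ k t).length := by
  rw [img_succ, mul_comm]
  exact length_wordMap_le fun s _ => hW s

theorem length_img_add_le {W : ℕ} (hW : ∀ t, (φ t).length ≤ W) (k j : ℕ) (t : A) :
    (img φ (k + j) t).length ≤ W ^ j * (img φ k t).length := by
  induction j with
  | zero => simp
  | succ j ih =>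
    calc _ ≤ W * (img φ (k + j) t).length := length_img_succ_le hW (k + j) t
      _ ≤ W * (W ^ j * (img φ k t).length) := Nat.mul_le_mul_left _ ih
      _ = _ := by ring

theorem length_img_le_of_mem {k : ℕ} {s t : A} (h : s ∈ img φ k t) (j : ℕ) :
    (img φ j s).length ≤ (img φ (k + j) t).length := by
  rw [img_add]
  exact length_le_wordMap_of_mem h

theorem FixedBy.iterate_sub_le (h : FixedBy φ α D) {i B p m : ℕ}
    (hB : ∀ z, p ≤ z → z < p + m → (img φ i (α z)).length ≤ B) :
    D^[i] (p + m) ≤ D^[i] p + m * B := by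
  rw [(h.iterate i).add]
  have := length_wordMap_le (φ := img φ i) (u := factorAt α p m) (W := B) fun t ht => by
    obtain ⟨z, h1, h2, rfl⟩ := mem_factorAt.1 ht
    exact hB z h1 h2
  rw [factorAt_length] at this
  omega

theorem FixedBy.add_two_mul_le (h : FixedBy φ α D) (h2 : ∀ t, 2 ≤ (φ t).length) (p m : ℕ) :
    D p + 2 * m ≤ D (p + m) := by
  rw [h.add]
  have := le_length_wordMap (φ := φ) (u := factorAt α p m) (W := 2) fun t _ => h2 t
  rw [factorAt_length] at this
  omega

/-- Every letter occurs in an iterated image of the first one. -/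
theorem FixedBy.exists_mem_img (h : FixedBy φ α D) (hD : ∀ j, 1 ≤ j → j < D j) (i : ℕ) :
    ∃ k, α i ∈ img φ k (α 0) := by
  refine ⟨i, (h.iterate i).mem_image.2 ⟨i, ?_, ?_, rfl⟩⟩
  · rw [(h.iterate i).zero]; omega
  · have := add_le_iterate hD (le_refl 1) i
    rw [zero_add]
    omega

/-- If the letters outside `F` grow much slower than those in `F`, then every scale `j` lying
between the two growth rates provides a right special factor. -/
theorem FixedBy.exists_complexity_add_card_le [Finite A] (h : FixedBy φ α D)
    (hD : ∀ j, 1 ≤ j → j < D j) (h2 : ∀ t, 2 ≤ (φ t).length) (hsurj : Function.Surjective α)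
    {F : A → Prop} (hF : ∃ t, F t) (hS : ∃ t, ¬ F t)
    (hratio : ∀ N, ∃ k, ∀ f s, F f → ¬ F s → N * (img φ k s).length < (img φ k f).length) :
    ∃ C, 1 ≤ C ∧ ∀ (n : ℕ) (J : Finset ℕ),
      (∀ j ∈ J, ∀ s, ¬ F s → C * (img φ j s).length < n) →
      (∀ j ∈ J, ∀ f, F f → 2 * n + 1 ≤ (img φ j f).length) →
      complexity α n + J.card ≤ complexity α (n + 1) := by
  classical
  obtain ⟨W, hW1, hW⟩ := exists_length_le φ
  -- the longest image of a letter outside `F`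
  have hmax : ∀ k, ∃ s, ¬ F s ∧ ∀ r, ¬ F r → (img φ k r).length ≤ (img φ k s).length := by
    intro k
    obtain ⟨s0, hs0⟩ := hS
    obtain ⟨s, hs, hs'⟩ := Set.exists_max_image {s | ¬ F s} (fun s => (img φ k s).length)
      (Set.toFinite _) ⟨s0, hs0⟩
    exact ⟨s, hs, hs'⟩
  choose m hmS hm using hmax
  set G : ℕ → ℕ := fun k => (img φ k (m k)).length with hG
  have hGle : ∀ k r, ¬ F r → (img φ k r).length ≤ G k := hm
  have hG2 : ∀ k, 2 * G k ≤ G (k + 1) := fun k =>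
    (two_mul_length_img_le h2 k (m k)).trans (hGle _ _ (hmS k))
  have hGW : ∀ k j, G (k + j) ≤ W ^ j * G k := fun k j =>
    (length_img_add_le hW k j _).trans (Nat.mul_le_mul_left _ (hGle _ _ (hmS _)))
  have hG1 : ∀ k, 1 ≤ G k := by
    intro k
    induction k with
    | zero => simp [hG]
    | succ k ih => have := hG2 k; omega
  have hSS : ∀ t, ¬ F t → ∀ s ∈ φ t, ¬ F s := by
    intro t ht s hs hsF
    obtain ⟨k, hk⟩ := hratio W
    have h1 := hk s t hsF ht
    have h3 := length_img_le_of_mem (k := 1) (by simpa using hs) k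
    rw [add_comm] at h3
    have := length_img_succ_le hW k t
    omega
  have hFF : ∀ t, F t → ∃ s ∈ φ t, F s := by
    intro t ht
    by_contra! hc
    obtain ⟨k, hk⟩ := hratio W
    have h1 := hk t (m k) ht (hmS k)
    have h3 := length_wordMap_le (φ := img φ k) (u := φ t) fun s hs => hGle k s (hc s hs)
    rw [← img_succ'] at h3
    have h4 := two_mul_length_img_le h2 k t
    have h5 := Nat.mul_le_mul_right (G k) (hW t)
    simp only [hG] at *
    omega
  have h0 : F (α 0) := by
    by_contra hc
    obtain ⟨f, hf⟩ := hF
    obtain ⟨i, rfl⟩ := hsurj f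
    obtain ⟨l, hl⟩ := h.exists_mem_img hD i
    obtain ⟨k, hk⟩ := hratio (W ^ l)
    have h1 := hk _ _ hf hc
    have h3 := length_img_le_of_mem hl k
    rw [add_comm] at h3
    have := length_img_add_le hW k l (α 0)
    omega
  have hpos : ∃ x, 1 ≤ x ∧ F (α x) := by
    by_contra! hc
    have hb : ∀ k, D^[k] 1 ≤ 1 + W * G k := by
      intro k
      induction k with
      | zero => simp
      | succ k ih =>
        rw [Function.iterate_succ_apply]
        have h1 := hD 1 le_rfl
        have h3 := h.iterate_sub_le (i := k) (B := G k) (p := 1) (m := D 1 - 1)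
          fun z hz _ => hGle k _ (hc z hz)
        rw [Nat.add_sub_cancel' h1.le] at h3
        have h4 : D 1 - 1 ≤ W := by
          have := h.sub_eq 0
          have := hW (α 0)
          rw [h.zero, zero_add] at *
          omega
        have h5 := Nat.mul_le_mul_right (G k) h4
        have h6 := Nat.mul_le_mul_left W (hG2 k)
        have h7 : W * (2 * G k) = 2 * (W * G k) := by ring
        omega
    obtain ⟨k, hk⟩ := hratio (W + 1)
    have h1 := hk (α 0) (m k) h0 (hmS k)
    have h3 := (h.iterate k).sub_eq 0
    rw [(h.iterate k).zero, zero_add] at h3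
    have h4 := hb k
    have h5 := hG1 k
    have h6 : (W + 1) * G k = W * G k + G k := by ring
    simp only [hG] at *
    omega
  have hinf : ∀ i, ∃ s, i ≤ s ∧ F (α s) := by
    obtain ⟨x, hx1, hxF⟩ := hpos
    have hk : ∀ k, ∃ s, x + k ≤ s ∧ F (α s) := by
      intro k
      induction k with
      | zero => exact ⟨x, le_rfl, hxF⟩
      | succ k ih =>
        obtain ⟨s, hs, hsF⟩ := ih
        obtain ⟨t, ht, htF⟩ := hFF _ hsF
        obtain ⟨r, hr, -, rfl⟩ := h.mem_image.1 ht
        have := hD s (by omega)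
        exact ⟨r, by omega, htF⟩
    intro i
    obtain ⟨s, hs, hsF⟩ := hk i
    exact ⟨s, by omega, hsF⟩
  -- a first gap
  obtain ⟨x0, y0, hxy0, hgap0⟩ : ∃ x0 y0, Consecutive α F x0 y0 ∧ x0 + 1 < y0 := by
    obtain ⟨s, hs⟩ := hS
    obtain ⟨z, rfl⟩ := hsurj s
    have hx := Nat.findGreatest_spec (P := fun x => F (α x)) (Nat.zero_le z) h0
    have hxz : Nat.findGreatest (fun x => F (α x)) z ≤ z := Nat.findGreatest_le _
    have hne : Nat.findGreatest (fun x => F (α x)) z ≠ z := fun hc => hs (by rwa [hc] at hx)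
    have hex : ∃ y, z ≤ y ∧ F (α y) := hinf z
    have hyne : Nat.find hex ≠ z := fun hc => hs (hc ▸ (Nat.find_spec hex).2)
    have hyz := (Nat.find_spec hex).1
    refine ⟨_, Nat.find hex, ⟨hx, (Nat.find_spec hex).2, by omega, fun w hw1 hw2 hw => ?_⟩,
      by omega⟩
    rcases Nat.lt_or_ge w z with hlt | hge
    · have := Nat.le_findGreatest (P := fun x => F (α x)) hlt.le hw
      omega
    · exact Nat.find_min hex hw2 ⟨hge, hw⟩
  -- offset of the last letter of `F` in an image
  obtain ⟨o, ho⟩ : ∃ o : A → ℕ, ∀ x, F (α x) → D x + o (α x) < D (x + 1) ∧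
      F (α (D x + o (α x))) ∧ ∀ z, D x + o (α x) < z → z < D (x + 1) → ¬ F (α z) := by
    have : ∀ t, ∃ o, F t → ∀ x, α x = t → D x + o < D (x + 1) ∧
      F (α (D x + o)) ∧ ∀ z, D x + o < z → z < D (x + 1) → ¬ F (α z) := by
      intro t
      by_cases ht : F t
      swap
      · exact ⟨0, fun hc => (ht hc).elim⟩
      obtain ⟨i, rfl⟩ := hsurj t
      obtain ⟨s, hs, hsF⟩ := hFF _ ht
      obtain ⟨r, hr1, hr2, rfl⟩ := h.mem_image.1 hs
      have hspec := Nat.findGreatest_spec (P := fun x => F (α x))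
        (show r ≤ D (i + 1) - 1 by omega) hsF
      have hge := Nat.le_findGreatest (P := fun x => F (α x))
        (show r ≤ D (i + 1) - 1 by omega) hsF
      have hle : Nat.findGreatest (fun x => F (α x)) (D (i + 1) - 1) ≤ _ := Nat.findGreatest_le _
      have hno : ∀ z, Nat.findGreatest (fun x => F (α x)) (D (i + 1) - 1) < z → z < D (i + 1) →
          ¬ F (α z) := fun z hz1 hz2 hz => by
        have := Nat.le_findGreatest (P := fun x => F (α x)) (show z ≤ D (i + 1) - 1 by omega) hz
        omega
      set u := Nat.findGreatest (fun x => F (α x)) (D (i + 1) - 1)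
      refine ⟨u - D i, fun _ x hx => ?_⟩
      obtain ⟨c1, c2⟩ := h.congr (i := i) (j := x) (m := 1) fun r hr => by
        rw [show r = 0 by omega, add_zero, add_zero, hx]
      have hmi := h.mono (Nat.le_succ i)
      have hmx := h.mono (Nat.le_succ x)
      simp only [Nat.succ_eq_add_one] at hmi hmx
      refine ⟨by omega, ?_, fun z hz1 hz2 => ?_⟩
      · rw [← c2 (u - D i) (by omega), show D i + (u - D i) = u by omega]
        exact hspec
      · have := c2 (z - D x) (by omega)
        rw [show D x + (z - D x) = z by omega] at this
        rw [← this]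
        exact hno _ (by omega) (by omega)
    choose o ho using this
    exact ⟨o, fun x hx => ho _ hx x rfl⟩
  obtain ⟨nx, hnx⟩ : ∃ nx : ℕ → ℕ, ∀ y, F (α y) → D y ≤ nx y ∧ nx y < D (y + 1) ∧
      F (α (nx y)) ∧ ∀ z, D y ≤ z → z < nx y → ¬ F (α z) := by
    have : ∀ y, ∃ v, F (α y) → D y ≤ v ∧ v < D (y + 1) ∧
      F (α v) ∧ ∀ z, D y ≤ z → z < v → ¬ F (α z) := by
      intro y
      by_cases hy : F (α y)
      swap
      · exact ⟨0, fun hc => (hy hc).elim⟩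
      obtain ⟨s, hs, hsF⟩ := hFF _ hy
      obtain ⟨r, hr1, hr2, rfl⟩ := h.mem_image.1 hs
      have hex : ∃ v, D y ≤ v ∧ F (α v) := ⟨r, hr1, hsF⟩
      refine ⟨Nat.find hex, fun _ => ⟨(Nat.find_spec hex).1,
        (Nat.find_min' hex ⟨hr1, hsF⟩).trans_lt hr2, (Nat.find_spec hex).2,
        fun z hz1 hz2 hz => Nat.find_min hex hz2 ⟨hz1, hz⟩⟩⟩
    choose nx hnx using this
    exact ⟨nx, hnx⟩
  set x : ℕ → ℕ := fun k => (fun z => D z + o (α z))^[k] x0 with hxdef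
  set y : ℕ → ℕ := fun k => nx^[k] y0 with hydef
  have hxs : ∀ k, x (k + 1) = D (x k) + o (α (x k)) := fun k => by
    simp only [hxdef, Function.iterate_succ_apply']
  have hys : ∀ k, y (k + 1) = nx (y k) := fun k => by
    simp only [hydef, Function.iterate_succ_apply']
  have hcons : ∀ k, Consecutive α F (x k) (y k) := by
    intro k
    induction k with
    | zero => exact hxy0
    | succ k ih =>
      obtain ⟨a1, a2, a3, a4⟩ := ih
      obtain ⟨b1, b2, b3⟩ := ho _ a1
      obtain ⟨c1, c2, c3, c4⟩ := hnx _ a2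
      have hm1 := h.mono (show x k + 1 ≤ y k from a3)
      rw [hxs, hys]
      refine ⟨b2, c3, by omega, fun z hz1 hz2 hz => ?_⟩
      rcases Nat.lt_or_ge z (D (x k + 1)) with hlt | hge
      · exact b3 z hz1 hlt hz
      rcases Nat.lt_or_ge z (D (y k)) with hlt | hge'
      · obtain ⟨w, hw1, hw2⟩ := h.exists_block_one hD z
        have hw3 : x k < w := by
          by_contra hc
          have := h.mono (show w + 1 ≤ x k + 1 by omega)
          omega
        have hw4 : w < y k := by
          by_contra hc
          have := h.mono (show y k ≤ w by omega)
          omega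
        exact hSS _ (a4 w hw3 hw4) _ (h.mem_image.2 ⟨z, hw1, hw2, rfl⟩) hz
      · exact c4 z hge' hz2 hz
  have hxle : ∀ k, x (k + 1) + 1 ≤ D (x k + 1) := fun k => by
    rw [hxs]
    exact (ho _ (hcons k).1).1
  have hxge : ∀ k, D (x k) ≤ x (k + 1) := fun k => by rw [hxs]; omega
  have hyge : ∀ k, D (y k) ≤ y (k + 1) := fun k => by
    rw [hys]
    exact (hnx _ (hcons k).2.1).1
  have hyle : ∀ k, y (k + 1) < D (y k + 1) := fun k => by
    rw [hys]
    exact (hnx _ (hcons k).2.1).2.1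
  set g : ℕ → ℕ := fun k => y k - (x k + 1) with hgdef
  have hg2 : ∀ k, 2 * g k ≤ g (k + 1) := by
    intro k
    have a1 := h.add_two_mul_le h2 (x k + 1) (y k - (x k + 1))
    rw [Nat.add_sub_cancel' (hcons k).2.2.1] at a1
    have a2 := hxle k
    have a3 := hyge k
    simp only [hgdef]
    omega
  have hg1 : ∀ k, 1 ≤ g k := by
    intro k
    induction k with
    | zero => simp only [hgdef, hxdef, hydef, Function.iterate_zero, id]; omega
    | succ k ih => have := hg2 k; omega
  have hgmono : StrictMono g := strictMono_nat_of_lt_succ fun k => by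
    have := hg2 k
    have := hg1 k
    omega
  -- upper bound for the gaps
  have hgG : ∀ k i, D^[i] (y k) - D^[i] (x k + 1) + 2 * W * G i ≤ (g 0 + 2 * W) * G (i + k) := by
    intro k
    induction k with
    | zero =>
      intro i
      have a1 := h.iterate_sub_le (i := i) (B := G i) (p := x 0 + 1) (m := y 0 - (x 0 + 1))
        fun z hz1 hz2 => hGle _ _ ((hcons 0).2.2.2 z (by omega) (by omega))
      rw [Nat.add_sub_cancel' (hcons 0).2.2.1] at a1
      rw [add_zero, add_mul]
      simp only [hgdef]
      omega
    | succ k ih =>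
      intro i
      have a0 := ih (i + 1)
      rw [Function.iterate_succ_apply, Function.iterate_succ_apply,
        show i + 1 + k = i + (k + 1) by ring] at a0
      have hxk := hxle k
      have hxk' := hxge k
      have hyk := hyge k
      have hyk' := hyle k
      have hWx := hW (α (x k))
      have hWy := hW (α (y k))
      have hsx := h.succ (x k)
      have hsy := h.succ (y k)
      have hmid := h.mono (show x k + 1 ≤ y k from (hcons k).2.2.1)
      have a1 := h.iterate_sub_le (i := i) (B := G i) (p := x (k + 1) + 1)
        (m := D (x k + 1) - (x (k + 1) + 1)) fun z hz1 hz2 =>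
          hGle _ _ ((hcons (k + 1)).2.2.2 z (by omega) (by omega))
      rw [Nat.add_sub_cancel' hxk] at a1
      have a2 := h.iterate_sub_le (i := i) (B := G i) (p := D (y k))
        (m := y (k + 1) - D (y k)) fun z hz1 hz2 =>
          hGle _ _ ((hcons (k + 1)).2.2.2 z (by omega) (by omega))
      rw [Nat.add_sub_cancel' hyk] at a2
      have a3 : (D (x k + 1) - (x (k + 1) + 1)) * G i ≤ W * G i :=
        Nat.mul_le_mul_right _ (by omega)
      have a4 : (y (k + 1) - D (y k)) * G i ≤ W * G i := Nat.mul_le_mul_right _ (by omega)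
      have a5 := Nat.mul_le_mul_left (2 * W) (hG2 i)
      have a6 : 2 * W * (2 * G i) = 2 * (2 * W * G i) := by ring
      have a7 : 2 * W * G i = 2 * (W * G i) := by ring
      have a8 := (h.iterate i).mono hmid
      omega
  -- two gaps with equal left borders
  obtain ⟨k1, q, hq, hst1, hst2⟩ : ∃ k1 q, 1 ≤ q ∧ α (x k1) = α (x (k1 + q)) ∧
      α (x k1 + 1) = α (x (k1 + q) + 1) := by
    obtain ⟨a, b, hab, he⟩ := Finite.exists_ne_map_eq_of_infinite
      fun k => (α (x k), α (x k + 1))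
    simp only [Prod.mk.injEq] at he
    rcases Nat.lt_or_gt_of_ne hab with hlt | hlt
    · exact ⟨a, b - a, by omega, by rw [Nat.add_sub_cancel' hlt.le]; exact he⟩
    · exact ⟨b, a - b, by omega, by rw [Nat.add_sub_cancel' hlt.le]; exact ⟨he.1.symm, he.2.symm⟩⟩
  set X : ℕ → ℕ := fun j => x (k1 + j) with hX
  set X' : ℕ → ℕ := fun j => x (k1 + q + j) with hX'
  have hXs : ∀ j, X (j + 1) = D (X j) + o (α (X j)) := fun j => hxs (k1 + j)
  have hXs' : ∀ j, X' (j + 1) = D (X' j) + o (α (X' j)) := fun j => hxs (k1 + q + j)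
  have hleft : ∀ j, ∃ T, X j = D^[j] (X 0) + T ∧ X' j = D^[j] (X' 0) + T ∧
      ∀ r ≤ T, α (D^[j] (X 0) + r) = α (D^[j] (X' 0) + r) := by
    intro j
    induction j with
    | zero => exact ⟨0, rfl, rfl, fun r hr => by
        rw [show r = 0 by omega]; exact hst1⟩
    | succ j ih =>
      obtain ⟨T, t1, t2, t3⟩ := ih
      obtain ⟨c1, c2⟩ := h.congr (i := D^[j] (X 0)) (j := D^[j] (X' 0)) (m := T + 1)
        fun r hr => t3 r (by omega)
      obtain ⟨c3, -⟩ := h.congr (i := D^[j] (X 0)) (j := D^[j] (X' 0)) (m := T)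
        fun r hr => t3 r (by omega)
      rw [← add_assoc, ← add_assoc, ← t1, ← t2] at c1
      rw [← add_assoc, ← t1] at c2
      rw [← t1, ← t2] at c3
      have hlet : α (X j) = α (X' j) := by rw [t1, t2]; exact t3 T le_rfl
      have b1 := (ho _ (hcons (k1 + j)).1).1
      have b2 := h.mono (show D^[j] (X 0) ≤ X j by omega)
      have b3 := h.mono (show D^[j] (X' 0) ≤ X' j by omega)
      change D (X j) + o (α (X j)) < D (X j + 1) at b1
      refine ⟨D (X j) - D (D^[j] (X 0)) + o (α (X j)), ?_, ?_, fun r hr => ?_⟩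
      · rw [hXs, Function.iterate_succ_apply']
        omega
      · rw [hXs', Function.iterate_succ_apply', ← hlet]
        omega
      · rw [Function.iterate_succ_apply', Function.iterate_succ_apply']
        exact c2 r (by omega)
  -- first disagreement on the right
  have hdis : ∀ j, ∃ l, l ≤ g (k1 + j) ∧ α (X j + 1 + l) ≠ α (X' j + 1 + l) ∧
      ∀ r < l, α (X j + 1 + r) = α (X' j + 1 + r) := by
    intro j
    have hgg : g (k1 + j) < g (k1 + q + j) := hgmono (by omega)
    have hex : ∃ l, α (X j + 1 + l) ≠ α (X' j + 1 + l) := by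
      refine ⟨g (k1 + j), fun hc => ?_⟩
      have e1 : X j + 1 + g (k1 + j) = y (k1 + j) :=
        Nat.add_sub_cancel' (hcons (k1 + j)).2.2.1
      have a1 := (hcons (k1 + j)).2.1
      rw [← e1, hc] at a1
      refine (hcons (k1 + q + j)).2.2.2 _ ?_ ?_ a1
      · simp only [hX']; omega
      · simp only [hgdef] at hgg
        simp only [hX', hgdef]
        omega
    refine ⟨Nat.find hex, ?_, Nat.find_spec hex, fun r hr => not_not.1 (Nat.find_min hex hr)⟩
    by_contra hc
    have hc' := not_not.1 (Nat.find_min hex (not_le.1 hc))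
    have e1 : X j + 1 + g (k1 + j) = y (k1 + j) :=
      Nat.add_sub_cancel' (hcons (k1 + j)).2.2.1
    have a1 := (hcons (k1 + j)).2.1
    rw [← e1, hc'] at a1
    refine (hcons (k1 + q + j)).2.2.2 _ ?_ ?_ a1
    · simp only [hX']; omega
    · simp only [hgdef] at hgg
      simp only [hX', hgdef]
      omega
  choose l hlg hlne hleq using hdis
  have hlet : ∀ j, α (X j) = α (X' j) := fun j => by
    obtain ⟨T, t1, t2, t3⟩ := hleft j
    rw [t1, t2]
    exact t3 T le_rfl
  have hl2 : ∀ j, 2 * l j ≤ l (j + 1) := by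
    intro j
    obtain ⟨c1, c2⟩ := h.congr (i := X j) (j := X' j) (m := 1 + l j) fun r hr => by
      rcases Nat.eq_zero_or_pos r with rfl | hr0
      · exact hlet j
      · have := hleq j (r - 1) (by omega)
        convert this using 2 <;> omega
    by_contra hc
    refine hlne (j + 1) ?_
    have a1 := h.add_two_mul_le h2 (X j + 1) (l j)
    have a2 : X (j + 1) + 1 ≤ D (X j + 1) := hxle (k1 + j)
    have a3 := hXs j
    have := c2 (o (α (X j)) + 1 + l (j + 1)) (by rw [← add_assoc]; omega)
    rw [hXs, hXs', ← hlet]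
    convert this using 2 <;> ring
  have hl1 : ∀ j, 1 ≤ l j := by
    intro j
    induction j with
    | zero =>
      by_contra hc
      have := hlne 0
      rw [show l 0 = 0 by omega] at this
      exact this hst2
    | succ j ih => have := hl2 j; omega
  have hlmono : StrictMono l := strictMono_nat_of_lt_succ fun j => by
    have := hl2 j
    have := hl1 j
    omega
  refine ⟨(g 0 + 2 * W) * W ^ k1, Nat.mul_pos (by omega) (Nat.pow_pos hW1),
    fun n J hJ1 hJ2 => ?_⟩
  have hgn : ∀ j ∈ J, g (k1 + j) < n := by
    intro j hj
    have a1 := hgG (k1 + j) 0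
    have a2 := hGW j k1
    have a3 := hJ1 j hj (m j) (hmS j)
    have a4 := Nat.mul_le_mul_left (g 0 + 2 * W) a2
    rw [← mul_assoc] at a4
    change _ * G j < n at a3
    simp only [Function.iterate_zero, id, zero_add] at a1
    rw [add_comm j k1] at a4
    simp only [hgdef] at *
    omega
  have hT : ∀ j ∈ J, ∃ T, n ≤ T ∧ X j = D^[j] (X 0) + T ∧ X' j = D^[j] (X' 0) + T ∧
      ∀ r ≤ T, α (D^[j] (X 0) + r) = α (D^[j] (X' 0) + r) := by
    intro j hj
    obtain ⟨T, t1, t2, t3⟩ := hleft j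
    refine ⟨T, ?_, t1, t2, t3⟩
    have a1 := hJ2 j hj _ (hcons k1).1
    have a2 := (h.iterate j).succ (x k1)
    have hyj : ∀ j, D^[j] (x k1 + 1) ≤ y (k1 + j) := by
      intro j
      induction j with
      | zero => exact (hcons k1).2.2.1
      | succ j ih =>
        rw [Function.iterate_succ_apply']
        exact (h.mono ih).trans (hyge (k1 + j))
    have a3 := hyj j
    have a4 := hgn j hj
    have a5 : y (k1 + j) = X j + 1 + g (k1 + j) :=
      (Nat.add_sub_cancel' (hcons (k1 + j)).2.2.1).symm
    change X j = D^[j] (x k1) + T at t1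
    omega
  refine complexity_add_card_le α n J (fun j => X j + 1 + l j - n) (fun j => X' j + 1 + l j - n)
    ?_ ?_ ?_
  · have key : ∀ j ∈ J, ∀ j' ∈ J, factorAt α (X j + 1 + l j - n) n =
        factorAt α (X j' + 1 + l j' - n) n → ¬ j < j' := by
      intro j hj j' hj' he hlt
      rw [factorAt_eq_iff] at he
      obtain ⟨T, t1, t2, -, -⟩ := hT j hj
      obtain ⟨T', t1', t2', -, -⟩ := hT j' hj'
      have b1 := hlmono hlt
      have b2 := hlg j
      have b3 := hlg j'
      have b4 := hgn j hj
      have b5 := hgn j' hj'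
      have a1 := he (n - 1 - l j) (by omega)
      rw [show X j + 1 + l j - n + (n - 1 - l j) = X j by omega] at a1
      have a2 := (hcons (k1 + j)).1
      change F (α (X j)) at a2
      rw [a1] at a2
      have b6 : y (k1 + j') = X j' + 1 + g (k1 + j') :=
        (Nat.add_sub_cancel' (hcons (k1 + j')).2.2.1).symm
      refine (hcons (k1 + j')).2.2.2 _ ?_ ?_ a2
      · change X j' < _
        omega
      · omega
    intro j hj j' hj' he
    have a1 := key j hj j' hj' he
    have a2 := key j' hj' j hj he.symm
    omega
  · intro j hj
    obtain ⟨T, t0, t1, t2, t3⟩ := hT j hj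
    have b2 := hlg j
    have b4 := hgn j hj
    rw [factorAt_eq_iff]
    intro r hr
    rcases Nat.lt_or_ge r (n - l j) with hlt | hge
    · have := t3 (T + 1 + l j - n + r) (by omega)
      convert this using 2 <;> omega
    · have := hleq j (r - (n - l j)) (by omega)
      convert this using 2 <;> omega
  · intro j hj
    obtain ⟨T, t0, t1, t2, t3⟩ := hT j hj
    have := hlne j
    rw [show X j + 1 + l j - n + n = X j + 1 + l j by omega,
      show X' j + 1 + l j - n + n = X' j + 1 + l j by omega]
    exact this

end RightSpecial

/-! ### Exponential-polynomial growth -/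

/-- The growth function `k ↦ ρ ^ k * (k + 1) ^ d`. -/
noncomputable def expPoly (ρ : ℝ) (d k : ℕ) : ℝ := ρ ^ k * ((k : ℝ) + 1) ^ d

/-- `f` and `g` bound each other up to a constant factor. -/
def Comparable (f g : ℕ → ℝ) : Prop := ∃ C, ∀ k, f k ≤ C * g k ∧ g k ≤ C * f k

theorem comparable_of_le {f g : ℕ → ℝ} (hf : ∀ k, 0 ≤ f k) (hg : ∀ k, 0 ≤ g k) {C C' : ℝ}
    (h : ∀ k, f k ≤ C * g k) (h' : ∀ k, g k ≤ C' * f k) : Comparable f g :=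
  ⟨max C C', fun k => ⟨(h k).trans (mul_le_mul_of_nonneg_right (le_max_left _ _) (hg k)),
    (h' k).trans (mul_le_mul_of_nonneg_right (le_max_right _ _) (hf k))⟩⟩

theorem Comparable.trans {f g h : ℕ → ℝ} (hf : ∀ k, 0 ≤ f k) (hh : ∀ k, 0 ≤ h k)
    (hg : ∀ k, 0 ≤ g k) (hfg : Comparable f g) (hgh : Comparable g h) : Comparable f h := by
  obtain ⟨C, hC⟩ := hfg
  obtain ⟨C', hC'⟩ := hgh
  refine comparable_of_le hf hh (C := |C| * |C'|) (C' := |C'| * |C|) (fun k => ?_) fun k => ?_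
  · have h1 := (hC k).1.trans (mul_le_mul_of_nonneg_right (le_abs_self C) (hg k))
    have h2 := (hC' k).1.trans (mul_le_mul_of_nonneg_right (le_abs_self C') (hh k))
    have := mul_le_mul_of_nonneg_left h2 (abs_nonneg C)
    linarith
  · have h1 := (hC k).2.trans (mul_le_mul_of_nonneg_right (le_abs_self C) (hf k))
    have h2 := (hC' k).2.trans (mul_le_mul_of_nonneg_right (le_abs_self C') (hg k))
    have := mul_le_mul_of_nonneg_left h1 (abs_nonneg C')
    linarith

theorem expPoly_pos {ρ : ℝ} (hρ : 0 < ρ) (d k : ℕ) : 0 < expPoly ρ d k := by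
  unfold expPoly; positivity

theorem summable_geometric_mul_succ_pow {r : ℝ} (h0 : 0 < r) (h1 : r < 1) (d : ℕ) :
    Summable fun j : ℕ => r ^ j * ((j : ℝ) + 1) ^ d := by
  have h := summable_pow_mul_geometric_of_norm_lt_one (R := ℝ) d
    (r := r) (by rwa [Real.norm_eq_abs, abs_of_pos h0])
  have h' := ((summable_nat_add_iff 1).2 h).mul_left r⁻¹
  refine h'.congr fun j => ?_
  push_cast
  field_simp
  ring

theorem exists_expPoly_le_pow {ρ ρ' : ℝ} (hρ : 0 < ρ) (hlt : ρ < ρ') (d : ℕ) :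
    ∃ C, 0 ≤ C ∧ ∀ k, expPoly ρ d k ≤ C * ρ' ^ k := by
  have hρ' := hρ.trans hlt
  have hs := summable_geometric_mul_succ_pow (div_pos hρ hρ') ((div_lt_one hρ').2 hlt) d
  refine ⟨∑' j : ℕ, (ρ / ρ') ^ j * ((j : ℝ) + 1) ^ d, tsum_nonneg fun j => by positivity,
    fun k => ?_⟩
  have := hs.le_tsum k fun j _ => by positivity
  calc expPoly ρ d k = ((ρ / ρ') ^ k * ((k : ℝ) + 1) ^ d) * ρ' ^ k := by
        unfold expPoly; rw [div_pow]; field_simp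
    _ ≤ _ := by gcongr

theorem exists_expPoly_le {ρ ρ' : ℝ} {d d' : ℕ} (hρ : 0 < ρ)
    (h : toLex (ρ, d) ≤ toLex (ρ', d')) :
    ∃ C, 0 ≤ C ∧ ∀ k, expPoly ρ d k ≤ C * expPoly ρ' d' k := by
  rw [Prod.Lex.toLex_le_toLex] at h
  rcases h with h | ⟨h, h'⟩
  · obtain ⟨C, hC, hk⟩ := exists_expPoly_le_pow hρ h d
    refine ⟨C, hC, fun k => (hk k).trans ?_⟩
    have : (1 : ℝ) ≤ ((k : ℝ) + 1) ^ d' := one_le_pow₀ (by linarith [Nat.cast_nonneg (α := ℝ) k])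
    have h' : 0 ≤ ρ' ^ k := pow_nonneg (hρ.trans h).le k
    unfold expPoly
    exact mul_le_mul_of_nonneg_left (le_mul_of_one_le_right h' this) hC
  · simp only at h h'
    subst h
    refine ⟨1, zero_le_one, fun k => ?_⟩
    rw [one_mul]
    unfold expPoly
    exact mul_le_mul_of_nonneg_left
      (pow_le_pow_right₀ (by linarith [Nat.cast_nonneg (α := ℝ) k]) h') (by positivity)

theorem expPoly_succ_le {ρ : ℝ} (hρ : 0 < ρ) (d k : ℕ) :
    expPoly ρ d (k + 1) ≤ ρ * 2 ^ d * expPoly ρ d k := by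
  unfold expPoly
  have : ((k : ℝ) + 1 + 1) ^ d ≤ 2 ^ d * ((k : ℝ) + 1) ^ d := by
    rw [← mul_pow]
    exact pow_le_pow_left₀ (by positivity) (by linarith [Nat.cast_nonneg (α := ℝ) k]) d
  push_cast
  calc ρ ^ (k + 1) * ((k : ℝ) + 1 + 1) ^ d ≤ ρ ^ (k + 1) * (2 ^ d * ((k : ℝ) + 1) ^ d) := by
        gcongr
    _ = _ := by ring

theorem le_expPoly_succ {ρ : ℝ} (hρ : 1 ≤ ρ) (d k : ℕ) : expPoly ρ d k ≤ expPoly ρ d (k + 1) := by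
  unfold expPoly
  push_cast
  have h1 : ρ ^ k ≤ ρ ^ (k + 1) := pow_le_pow_right₀ hρ (by omega)
  have h2 : ((k : ℝ) + 1) ^ d ≤ ((k : ℝ) + 1 + 1) ^ d :=
    pow_le_pow_left₀ (by positivity) (by linarith) d
  exact mul_le_mul h1 h2 (by positivity) (by positivity)

/-- Shifting the argument does not change exponential-polynomial growth. -/
theorem comparable_of_succ {f : ℕ → ℝ} {ρ : ℝ} {d : ℕ} (hρ : 1 ≤ ρ) (hf : ∀ k, 0 < f k)
    (h : Comparable (fun k => f (k + 1)) (expPoly ρ d)) : Comparable f (expPoly ρ d) := by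
  obtain ⟨C, hC⟩ := h
  have hpos : 0 < ρ := by linarith
  have hC0 : 0 ≤ C :=
    (pos_of_mul_pos_left ((expPoly_pos hpos d 0).trans_le (hC 0).2) (hf 1).le).le
  have he : expPoly ρ d 0 = 1 := by simp [expPoly]
  refine comparable_of_le (fun k => (hf k).le) (fun k => (expPoly_pos hpos d k).le)
    (C := f 0 + C) (C' := (f 0)⁻¹ + ρ * 2 ^ d * C) (fun k => ?_) fun k => ?_
  · rcases k with _ | k
    · rw [he]; linarith
    · calc f (k + 1) ≤ C * expPoly ρ d k := (hC k).1
        _ ≤ C * expPoly ρ d (k + 1) := mul_le_mul_of_nonneg_left (le_expPoly_succ hρ d k) hC0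
        _ ≤ _ := mul_le_mul_of_nonneg_right (le_add_of_nonneg_left (hf 0).le)
          (expPoly_pos hpos d _).le
  · have h0 : 0 < (f 0)⁻¹ := inv_pos.2 (hf 0)
    rcases k with _ | k
    · rw [he, add_mul, inv_mul_cancel₀ (hf 0).ne']
      have := hf 0
      exact le_add_of_nonneg_right (by positivity)
    · calc expPoly ρ d (k + 1) ≤ ρ * 2 ^ d * expPoly ρ d k := expPoly_succ_le hpos d k
        _ ≤ ρ * 2 ^ d * (C * f (k + 1)) := mul_le_mul_of_nonneg_left (hC k).2 (by positivity)
        _ = (ρ * 2 ^ d * C) * f (k + 1) := by ring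
        _ ≤ _ := mul_le_mul_of_nonneg_right (le_add_of_nonneg_left h0.le) (hf _).le

theorem succ_pow_le_add (x : ℝ) (hx : 0 ≤ x) (d : ℕ) :
    (x + 1) ^ (d + 1) ≤ x ^ (d + 1) + (d + 1) * (x + 1) ^ d := by
  induction d with
  | zero => simp
  | succ d ih =>
    have h := mul_le_mul_of_nonneg_right ih (by linarith : 0 ≤ x + 1)
    have h1 : x ^ (d + 1) ≤ (x + 1) ^ (d + 1) := pow_le_pow_left₀ hx (by linarith) _
    push_cast
    calc (x + 1) ^ (d + 1 + 1) = (x + 1) ^ (d + 1) * (x + 1) := pow_succ _ _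
      _ ≤ (x ^ (d + 1) + (d + 1) * (x + 1) ^ d) * (x + 1) := h
      _ = x ^ (d + 1 + 1) + x ^ (d + 1) + (d + 1) * (x + 1) ^ (d + 1) := by ring
      _ ≤ _ := by linarith

theorem succ_pow_le_sum (d k : ℕ) :
    ((k : ℝ) + 1) ^ (d + 1) ≤
      1 + (d + 1) * 2 ^ d * ∑ j ∈ Finset.range k, ((j : ℝ) + 1) ^ d := by
  induction k with
  | zero => simp
  | succ k ih =>
    have h := succ_pow_le_add ((k : ℝ) + 1) (by positivity) d
    have h2 : ((k : ℝ) + 1 + 1) ^ d ≤ 2 ^ d * ((k : ℝ) + 1) ^ d := by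
      rw [← mul_pow]
      exact pow_le_pow_left₀ (by positivity) (by linarith [Nat.cast_nonneg (α := ℝ) k]) d
    have h3 := mul_le_mul_of_nonneg_left h2 (by positivity : (0 : ℝ) ≤ (d : ℝ) + 1)
    rw [Finset.sum_range_succ, mul_add]
    push_cast
    nlinarith

/-- The convolution of a geometric sequence with an exponential polynomial has
exponential-polynomial growth. -/
theorem exists_comparable_convolution {σ ρ : ℝ} (hσ : 1 ≤ σ) (hρ : 1 ≤ ρ) (d : ℕ) :
    ∃ ρ' d', 1 ≤ ρ' ∧ Comparable
      (fun k => σ ^ k + ∑ i ∈ Finset.range k, σ ^ i * expPoly ρ d (k - 1 - i))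
      (expPoly ρ' d') := by
  have hσ0 : 0 < σ := by linarith
  have hρ0 : 0 < ρ := by linarith
  have hnn : ∀ k, 0 ≤ ∑ i ∈ Finset.range k, σ ^ i * expPoly ρ d (k - 1 - i) := fun k =>
    Finset.sum_nonneg fun i _ => mul_nonneg (by positivity) (expPoly_pos hρ0 _ _).le
  have hnn' : ∀ k, 0 ≤ σ ^ k + ∑ i ∈ Finset.range k, σ ^ i * expPoly ρ d (k - 1 - i) := fun k =>
    add_nonneg (by positivity) (hnn k)
  rcases lt_trichotomy σ ρ with hlt | rfl | hlt
  · refine ⟨ρ, d, hρ, ?_⟩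
    have hr1 : σ / ρ < 1 := (div_lt_one hρ0).2 hlt
    have hs := summable_geometric_of_lt_one (by positivity : 0 ≤ σ / ρ) hr1
    refine comparable_of_le hnn' (fun k => (expPoly_pos hρ0 d k).le)
      (C := 1 + ∑' i : ℕ, (σ / ρ) ^ i) (C' := 1 + ρ * 2 ^ d) (fun k => ?_) fun k => ?_
    · rw [add_mul, one_mul]
      refine add_le_add ?_ ?_
      · unfold expPoly
        have : (1 : ℝ) ≤ ((k : ℝ) + 1) ^ d :=
          one_le_pow₀ (by linarith [Nat.cast_nonneg (α := ℝ) k])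
        calc σ ^ k ≤ ρ ^ k := pow_le_pow_left₀ hσ0.le hlt.le k
          _ ≤ _ := le_mul_of_one_le_right (by positivity) this
      · calc _ ≤ ∑ i ∈ Finset.range k, (σ / ρ) ^ i * expPoly ρ d k := by
              refine Finset.sum_le_sum fun i hi => ?_
              have hik := Finset.mem_range.1 hi
              have h1 : ρ ^ (k - 1 - i) ≤ ρ ^ (k - i) := pow_le_pow_right₀ hρ (by omega)
              have h2 : ((k - 1 - i : ℕ) : ℝ) + 1 ≤ (k : ℝ) + 1 := by
                have : ((k - 1 - i : ℕ) : ℝ) ≤ k := by exact_mod_cast (by omega : k - 1 - i ≤ k)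
                linarith
              have h3 : ρ ^ k = ρ ^ (k - i) * ρ ^ i := by rw [← pow_add]; congr 1; omega
              unfold expPoly
              rw [h3, div_pow]
              calc σ ^ i * (ρ ^ (k - 1 - i) * (((k - 1 - i : ℕ) : ℝ) + 1) ^ d)
                  ≤ σ ^ i * (ρ ^ (k - i) * ((k : ℝ) + 1) ^ d) := by gcongr
                _ = _ := by field_simp
          _ = (∑ i ∈ Finset.range k, (σ / ρ) ^ i) * expPoly ρ d k := by rw [Finset.sum_mul]
          _ ≤ _ := mul_le_mul_of_nonneg_right
            (hs.sum_le_tsum _ fun i _ => by positivity) (expPoly_pos hρ0 d k).le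
    · rcases k with _ | k
      · simp [expPoly]
        positivity
      · have h1 : expPoly ρ d k ≤
            ∑ i ∈ Finset.range (k + 1), σ ^ i * expPoly ρ d (k + 1 - 1 - i) := by
          have := Finset.single_le_sum
            (f := fun i => σ ^ i * expPoly ρ d (k + 1 - 1 - i))
            (fun i _ => mul_nonneg (by positivity) (expPoly_pos hρ0 _ _).le)
            (Finset.mem_range.2 (Nat.succ_pos k))
          simpa using this
        calc expPoly ρ d (k + 1) ≤ ρ * 2 ^ d * expPoly ρ d k := expPoly_succ_le hρ0 d k
          _ ≤ ρ * 2 ^ d * (σ ^ (k + 1) +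
              ∑ i ∈ Finset.range (k + 1), σ ^ i * expPoly ρ d (k + 1 - 1 - i)) := by
            gcongr
            exact h1.trans (le_add_of_nonneg_left (by positivity))
          _ ≤ _ := mul_le_mul_of_nonneg_right (by linarith) (hnn' _)
  · refine ⟨σ, d + 1, hσ, ?_⟩
    have hsum : ∀ k, σ * ∑ i ∈ Finset.range k, σ ^ i * expPoly σ d (k - 1 - i) =
        σ ^ k * ∑ j ∈ Finset.range k, ((j : ℝ) + 1) ^ d := fun k => by
      rw [← Finset.sum_range_reflect (fun j : ℕ => ((j : ℝ) + 1) ^ d), Finset.mul_sum,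
        Finset.mul_sum]
      refine Finset.sum_congr rfl fun i hi => ?_
      have hik := Finset.mem_range.1 hi
      have h3 : σ ^ k = σ * σ ^ i * σ ^ (k - 1 - i) := by
        rw [mul_assoc, ← pow_add, ← pow_succ']; congr 1; omega
      rw [h3, expPoly]
      ring
    refine comparable_of_le hnn' (fun k => (expPoly_pos hσ0 _ k).le)
      (C := 1) (C' := 1 + (d + 1) * 2 ^ d * σ) (fun k => ?_) fun k => ?_
    · have h1 : ∑ j ∈ Finset.range k, ((j : ℝ) + 1) ^ d ≤ k * ((k : ℝ) + 1) ^ d := by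
        have := Finset.sum_le_card_nsmul (Finset.range k) (fun j : ℕ => ((j : ℝ) + 1) ^ d)
          (((k : ℝ) + 1) ^ d) fun j hj => by
            have : (j : ℝ) ≤ k := by exact_mod_cast (Finset.mem_range.1 hj).le
            gcongr
        simpa using this
      have h2 : ∑ i ∈ Finset.range k, σ ^ i * expPoly σ d (k - 1 - i) ≤
          σ ^ k * (k * ((k : ℝ) + 1) ^ d) := by
        refine (le_mul_of_one_le_left (hnn k) hσ).trans ?_
        rw [hsum k]
        gcongr
      have h3 : (1 : ℝ) ≤ ((k : ℝ) + 1) ^ d :=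
        one_le_pow₀ (by linarith [Nat.cast_nonneg (α := ℝ) k])
      have h4 : σ ^ k * 1 ≤ σ ^ k * ((k : ℝ) + 1) ^ d := by gcongr
      unfold expPoly at *
      rw [pow_succ ((k : ℝ) + 1)]
      nlinarith
    · have h := mul_le_mul_of_nonneg_left (succ_pow_le_sum d k) (by positivity : 0 ≤ σ ^ k)
      have h1 : 0 ≤ (d + 1) * 2 ^ d * σ * σ ^ k := by positivity
      have h2 := hsum k
      have h3 := hnn k
      have h4 : σ ^ k * (1 + (d + 1) * 2 ^ d * ∑ j ∈ Finset.range k, ((j : ℝ) + 1) ^ d) =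
          σ ^ k + (d + 1) * 2 ^ d * (σ * ∑ i ∈ Finset.range k,
            σ ^ i * expPoly σ d (k - 1 - i)) := by rw [h2]; ring
      rw [h4] at h
      change σ ^ k * _ ≤ _
      refine h.trans ?_
      nlinarith
  · refine ⟨σ, 0, hσ, ?_⟩
    have hr1 : ρ / σ < 1 := (div_lt_one hσ0).2 hlt
    have hs := summable_geometric_mul_succ_pow (div_pos hρ0 hσ0) hr1 d
    have he : ∀ k, expPoly σ 0 k = σ ^ k := fun k => by simp [expPoly]
    refine comparable_of_le hnn' (fun k => (expPoly_pos hσ0 _ k).le)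
      (C := 1 + ∑' j : ℕ, (ρ / σ) ^ j * ((j : ℝ) + 1) ^ d) (C' := 1) (fun k => ?_) fun k => ?_
    · rw [add_mul, one_mul, he]
      refine add_le_add le_rfl ?_
      rw [← Finset.sum_range_reflect]
      calc _ ≤ ∑ j ∈ Finset.range k, ((ρ / σ) ^ j * ((j : ℝ) + 1) ^ d) * σ ^ k := by
            refine Finset.sum_le_sum fun j hj => ?_
            have hjk := Finset.mem_range.1 hj
            rw [show k - 1 - (k - 1 - j) = j by omega]
            have h1 : σ ^ (k - 1 - j) ≤ σ ^ (k - j) := pow_le_pow_right₀ hσ (by omega)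
            have h3 : σ ^ k = σ ^ (k - j) * σ ^ j := by rw [← pow_add]; congr 1; omega
            unfold expPoly
            rw [h3, div_pow]
            calc σ ^ (k - 1 - j) * (ρ ^ j * ((j : ℝ) + 1) ^ d)
                ≤ σ ^ (k - j) * (ρ ^ j * ((j : ℝ) + 1) ^ d) := by gcongr
              _ = _ := by field_simp
        _ = (∑ j ∈ Finset.range k, (ρ / σ) ^ j * ((j : ℝ) + 1) ^ d) * σ ^ k := by
          rw [Finset.sum_mul]
        _ ≤ _ := mul_le_mul_of_nonneg_right
          (hs.sum_le_tsum _ fun i _ => by positivity) (by positivity)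
    · rw [he, one_mul]
      exact le_add_of_nonneg_right (hnn k)

/-- A sequence multiplicative up to a constant factor is geometric up to that factor. -/
theorem exists_geometric_of_quasimultiplicative {f : ℕ → ℝ} {W : ℝ} (hf : ∀ k, 1 ≤ f k)
    (h1 : ∀ k l, f (k + l) ≤ W * (f k * f l)) (h2 : ∀ k l, f k * f l ≤ W * f (k + l)) :
    ∃ σ, 1 ≤ σ ∧ ∀ k, f k ≤ W * σ ^ k ∧ σ ^ k ≤ W * f k := by
  have hf0 : ∀ k, 0 < f k := fun k => by linarith [hf k]
  have hWf : f 0 ≤ W := by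
    have := h2 0 0
    rw [add_zero] at this
    exact le_of_mul_le_mul_right this (hf0 0)
  have hW : 1 ≤ W := (hf 0).trans hWf
  have hW0 : 0 < W := by linarith
  have hu : Subadditive fun k => Real.log (W * f k) := fun k l => by
    rw [← Real.log_mul (mul_pos hW0 (hf0 k)).ne' (mul_pos hW0 (hf0 l)).ne']
    refine Real.log_le_log (mul_pos hW0 (hf0 _)) ?_
    have := mul_le_mul_of_nonneg_left (h1 k l) hW0.le
    linarith
  have hv : Subadditive fun k => Real.log (W / f k) := fun k l => by
    rw [← Real.log_mul (div_pos hW0 (hf0 k)).ne' (div_pos hW0 (hf0 l)).ne']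
    refine Real.log_le_log (div_pos hW0 (hf0 _)) ?_
    rw [div_mul_div_comm, div_le_div_iff₀ (hf0 _) (mul_pos (hf0 _) (hf0 _))]
    have := mul_le_mul_of_nonneg_left (h2 k l) hW0.le
    linarith
  have hu0 : ∀ k, 0 ≤ Real.log (W * f k) := fun k =>
    Real.log_nonneg (by nlinarith [hf k])
  have huv : ∀ k, Real.log (W / f k) = 2 * Real.log W - Real.log (W * f k) := fun k => by
    rw [Real.log_div hW0.ne' (hf0 k).ne', Real.log_mul hW0.ne' (hf0 k).ne']
    ring
  have hub : BddBelow (Set.range fun k : ℕ => Real.log (W * f k) / k) :=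
    ⟨0, by rintro _ ⟨k, rfl⟩; exact div_nonneg (hu0 k) (Nat.cast_nonneg k)⟩
  have hvb : BddBelow (Set.range fun k : ℕ => Real.log (W / f k) / k) := by
    refine ⟨-(Real.log (W * f 1) + Real.log (W * f 0)), ?_⟩
    rintro _ ⟨k, rfl⟩
    rcases Nat.eq_zero_or_pos k with rfl | hk
    · have h3 := hu0 0
      have h4 := hu0 1
      simp only [Nat.cast_zero, div_zero]
      linarith
    · have hk' : (1 : ℝ) ≤ k := by exact_mod_cast hk
      have h3 := hu.apply_mul_add_le k 1 0
      simp only [mul_one, add_zero] at h3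
      have h4 := hu0 0
      have h5 := Real.log_nonneg hW
      simp only
      rw [le_div_iff₀ (by linarith), huv]
      nlinarith
  have hut := hu.tendsto_lim hub
  have hvt := hv.tendsto_lim hvb
  have hsum : hu.lim + hv.lim = 0 := by
    refine tendsto_nhds_unique (hut.add hvt) ?_
    refine (tendsto_const_div_atTop_nhds_zero_nat (2 * Real.log W)).congr fun k => ?_
    rw [← add_div, huv]
    ring
  have hlim : 0 ≤ hu.lim := ge_of_tendsto' hut fun k => div_nonneg (hu0 k) (Nat.cast_nonneg k)
  refine ⟨Real.exp hu.lim, Real.one_le_exp hlim, fun k => ?_⟩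
  rcases Nat.eq_zero_or_pos k with rfl | hk
  · simp only [pow_zero, mul_one]
    exact ⟨hWf, by nlinarith [hf 0]⟩
  have hk' : (0 : ℝ) < k := by exact_mod_cast hk
  rw [← Real.exp_nat_mul]
  constructor
  · have h3 := hv.lim_le_div hvb hk.ne'
    rw [le_div_iff₀ hk', ← neg_eq_of_add_eq_zero_right hsum, Real.le_log_iff_exp_le
      (div_pos hW0 (hf0 k)), neg_mul, Real.exp_neg, le_div_iff₀ (hf0 k), inv_mul_le_iff₀
      (Real.exp_pos _), mul_comm hu.lim, mul_comm (Real.exp _)] at h3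
    exact h3
  · have h3 := hu.lim_le_div hub hk.ne'
    rwa [le_div_iff₀ hk', Real.le_log_iff_exp_le (mul_pos hW0 (hf0 k)), mul_comm hu.lim] at h3

/-! ### Growth of letters -/

section Growth

variable {φ : A → List A}

theorem filter_wordMap {P : A → Bool} {ψ : A → List A} {u : List A}
    (h : ∀ s ∈ u, P s = false → ∀ r ∈ ψ s, P r = false) :
    (wordMap ψ u).filter P = wordMap (fun s => (ψ s).filter P) (u.filter P) := by
  induction u with
  | nil => simp
  | cons s u ih =>
    rw [wordMap_cons, List.filter_append, ih fun r hr => h r (by simp [hr])]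
    cases hs : P s with
    | true => rw [List.filter_cons_of_pos hs, wordMap_cons]
    | false =>
      rw [List.filter_cons_of_neg (by simp [hs]), List.filter_eq_nil_iff.2, List.nil_append]
      intro r hr
      simp [h s (by simp) hs r hr]

theorem mul_le_mul_length_wordMap {ψ : A → List A} {u : List A} {B W : ℕ}
    (h : ∀ s ∈ u, B ≤ W * (ψ s).length) : u.length * B ≤ W * (wordMap ψ u).length := by
  induction u with
  | nil => simp
  | cons s u ih =>
    have h1 := h s (by simp)
    have h2 := ih fun r hr => h r (by simp [hr])
    simp only [wordMap_cons, List.length_append, List.length_cons]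
    linarith

theorem cast_length_wordMap_le {ψ : A → List A} {u : List A} {B : ℝ}
    (h : ∀ s ∈ u, ((ψ s).length : ℝ) ≤ B) : ((wordMap ψ u).length : ℝ) ≤ u.length * B := by
  induction u with
  | nil => simp
  | cons s u ih =>
    have h1 := h s (by simp)
    have h2 := ih fun r hr => h r (by simp [hr])
    simp only [wordMap_cons, List.length_append, List.length_cons]
    push_cast
    linarith

theorem length_wordMap_filter_add (ψ : A → List A) (P : A → Bool) (u : List A) :
    (wordMap ψ u).length = (wordMap ψ (u.filter P)).length +
      (wordMap ψ (u.filter fun s => !P s)).length := by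
  induction u with
  | nil => simp
  | cons s u ih => cases hs : P s <;> simp [hs, ih] <;> omega

theorem mem_of_mem_img (htr : ∀ t s, s ∈ wordMap φ (φ t) → s ∈ φ t) {k : ℕ} {s t : A}
    (h : s ∈ img φ k t) : s = t ∨ s ∈ φ t := by
  induction k generalizing s with
  | zero => exact Or.inl (by simpa using h)
  | succ k ih =>
    rw [img_succ, mem_wordMap] at h
    obtain ⟨r, hr, hs⟩ := h
    rcases ih hr with rfl | hr
    · exact Or.inr hs
    · exact Or.inr (htr _ _ (mem_wordMap.2 ⟨r, hr, hs⟩))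

/-- Among finitely many letters of exponential-polynomial growth one dominates the others. -/
theorem exists_dominating_letter {u : List A} (hu : u ≠ [])
    (h : ∀ s ∈ u, ∃ ρ d, 1 ≤ ρ ∧
      Comparable (fun k => ((img φ k s).length : ℝ)) (expPoly ρ d)) :
    ∃ s ∈ u, ∃ ρ d C, 1 ≤ ρ ∧ 0 ≤ C ∧
      (∀ k, expPoly ρ d k ≤ C * ((img φ k s).length : ℝ)) ∧
      ∀ r ∈ u, ∀ k, ((img φ k r).length : ℝ) ≤ C * expPoly ρ d k := by
  classical
  choose! ρ d hρ C hC using h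
  obtain ⟨s, hs, hmax⟩ := Finset.exists_max_image u.toFinset (fun s => toLex (ρ s, d s))
    (List.toFinset_nonempty_iff u |>.2 hu)
  rw [List.mem_toFinset] at hs
  have hdom : ∀ r ∈ u, ∃ B, 0 ≤ B ∧ ∀ k, ((img φ k r).length : ℝ) ≤ B * expPoly (ρ s) (d s) k := by
    intro r hr
    have hr0 : 0 < ρ r := by linarith [hρ r hr]
    obtain ⟨B, hB, hk⟩ := exists_expPoly_le hr0 (hmax r (List.mem_toFinset.2 hr))
    refine ⟨|C r| * B, by positivity, fun k => ?_⟩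
    calc ((img φ k r).length : ℝ) ≤ C r * expPoly (ρ r) (d r) k := (hC r hr k).1
      _ ≤ |C r| * expPoly (ρ r) (d r) k :=
        mul_le_mul_of_nonneg_right (le_abs_self _) (expPoly_pos hr0 _ _).le
      _ ≤ |C r| * (B * expPoly (ρ s) (d s) k) :=
        mul_le_mul_of_nonneg_left (hk k) (abs_nonneg _)
      _ = _ := by ring
  choose! B hB hBk using hdom
  have hs0 : 0 < ρ s := by linarith [hρ s hs]
  refine ⟨s, hs, ρ s, d s, |C s| + ∑ r ∈ u.toFinset, B r, hρ s hs, ?_, fun k => ?_,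
    fun r hr k => ?_⟩
  · exact add_nonneg (abs_nonneg _)
      (Finset.sum_nonneg fun r hr => hB r (List.mem_toFinset.1 hr))
  · refine (hC s hs k).2.trans (mul_le_mul_of_nonneg_right ?_ (Nat.cast_nonneg _))
    exact (le_abs_self _).trans (le_add_of_nonneg_right
      (Finset.sum_nonneg fun r hr => hB r (List.mem_toFinset.1 hr)))
  · refine (hBk r hr k).trans (mul_le_mul_of_nonneg_right ?_ (expPoly_pos hs0 _ _).le)
    exact (Finset.single_le_sum (f := B) (fun r hr => hB r (List.mem_toFinset.1 hr))
      (List.mem_toFinset.2 hr)).trans (le_add_of_nonneg_left (abs_nonneg _))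

/-- The number of letters in the strongly connected component of `t` occurring in the iterated
images of `t` is geometric up to a constant factor. -/
theorem exists_geometric_component {W : ℕ} (hW : ∀ s, (φ s).length ≤ W)
    (htr : ∀ t s, s ∈ wordMap φ (φ t) → s ∈ φ t) {t : A} (ht : t ∈ φ t) {P : A → Bool}
    (hP : ∀ s, P s = true ↔ s ∈ φ t ∧ t ∈ φ s) :
    ∃ σ : ℝ, 1 ≤ σ ∧ ∀ k, (((img φ k t).filter P).length : ℝ) ≤ W * σ ^ k ∧
      σ ^ k ≤ W * (((img φ k t).filter P).length : ℝ) := by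
  have htr' : ∀ {r s u}, s ∈ φ r → u ∈ φ s → u ∈ φ r := fun h h' =>
    htr _ _ (mem_wordMap.2 ⟨_, h, h'⟩)
  have hPt : P t = true := (hP t).2 ⟨ht, ht⟩
  have hmem : ∀ k, t ∈ img φ k t := by
    intro k
    induction k with
    | zero => simp
    | succ k ih => rw [img_succ]; exact mem_wordMap.2 ⟨t, ih, ht⟩
  have hclosed : ∀ s, P s = true → ∀ k l, ∀ r ∈ img φ k s, P r = false → ∀ u ∈ img φ l r,
      P u = false := by
    intro s hs k l r hr hrP u hu
    by_contra hne
    rw [Bool.not_eq_false] at hne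
    obtain ⟨hs1, hs2⟩ := (hP s).1 hs
    obtain ⟨hu1, hu2⟩ := (hP u).1 hne
    have h1 : r ∈ φ t := by
      rcases mem_of_mem_img htr hr with rfl | h
      · exact hs1
      · exact htr' hs1 h
    have h2 : t ∈ φ r := by
      rcases mem_of_mem_img htr hu with rfl | h
      · exact hu2
      · exact htr' h hu2
    rw [(hP r).2 ⟨h1, h2⟩] at hrP
    exact absurd hrP (by simp)
  have hsplit : ∀ s, P s = true → ∀ k l, (img φ (k + l) s).filter P =
      wordMap (fun r => (img φ l r).filter P) ((img φ k s).filter P) := by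
    intro s hs k l
    rw [img_add]
    exact filter_wordMap (hclosed s hs k l)
  have hcmp : ∀ r s, P r = true → P s = true → ∀ k,
      ((img φ k r).filter P).length ≤ W * ((img φ k s).filter P).length := by
    intro r s hr hs k
    have hrs : r ∈ φ s := htr' ((hP s).1 hs).2 ((hP r).1 hr).1
    calc ((img φ k r).filter P).length ≤ ((img φ (1 + k) s).filter P).length := by
          rw [hsplit s hs 1 k, img_one]
          exact length_le_wordMap_of_mem (φ := fun r => (img φ k r).filter P)
            (List.mem_filter.2 ⟨hrs, hr⟩)
      _ = ((img φ (k + 1) s).filter P).length := by rw [add_comm]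
      _ ≤ W * ((img φ k s).filter P).length := by
          rw [hsplit s hs k 1, mul_comm]
          refine length_wordMap_le fun u _ => ?_
          rw [img_one]
          exact (List.length_filter_le _ _).trans (hW u)
  refine exists_geometric_of_quasimultiplicative
    (f := fun k => (((img φ k t).filter P).length : ℝ)) (fun k => ?_) (fun k l => ?_) fun k l => ?_
  · have : 0 < ((img φ k t).filter P).length :=
      List.length_pos_of_mem (List.mem_filter.2 ⟨hmem k, hPt⟩)
    exact_mod_cast this
  · have : ((img φ (k + l) t).filter P).length ≤
        ((img φ k t).filter P).length * (W * ((img φ l t).filter P).length) := by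
      rw [hsplit t hPt]
      exact length_wordMap_le fun s hs => hcmp s t (List.mem_filter.1 hs).2 hPt l
    calc (((img φ (k + l) t).filter P).length : ℝ) ≤ ((img φ k t).filter P).length *
          (W * ((img φ l t).filter P).length) := by exact_mod_cast this
      _ = _ := by ring
  · have : ((img φ k t).filter P).length * ((img φ l t).filter P).length ≤
        W * ((img φ (k + l) t).filter P).length := by
      rw [hsplit t hPt]
      exact mul_le_mul_length_wordMap fun s hs => hcmp t s hPt (List.mem_filter.1 hs).2 l
    exact_mod_cast this

/-- The length of the iterated images of a letter lying on a cycle, in terms of its component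
and of the letters below the component. -/
theorem exists_comparable_of_mem_self {W : ℕ} (hW : ∀ s, (φ s).length ≤ W)
    (htr : ∀ t s, s ∈ wordMap φ (φ t) → s ∈ φ t) {t : A} (ht : t ∈ φ t)
    (hlow : ∀ s ∈ φ t, t ∉ φ s → ∃ ρ d, 1 ≤ ρ ∧
      Comparable (fun k => ((img φ k s).length : ℝ)) (expPoly ρ d)) :
    ∃ ρ d, 1 ≤ ρ ∧ Comparable (fun k => ((img φ k t).length : ℝ)) (expPoly ρ d) := by
  classical
  have htr' : ∀ {r s u}, s ∈ φ r → u ∈ φ s → u ∈ φ r := fun h h' =>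
    htr _ _ (mem_wordMap.2 ⟨_, h, h'⟩)
  obtain ⟨P, hP⟩ : ∃ P : A → Bool, ∀ s, P s = true ↔ s ∈ φ t ∧ t ∈ φ s :=
    ⟨fun s => decide (s ∈ φ t ∧ t ∈ φ s), fun s => by simp⟩
  have hPt : P t = true := (hP t).2 ⟨ht, ht⟩
  obtain ⟨σ, hσ, ha⟩ := exists_geometric_component hW htr ht hP
  have hσ0 : 0 < σ := by linarith
  have himg : ∀ {k s}, s ∈ img φ k t → s ∈ φ t := fun {k s} h => by
    rcases mem_of_mem_img htr h with rfl | h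
    · exact ht
    · exact h
  by_cases hnl : (φ t).filter (fun s => !P s) = []
  · refine ⟨σ, 0, hσ, W, fun k => ?_⟩
    have hall : (img φ k t).filter P = img φ k t := by
      rw [List.filter_eq_self]
      intro s hs
      have := List.filter_eq_nil_iff.1 hnl s (himg hs)
      simpa using this
    have := ha k
    rw [hall] at this
    simpa [expPoly] using this
  obtain ⟨s, hs, ρ, d, C, hρ, hC, hlo, hup⟩ := exists_dominating_letter hnl fun s hs => by
    rw [List.mem_filter] at hs
    refine hlow s hs.1 fun hts => ?_
    have := (hP s).2 ⟨hs.1, hts⟩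
    simp [this] at hs
  have hρ0 : 0 < ρ := by linarith
  rw [List.mem_filter] at hs
  let T : ℕ → ℕ → ℕ := fun i j => (wordMap (img φ j) ((img φ i t).filter P)).length
  let R : ℕ → ℕ → ℕ := fun i j =>
    (wordMap (img φ j) ((wordMap φ ((img φ i t).filter P)).filter fun s => !P s)).length
  have hT : ∀ i j, T i (j + 1) = T (i + 1) j + R i j := by
    intro i j
    have h1 : wordMap (img φ (j + 1)) ((img φ i t).filter P) =
        wordMap (img φ j) (wordMap φ ((img φ i t).filter P)) := by
      have := wordMap_wordMap φ 1 j ((img φ i t).filter P)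
      rw [img_one, add_comm] at this
      exact this.symm
    have h2 : ∀ s ∈ img φ i t, P s = false → ∀ r ∈ φ s, P r = false := by
      intro s hs hsP r hr
      by_contra hne
      rw [Bool.not_eq_false] at hne
      rw [(hP s).2 ⟨himg hs, htr' hr ((hP r).1 hne).2⟩] at hsP
      exact absurd hsP (by simp)
    have h3 : (wordMap φ ((img φ i t).filter P)).filter P = (img φ (i + 1) t).filter P := by
      rw [img_succ, filter_wordMap h2, filter_wordMap fun s hs => h2 s (List.mem_filter.1 hs).1,
        List.filter_filter]
      simp
    simp only [T, R]
    rw [h1, length_wordMap_filter_add _ P, h3]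
  have hL : ∀ k m, m ≤ k → T 0 k = T m (k - m) + ∑ i ∈ Finset.range m, R i (k - 1 - i) := by
    intro k m
    induction m with
    | zero => simp
    | succ m ih =>
      intro hm
      rw [ih (by omega), Finset.sum_range_succ, show k - m = (k - (m + 1)) + 1 by omega, hT,
        show k - 1 - m = k - (m + 1) by omega]
      ring
  have hT0 : ∀ k, T 0 k = (img φ k t).length := fun k => by simp [T, hPt]
  have hTk : ∀ k, T k 0 = ((img φ k t).filter P).length := fun k => by
    have : wordMap (img φ 0) ((img φ k t).filter P) = (img φ k t).filter P := by
      rw [wordMap_img]; rfl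
    simp only [T, this]
  have hlen : ∀ k, ((img φ k t).length : ℝ) = ((img φ k t).filter P).length +
      ∑ i ∈ Finset.range k, (R i (k - 1 - i) : ℝ) := fun k => by
    have := hL k k le_rfl
    rw [hT0, Nat.sub_self, hTk] at this
    exact_mod_cast this
  have hRup : ∀ i j, (R i j : ℝ) ≤ (W * W * C) * (σ ^ i * expPoly ρ d j) := by
    intro i j
    have h1 : (R i j : ℝ) ≤ ((wordMap φ ((img φ i t).filter P)).filter fun s => !P s).length *
        (C * expPoly ρ d j) := by
      refine cast_length_wordMap_le fun r hr => hup r ?_ j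
      rw [List.mem_filter] at hr ⊢
      obtain ⟨u, hu, hru⟩ := mem_wordMap.1 hr.1
      exact ⟨htr' (himg (List.mem_filter.1 hu).1) hru, hr.2⟩
    have h2 : ((wordMap φ ((img φ i t).filter P)).filter fun s => !P s).length ≤
        ((img φ i t).filter P).length * W :=
      (List.length_filter_le _ _).trans (length_wordMap_le fun r _ => hW r)
    have h3 : (((wordMap φ ((img φ i t).filter P)).filter fun s => !P s).length : ℝ) ≤
        ((img φ i t).filter P).length * W := by exact_mod_cast h2
    have he := (expPoly_pos hρ0 d j).le
    calc (R i j : ℝ) ≤ _ := h1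
      _ ≤ (((img φ i t).filter P).length * W) * (C * expPoly ρ d j) := by gcongr
      _ ≤ ((W * σ ^ i) * W) * (C * expPoly ρ d j) := by gcongr; exact (ha i).1
      _ = _ := by ring
  have hRlo : ∀ i j, σ ^ i * expPoly ρ d j ≤ (W * C) * R i j := by
    intro i j
    have h1 : ((img φ i t).filter P).length * (img φ j s).length ≤ R i j := by
      have : wordMap (img φ j) ((wordMap φ ((img φ i t).filter P)).filter fun s => !P s) =
          wordMap (fun u => wordMap (img φ j) ((φ u).filter fun s => !P s))
            ((img φ i t).filter P) := by
        simp only [wordMap, List.filter_flatMap, List.flatMap_assoc]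
      simp only [R]
      rw [this]
      refine le_length_wordMap fun u hu => ?_
      refine length_le_wordMap_of_mem (φ := img φ j) (List.mem_filter.2 ⟨?_, hs.2⟩)
      exact htr' ((hP u).1 (List.mem_filter.1 hu).2).2 hs.1
    have h2 : (((img φ i t).filter P).length : ℝ) * (img φ j s).length ≤ R i j := by
      exact_mod_cast h1
    have he := (expPoly_pos hρ0 d j).le
    calc σ ^ i * expPoly ρ d j ≤ (W * (((img φ i t).filter P).length : ℝ)) *
          (C * (img φ j s).length) := by
            gcongr
            · exact (ha i).2
            · exact hlo j
      _ = (W * C) * ((((img φ i t).filter P).length : ℝ) * (img φ j s).length) := by ring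
      _ ≤ _ := by gcongr
  obtain ⟨ρ', d', hρ', hcomp⟩ := exists_comparable_convolution hσ hρ d
  refine ⟨ρ', d', hρ', Comparable.trans (fun k => Nat.cast_nonneg _)
    (fun k => (expPoly_pos (by linarith) d' k).le) (fun k => ?_) ?_ hcomp⟩
  · exact add_nonneg (by positivity) (Finset.sum_nonneg fun i _ =>
      mul_nonneg (by positivity) (expPoly_pos hρ0 _ _).le)
  refine comparable_of_le (C := W + W * W * C) (C' := W + W * C) (fun k => Nat.cast_nonneg _)
    (fun k => ?_) (fun k => ?_) fun k => ?_
  · exact add_nonneg (by positivity) (Finset.sum_nonneg fun i _ =>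
      mul_nonneg (by positivity) (expPoly_pos hρ0 _ _).le)
  · have h1 : ∑ i ∈ Finset.range k, (R i (k - 1 - i) : ℝ) ≤
        (W * W * C) * ∑ i ∈ Finset.range k, σ ^ i * expPoly ρ d (k - 1 - i) := by
      rw [Finset.mul_sum]
      exact Finset.sum_le_sum fun i _ => hRup i _
    have h2 : 0 ≤ ∑ i ∈ Finset.range k, σ ^ i * expPoly ρ d (k - 1 - i) :=
      Finset.sum_nonneg fun i _ => mul_nonneg (by positivity) (expPoly_pos hρ0 _ _).le
    have h3 := (ha k).1
    have h4 : 0 ≤ W * W * C * σ ^ k := by positivity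
    have h5 := mul_nonneg (Nat.cast_nonneg (α := ℝ) W) h2
    rw [hlen k]
    nlinarith
  · have h1 : ∑ i ∈ Finset.range k, σ ^ i * expPoly ρ d (k - 1 - i) ≤
        (W * C) * ∑ i ∈ Finset.range k, (R i (k - 1 - i) : ℝ) := by
      rw [Finset.mul_sum]
      exact Finset.sum_le_sum fun i _ => hRlo i _
    have h2 : 0 ≤ ∑ i ∈ Finset.range k, (R i (k - 1 - i) : ℝ) :=
      Finset.sum_nonneg fun i _ => Nat.cast_nonneg _
    have h3 := (ha k).2
    have h4 : 0 ≤ W * C * (((img φ k t).filter P).length : ℝ) := by positivity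
    have h5 := mul_nonneg (Nat.cast_nonneg (α := ℝ) W) h2
    rw [hlen k]
    nlinarith

/-- Every letter has exponential-polynomial growth. -/
theorem exists_comparable_length [Finite A] (hne : ∀ t, φ t ≠ [])
    (htr : ∀ t s, s ∈ wordMap φ (φ t) → s ∈ φ t) (t : A) :
    ∃ ρ d, 1 ≤ ρ ∧ Comparable (fun k => ((img φ k t).length : ℝ)) (expPoly ρ d) := by
  obtain ⟨W, -, hW⟩ := exists_length_le φ
  have htr' : ∀ {r s u}, s ∈ φ r → u ∈ φ s → u ∈ φ r := fun h h' =>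
    htr _ _ (mem_wordMap.2 ⟨_, h, h'⟩)
  induction hn : (insert t {s | s ∈ φ t}).ncard using Nat.strong_induction_on generalizing t with
  | _ n ih =>
  subst hn
  have hdesc : ∀ s ∈ φ t, s ≠ t → t ∉ φ s → ∃ ρ d, 1 ≤ ρ ∧
      Comparable (fun k => ((img φ k s).length : ℝ)) (expPoly ρ d) := by
    intro s hs hst hts
    refine ih _ (Set.ncard_lt_ncard ⟨?_, fun hsub => ?_⟩ (Set.toFinite _)) s rfl
    · rintro u (rfl | hu)
      · exact Or.inr hs
      · exact Or.inr (htr' hs hu)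
    · rcases hsub (Or.inl rfl) with h | h
      · exact hst h.symm
      · exact hts h
  by_cases ht : t ∈ φ t
  · exact exists_comparable_of_mem_self hW htr ht fun s hs hts =>
      hdesc s hs (fun h => hts (h ▸ ht)) hts
  · obtain ⟨s, hs, ρ, d, C, hρ, hC, hlo, hup⟩ := exists_dominating_letter (hne t)
      fun s hs => hdesc s hs (fun h => ht (h ▸ hs)) fun h => ht (htr' hs h)
    have hρ0 : 0 < ρ := by linarith
    refine ⟨ρ, d, hρ, comparable_of_succ hρ (fun k => ?_) ?_⟩
    · exact_mod_cast List.length_pos_iff.2 (img_ne_nil hne k t)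
    · refine comparable_of_le (C := W * C) (C' := C) (fun k => Nat.cast_nonneg _)
        (fun k => (expPoly_pos hρ0 d k).le) (fun k => ?_) fun k => ?_
      · rw [img_succ']
        have he := (expPoly_pos hρ0 d k).le
        calc _ ≤ ((φ t).length : ℝ) * (C * expPoly ρ d k) :=
              cast_length_wordMap_le fun r hr => hup r hr k
          _ ≤ (W : ℝ) * (C * expPoly ρ d k) := by gcongr; exact_mod_cast hW t
          _ = _ := by ring
      · refine (hlo k).trans (mul_le_mul_of_nonneg_left ?_ hC)
        rw [img_succ']
        exact_mod_cast length_le_wordMap_of_mem hs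

end Growth

/-- Either all letters grow at the same rate up to a polynomial factor, and then either at the
same rate or with a polynomial gap, or there is an exponential gap. -/
theorem growth_trichotomy [Finite A] {φ : A → List A} (hne : ∀ t, φ t ≠ [])
    (htr : ∀ t s, s ∈ wordMap φ (φ t) → s ∈ φ t) :
    (∃ C : ℕ, ∀ s t k, (img φ k t).length ≤ C * (img φ k s).length) ∨
    (∃ F : A → Prop, (∃ t, F t) ∧ (∃ t, ¬F t) ∧
      (∃ C e : ℕ, ∀ s t k, (img φ k t).length ≤ C * (k + 1) ^ e * (img φ k s).length) ∧
      ∃ c : ℕ, ∀ f s k, F f → ¬F s → (k + 1) * (img φ k s).length ≤ c * (img φ k f).length) ∨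
    ∃ F : A → Prop, (∃ t, F t) ∧ (∃ t, ¬F t) ∧ ∃ q c : ℕ, 1 ≤ q ∧
      ∀ f s k, F f → ¬F s → 2 ^ (k / q) * (img φ k s).length ≤ c * (img φ k f).length := by
  classical
  have := Fintype.ofFinite A
  rcases isEmpty_or_nonempty A with hA | hA
  · exact Or.inl ⟨0, fun s => isEmptyElim s⟩
  choose ρ d hρ C hC using exists_comparable_length hne htr
  have hρ0 : ∀ t, 0 < ρ t := fun t => by linarith [hρ t]
  have hpos : ∀ t k, (0 : ℝ) < (img φ k t).length := fun t k => by
    exact_mod_cast List.length_pos_iff.2 (img_ne_nil hne k t)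
  have hC0 : ∀ t, 0 < C t := fun t =>
    pos_of_mul_pos_left ((expPoly_pos (hρ0 t) (d t) 0).trans_le (hC t 0).2) (hpos t 0).le
  have hcast : ∀ B : A → A → ℝ, ∃ c : ℕ, ∀ s t, B s t ≤ c := fun B => by
    obtain ⟨b, hb⟩ := (Set.finite_range fun x : A × A => B x.1 x.2).bddAbove
    exact ⟨⌈b⌉₊, fun s t => (hb ⟨(s, t), rfl⟩).trans (Nat.le_ceil b)⟩
  -- a comparison of growth functions gives a comparison of lengths
  have hlen : ∀ {s t k} {g B : ℝ}, 0 ≤ g → 0 ≤ B →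
      g * expPoly (ρ s) (d s) k ≤ B * expPoly (ρ t) (d t) k →
      g * (img φ k s).length ≤ (C s * B * C t) * (img φ k t).length := by
    intro s t k g B hg hB h
    calc g * ((img φ k s).length : ℝ) ≤ g * (C s * expPoly (ρ s) (d s) k) :=
          mul_le_mul_of_nonneg_left (hC s k).1 hg
      _ = C s * (g * expPoly (ρ s) (d s) k) := by ring
      _ ≤ C s * (B * expPoly (ρ t) (d t) k) := mul_le_mul_of_nonneg_left h (hC0 s).le
      _ ≤ C s * (B * (C t * (img φ k t).length)) := by
          have := hC0 s
          have := (hC t k).2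
          gcongr
      _ = _ := by ring
  by_cases hall : ∀ s t, ρ s = ρ t
  · obtain ⟨e, he⟩ : ∃ e, ∀ t, d t ≤ e := by
      obtain ⟨e, he⟩ := (Set.finite_range d).bddAbove
      exact ⟨e, fun t => he ⟨t, rfl⟩⟩
    by_cases hd : ∀ s t, d s = d t
    · obtain ⟨c, hc⟩ := hcast fun s t => C t * 1 * C s
      refine Or.inl ⟨c, fun s t k => ?_⟩
      have := hlen (s := t) (t := s) (k := k) (g := 1) (B := 1) zero_le_one zero_le_one
        (by rw [hall s t, hd s t])
      rw [one_mul] at this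
      have h2 := this.trans (mul_le_mul_of_nonneg_right (hc s t) (hpos s k).le)
      exact_mod_cast h2
    · right; left
      push Not at hd
      obtain ⟨s₀, t₀, hst⟩ := hd
      obtain ⟨m, hm⟩ := Finite.exists_min d
      refine ⟨fun t => d m < d t, ?_, ⟨m, by simp⟩, ?_, ?_⟩
      · by_contra! h
        have h1 := h s₀
        have h2 := h t₀
        have h3 := hm s₀
        have h4 := hm t₀
        omega
      · obtain ⟨c, hc⟩ := hcast fun s t => C t * 1 * C s
        refine ⟨c, e, fun s t k => ?_⟩
        have hk : (1 : ℝ) ≤ (k : ℝ) + 1 := by linarith [Nat.cast_nonneg (α := ℝ) k]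
        have := hlen (s := t) (t := s) (k := k) (g := 1) (B := ((k : ℝ) + 1) ^ e) zero_le_one
          (by positivity) (by
            unfold expPoly
            rw [hall s t, one_mul, mul_left_comm]
            refine mul_le_mul_of_nonneg_left ?_ (pow_nonneg (hρ0 t).le k)
            rw [← pow_add]
            exact pow_le_pow_right₀ hk ((he t).trans (Nat.le_add_right _ _)))
        rw [one_mul] at this
        have h2 : ((img φ k t).length : ℝ) ≤ c * ((k : ℝ) + 1) ^ e * (img φ k s).length := by
          refine this.trans (mul_le_mul_of_nonneg_right ?_ (hpos s k).le)
          have := mul_le_mul_of_nonneg_right (hc s t)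
            (by positivity : (0 : ℝ) ≤ ((k : ℝ) + 1) ^ e)
          linarith
        exact_mod_cast h2
      · obtain ⟨c, hc⟩ := hcast fun s t => C t * 1 * C s
        refine ⟨c, fun f s k hf hs => ?_⟩
        have hk : (1 : ℝ) ≤ (k : ℝ) + 1 := by linarith [Nat.cast_nonneg (α := ℝ) k]
        have := hlen (s := s) (t := f) (k := k) (g := (k : ℝ) + 1) (B := 1) (by linarith)
          zero_le_one (by
            unfold expPoly
            rw [hall s f, one_mul, mul_left_comm]
            refine mul_le_mul_of_nonneg_left ?_ (pow_nonneg (hρ0 f).le k)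
            rw [← pow_succ']
            exact pow_le_pow_right₀ hk (by omega))
        have h2 := this.trans (mul_le_mul_of_nonneg_right (hc f s) (hpos f k).le)
        exact_mod_cast h2
  · right; right
    push Not at hall
    obtain ⟨s₀, t₀, hst⟩ := hall
    obtain ⟨m, hm⟩ := Finite.exists_max ρ
    have hex : ∃ t, ¬ρ t = ρ m := by
      by_contra! h
      exact hst ((h s₀).trans (h t₀).symm)
    -- a number strictly between the largest rate and all the others
    obtain ⟨τ, hτ, hτm, hτρ⟩ : ∃ τ : ℝ, 1 ≤ τ ∧ τ < ρ m ∧ ∀ s, ρ s ≠ ρ m → ρ s ≤ τ := by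
      obtain ⟨v, hv, hvmax⟩ := Finset.exists_max_image
        (Finset.univ.filter fun t => ¬ρ t = ρ m) ρ (by simpa [Finset.Nonempty] using hex)
      rw [Finset.mem_filter] at hv
      exact ⟨ρ v, hρ v, lt_of_le_of_ne (hm v) hv.2, fun s hs => hvmax s (by simp [hs])⟩
    have hτ0 : 0 < τ := by linarith
    obtain ⟨χ, hχ1, hχ2⟩ := exists_between hτm
    have hθ : 1 < ρ m / χ := (one_lt_div (by linarith)).2 hχ2
    obtain ⟨q, hq⟩ := pow_unbounded_of_one_lt 2 hθ
    have hq1 : 1 ≤ q := by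
      rcases Nat.eq_zero_or_pos q with rfl | h
      · norm_num at hq
      · exact h
    have hBex : ∀ s, ∃ B, 0 ≤ B ∧ (ρ s ≠ ρ m → ∀ k, expPoly (ρ s) (d s) k ≤ B * χ ^ k) := by
      intro s
      by_cases hs : ρ s = ρ m
      · exact ⟨0, le_rfl, fun h => absurd hs h⟩
      · obtain ⟨B, hB, hk⟩ := exists_expPoly_le_pow (hρ0 s) ((hτρ s hs).trans_lt hχ1) (d s)
        exact ⟨B, hB, fun _ => hk⟩
    choose B hB hBk using hBex
    obtain ⟨c, hc⟩ := hcast fun s t => C t * B t * C s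
    refine ⟨fun t => ρ t = ρ m, ⟨m, rfl⟩, hex, q, c, hq1, fun f s k hf hs => ?_⟩
    have hχ0 : 0 < χ := by linarith
    have := hlen (s := s) (t := f) (k := k) (g := 2 ^ (k / q)) (B := B s) (by positivity)
      (hB s) (by
        have h1 : (2 : ℝ) ^ (k / q) ≤ (ρ m / χ) ^ k := by
          calc (2 : ℝ) ^ (k / q) ≤ ((ρ m / χ) ^ q) ^ (k / q) := by gcongr
            _ = (ρ m / χ) ^ (q * (k / q)) := by rw [pow_mul]
            _ ≤ _ := pow_le_pow_right₀ hθ.le (Nat.mul_div_le k q)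
        have h2 : (1 : ℝ) ≤ ((k : ℝ) + 1) ^ d f :=
          one_le_pow₀ (by linarith [Nat.cast_nonneg (α := ℝ) k])
        have hm0 := hρ0 m
        have hBs := hB s
        calc (2 : ℝ) ^ (k / q) * expPoly (ρ s) (d s) k
            ≤ (ρ m / χ) ^ k * (B s * χ ^ k) :=
              mul_le_mul h1 (hBk s hs k) (expPoly_pos (hρ0 s) _ _).le (by positivity)
          _ = B s * (ρ m ^ k * 1) := by rw [div_pow]; field_simp
          _ ≤ B s * (ρ m ^ k * ((k : ℝ) + 1) ^ d f) := by gcongr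
          _ = B s * expPoly (ρ f) (d f) k := by rw [expPoly, hf])
    have h2 := this.trans (mul_le_mul_of_nonneg_right (hc f s) (hpos f k).le)
    exact_mod_cast h2

/-! ### The growing case -/

section GrowingCase

variable {φ : A → List A} {α : ℕ → A} {D : ℕ → ℕ}

theorem two_pow_mul_length_img_le (h2 : ∀ t, 2 ≤ (φ t).length) (k j : ℕ) (t : A) :
    2 ^ j * (img φ k t).length ≤ (img φ (k + j) t).length := by
  induction j with
  | zero => simp
  | succ j ih =>
    have := two_mul_length_img_le h2 (k + j) t
    rw [← add_assoc, pow_succ]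
    linarith

theorem two_pow_le_length_img (h2 : ∀ t, 2 ≤ (φ t).length) (k : ℕ) (t : A) :
    2 ^ k ≤ (img φ k t).length := by
  simpa using two_pow_mul_length_img_le h2 0 k t

theorem stableFrom_succ (hne : ∀ t, φ t ≠ []) {e e' : A → A}
    (he : ∀ t, e (e t) = e t ∧ ∃ z, φ t = e t :: z)
    (he' : ∀ t, e' (e' t) = e' t ∧ ∃ z, (φ t).reverse = e' t :: z) {n K : ℕ}
    (hK : ∀ t, n ≤ (img φ K t).length) : StableFrom φ n (K + 1) := by
  intro K' hK' t
  refine ⟨take_img_of_long hne (fun t => (he t).2) (fun t => (he t).1) hK hK' t, ?_⟩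
  have := take_img_of_long (φ := fun t => (φ t).reverse) (by simpa using hne)
    (fun t => (he' t).2) (fun t => (he' t).1) (n := n) (K := K)
    (by simpa [img_reverse] using hK) hK' t
  simpa only [img_reverse] using this

theorem FixedBy.exists_complexity_le_clog [Finite A] (h : FixedBy φ α D)
    (hD : ∀ j, 1 ≤ j → j < D j) (h2 : ∀ t, 2 ≤ (φ t).length)
    (hst : ∀ n K, (∀ t, n ≤ (img φ K t).length) → StableFrom φ n (K + 1)) :
    ∃ C, ∀ n, complexity α n ≤ C * (n + 1) * (Nat.clog 2 n + 2) := by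
  obtain ⟨C, hC⟩ := h.exists_complexity_le hD
  refine ⟨C, fun n => (hC n (Nat.clog 2 n + 1) (hst n _ fun t => ?_)).trans ?_⟩
  · exact (Nat.le_pow_clog one_lt_two n).trans (two_pow_le_length_img h2 _ t)
  · refine Nat.mul_le_mul_left _ ?_
    refine (Nat.add_le_add_left (@Finset.card_filter_le _ _ _ (_)) 1).trans ?_
    rw [Finset.card_range]
    omega

theorem FixedBy.exists_complexity_le_clog_clog [Finite A] (h : FixedBy φ α D)
    (hD : ∀ j, 1 ≤ j → j < D j) (h2 : ∀ t, 2 ≤ (φ t).length)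
    (hst : ∀ n K, (∀ t, n ≤ (img φ K t).length) → StableFrom φ n (K + 1)) {B e : ℕ}
    (hB : ∀ s t k, (img φ k t).length ≤ B * (k + 1) ^ e * (img φ k s).length) :
    ∃ C, ∀ n, complexity α n ≤ C * (n + 1) * (1 + e * Nat.clog 2 (Nat.clog 2 n + 1)) := by
  classical
  obtain ⟨C, hC⟩ := h.exists_complexity_le hD
  refine ⟨C * (Nat.clog 2 B + 4), fun n => ?_⟩
  have hex : ∃ K, ∀ t, n ≤ (img φ K t).length := ⟨Nat.clog 2 n, fun t =>
    (Nat.le_pow_clog one_lt_two n).trans (two_pow_le_length_img h2 _ t)⟩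
  obtain ⟨K₀, hK₀, hmin⟩ : ∃ K, (∀ t, n ≤ (img φ K t).length) ∧
      ∀ K' < K, ∃ t, (img φ K' t).length < n := ⟨Nat.find hex, Nat.find_spec hex, fun K' hK' => by
    simpa using Nat.find_min hex hK'⟩
  have hK₀le : K₀ ≤ Nat.clog 2 n := by
    by_contra! hlt
    obtain ⟨t, ht⟩ := hmin _ hlt
    have := (Nat.le_pow_clog one_lt_two n).trans (two_pow_le_length_img h2 _ t)
    omega
  have hbase := hC n (K₀ + 1) (hst n _ hK₀)
  set X := Nat.clog 2 B + e * Nat.clog 2 (Nat.clog 2 n + 1) with hX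
  have hcard : ((Finset.range (K₀ + 1)).filter fun K => ∃ t, n ≤ (img φ (K + 1) t).length).card
      ≤ X + 3 := by
    have hsub : ((Finset.range (K₀ + 1)).filter fun K => ∃ t, n ≤ (img φ (K + 1) t).length) ⊆
        Finset.Ico (K₀ + 1 - (X + 3)) (K₀ + 1) := by
      intro K hK
      rw [Finset.mem_filter, Finset.mem_range] at hK
      rw [Finset.mem_Ico]
      refine ⟨?_, hK.1⟩
      obtain ⟨t, ht⟩ := hK.2
      by_contra! hlt
      obtain ⟨s, hs⟩ := hmin (K₀ - 1) (by omega)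
      have h3 := two_pow_mul_length_img_le h2 (K + 1) (K₀ - 1 - (K + 1)) s
      rw [show K + 1 + (K₀ - 1 - (K + 1)) = K₀ - 1 by omega] at h3
      have h4 : 2 ^ (K₀ - 1 - (K + 1)) * (img φ (K + 1) s).length <
          B * (K + 1 + 1) ^ e * (img φ (K + 1) s).length :=
        h3.trans_lt (hs.trans_le (ht.trans (hB s t (K + 1))))
      have h5 := lt_of_mul_lt_mul_right h4 (Nat.zero_le _)
      have h6 : B * (K + 1 + 1) ^ e ≤ 2 ^ X := by
        rw [hX, pow_add]
        refine Nat.mul_le_mul (Nat.le_pow_clog one_lt_two B) ?_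
        rw [mul_comm, pow_mul]
        refine Nat.pow_le_pow_left ?_ e
        exact (by omega : K + 1 + 1 ≤ Nat.clog 2 n + 1).trans (Nat.le_pow_clog one_lt_two _)
      have h7 := (Nat.pow_lt_pow_iff_right (a := 2) one_lt_two).1 (h5.trans_le h6)
      omega
    have := Finset.card_le_card hsub
    rw [Nat.card_Ico] at this
    omega
  have h8 : complexity α n ≤ C * (n + 1) * (X + 4) := by
    refine hbase.trans (Nat.mul_le_mul_left _ ?_)
    have : ∀ i : DecidablePred fun K => ∃ t, n ≤ (img φ (K + 1) t).length,
        (@Finset.filter _ (fun K => ∃ t, n ≤ (img φ (K + 1) t).length) i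
          (Finset.range (K₀ + 1))).card ≤ X + 3 := fun i => by convert hcard
    have := this (fun K => Classical.propDecidable _)
    omega
  refine h8.trans ?_
  have h9 : X + 4 ≤ (Nat.clog 2 B + 4) * (1 + e * Nat.clog 2 (Nat.clog 2 n + 1)) := by
    rw [hX]; nlinarith [Nat.zero_le (Nat.clog 2 B * (e * Nat.clog 2 (Nat.clog 2 n + 1)))]
  calc C * (n + 1) * (X + 4) ≤ C * (n + 1) * ((Nat.clog 2 B + 4) *
        (1 + e * Nat.clog 2 (Nat.clog 2 n + 1))) := Nat.mul_le_mul_left _ h9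
    _ = _ := by ring

/-- A gap between the growth rates of letters forces many right special factors. -/
theorem FixedBy.exists_complexity_add_le [Finite A] (h : FixedBy φ α D)
    (hD : ∀ j, 1 ≤ j → j < D j) (h2 : ∀ t, 2 ≤ (φ t).length) (hsurj : Function.Surjective α)
    {F : A → Prop} (hF : ∃ t, F t) (hS : ∃ t, ¬F t) {R : ℕ → ℕ} {c : ℕ}
    (hR : ∀ N, ∃ k, N ≤ R k)
    (hgap : ∀ f s k, F f → ¬F s → R k * (img φ k s).length ≤ c * (img φ k f).length) :
    ∃ w N, 1 ≤ w ∧ ∀ n, N ≤ n → ∃ j, Nat.log 2 n ≤ w * (j + 2) ∧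
      ∀ x, (∀ i < x, i ≤ j ∧ 2 ^ (w * (i + 2)) ≤ R (j - i)) →
        complexity α n + x ≤ complexity α (n + 1) := by
  have hne : ∀ t, φ t ≠ [] := fun t ht => by have := h2 t; simp [ht] at this
  have hpos : ∀ t k, 0 < (img φ k t).length := fun t k => List.length_pos_iff.2 (img_ne_nil hne k t)
  obtain ⟨W, hW1, hW⟩ := exists_length_le φ
  obtain ⟨s₁, hs₁⟩ := hS
  obtain ⟨f₁, hf₁⟩ := hF
  have hc : 0 < c := by
    obtain ⟨k, hk⟩ := hR 1
    have h3 := hgap f₁ s₁ k hf₁ hs₁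
    have := hpos s₁ k
    by_contra h0
    have : c = 0 := by omega
    subst this
    nlinarith
  obtain ⟨C, hC1, hC⟩ := h.exists_complexity_add_card_le hD h2 hsurj ⟨f₁, hf₁⟩ ⟨s₁, hs₁⟩ (by
    intro N
    obtain ⟨k, hk⟩ := hR (c * (N + 1))
    refine ⟨k, fun f s hf hs => ?_⟩
    have h3 := (Nat.mul_le_mul_right (img φ k s).length hk).trans (hgap f s k hf hs)
    rw [mul_assoc] at h3
    have h4 := Nat.le_of_mul_le_mul_left h3 hc
    have := hpos s k
    nlinarith)
  have hw : 3 * c * C ≤ 2 ^ (3 * c * C + W) ∧ W ≤ 2 ^ (3 * c * C + W) := by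
    have := Nat.lt_two_pow_self (n := 3 * c * C + W)
    constructor <;> omega
  set w := 3 * c * C + W with hwdef
  refine ⟨w, C + 1, by omega, fun n hn => ?_⟩
  have hex : ∃ j, ∃ s, ¬F s ∧ n ≤ C * (img φ j s).length := by
    refine ⟨n, s₁, hs₁, ?_⟩
    have h3 := two_pow_le_length_img h2 n s₁
    have h4 := Nat.lt_two_pow_self (n := n)
    nlinarith
  obtain ⟨j, ⟨s, hs, hjs⟩, hmin⟩ : ∃ j, (∃ s, ¬F s ∧ n ≤ C * (img φ (j + 1) s).length) ∧
      ∀ i ≤ j, ∀ s, ¬F s → C * (img φ i s).length < n := by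
    classical
    rcases hj : Nat.find hex with _ | j
    · obtain ⟨s, hs, hns⟩ := Nat.find_spec hex
      rw [hj] at hns
      simp at hns
      omega
    · refine ⟨j, by rw [← hj]; exact Nat.find_spec hex, fun i hi s hs => ?_⟩
      have := Nat.find_min hex (m := i) (by omega)
      by_contra! hcon
      exact this ⟨s, hs, hcon⟩
  have hCc : C ≤ 3 * c * C := by nlinarith
  refine ⟨j, ?_, fun x hx => ?_⟩
  · have h3 := length_img_add_le hW 0 (j + 1) s
    rw [zero_add, img_zero, List.length_singleton, mul_one] at h3
    have h4 : n ≤ 2 ^ (w * (j + 2)) := by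
      calc n ≤ C * W ^ (j + 1) := hjs.trans (Nat.mul_le_mul_left _ h3)
        _ ≤ 2 ^ w * (2 ^ w) ^ (j + 1) :=
          Nat.mul_le_mul (hCc.trans hw.1) (Nat.pow_le_pow_left hw.2 _)
        _ = _ := by rw [← pow_succ', ← pow_mul]
    calc Nat.log 2 n ≤ Nat.log 2 (2 ^ (w * (j + 2))) := Nat.log_mono_right h4
      _ = _ := Nat.log_pow one_lt_two _
  · have hinj : Set.InjOn (fun i => j - i) (Finset.range x : Set ℕ) := by
      intro a ha b hb hab
      have := (hx a (by simpa using ha)).1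
      have := (hx b (by simpa using hb)).1
      simp only at hab
      omega
    have := hC n ((Finset.range x).image fun i => j - i) (fun i hi => ?_) fun i hi f hf => ?_
    · rwa [Finset.card_image_of_injOn hinj, Finset.card_range] at this
    · obtain ⟨i, -, rfl⟩ := Finset.mem_image.1 hi
      exact hmin _ (by omega)
    · obtain ⟨i, hi', rfl⟩ := Finset.mem_image.1 hi
      obtain ⟨hij, hRi⟩ := hx i (Finset.mem_range.1 hi')
      have h3 := length_img_add_le hW (j - i) (i + 1) s
      rw [show j - i + (i + 1) = j + 1 by omega] at h3
      have h4 : c * (3 * n) ≤ c * (img φ (j - i) f).length := by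
        calc c * (3 * n) ≤ c * (3 * (C * (W ^ (i + 1) * (img φ (j - i) s).length))) := by
              gcongr
              exact hjs.trans (Nat.mul_le_mul_left _ h3)
          _ = (3 * c * C) * W ^ (i + 1) * (img φ (j - i) s).length := by ring
          _ ≤ 2 ^ w * (2 ^ w) ^ (i + 1) * (img φ (j - i) s).length := by
              gcongr
              · exact hw.1
              · exact hw.2
          _ = 2 ^ (w * (i + 2)) * (img φ (j - i) s).length := by rw [← pow_succ', ← pow_mul]
          _ ≤ R (j - i) * (img φ (j - i) s).length := Nat.mul_le_mul_right _ hRi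
          _ ≤ _ := hgap f s _ hf hs
      have h5 := Nat.le_of_mul_le_mul_left h4 hc
      omega

theorem FixedBy.exists_complexity_add_log_le [Finite A] (h : FixedBy φ α D)
    (hD : ∀ j, 1 ≤ j → j < D j) (h2 : ∀ t, 2 ≤ (φ t).length) (hsurj : Function.Surjective α)
    {F : A → Prop} (hF : ∃ t, F t) (hS : ∃ t, ¬F t) {q c : ℕ} (hq : 1 ≤ q)
    (hgap : ∀ f s k, F f → ¬F s → 2 ^ (k / q) * (img φ k s).length ≤ c * (img φ k f).length) :
    ∃ m N, 1 ≤ m ∧ ∀ n, N ≤ n → complexity α n + Nat.log 2 n / m ≤ complexity α (n + 1) := by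
  obtain ⟨w, N, hw, hN⟩ := h.exists_complexity_add_le hD h2 hsurj hF hS
    (R := fun k => 2 ^ (k / q)) (fun M => ⟨q * M, by
      rw [Nat.mul_div_cancel_left _ (by omega)]
      exact Nat.lt_two_pow_self.le⟩) hgap
  refine ⟨w * (8 * (w * q)), N + 2 ^ (w * (2 * (w * q) + 6)), by
    have := Nat.mul_pos hw hq
    have := Nat.mul_pos hw this
    nlinarith, fun n hn => ?_⟩
  obtain ⟨j, hj, hx⟩ := hN n ((Nat.le_add_right _ _).trans hn)
  refine hx _ fun i hi => ?_
  have hlog : w * (2 * (w * q) + 6) ≤ Nat.log 2 n :=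
    Nat.le_log_of_pow_le one_lt_two ((Nat.le_add_left _ _).trans hn)
  have hj' : 2 * (w * q) + 6 ≤ j + 2 := Nat.le_of_mul_le_mul_left (hlog.trans hj) hw
  have hxj : w * (8 * (w * q) * (i + 1)) ≤ w * (j + 2) := by
    have := (Nat.le_div_iff_mul_le (by
      have := Nat.mul_pos hw hq
      positivity)).1 hi
    calc _ = (i + 1) * (w * (8 * (w * q))) := by ring
      _ ≤ _ := this.trans hj
  have hxj' := Nat.le_of_mul_le_mul_left hxj hw
  have hwq : 1 ≤ w * q := Nat.mul_pos hw hq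
  have hkey : w * q * (i + 2) + i ≤ j := by nlinarith
  refine ⟨by omega, Nat.pow_le_pow_right (by norm_num) ?_⟩
  rw [Nat.le_div_iff_mul_le (by omega)]
  calc w * (i + 2) * q = w * q * (i + 2) := by ring
    _ ≤ j - i := by omega

theorem FixedBy.exists_complexity_add_log_log_le [Finite A] (h : FixedBy φ α D)
    (hD : ∀ j, 1 ≤ j → j < D j) (h2 : ∀ t, 2 ≤ (φ t).length) (hsurj : Function.Surjective α)
    {F : A → Prop} (hF : ∃ t, F t) (hS : ∃ t, ¬F t) {c : ℕ}
    (hgap : ∀ f s k, F f → ¬F s → (k + 1) * (img φ k s).length ≤ c * (img φ k f).length) :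
    ∃ m N, 1 ≤ m ∧ ∀ n, N ≤ n →
      complexity α n + Nat.log 2 (Nat.log 2 n) / m ≤ complexity α (n + 1) := by
  obtain ⟨w, N, hw, hN⟩ := h.exists_complexity_add_le hD h2 hsurj hF hS
    (R := fun k => k + 1) (fun M => ⟨M, by omega⟩) hgap
  refine ⟨5 * w, N + 2, by omega, fun n hn => ?_⟩
  obtain ⟨j, hj, hx⟩ := hN n (by omega)
  refine hx _ fun i hi => ?_
  have hi1 := (Nat.le_div_iff_mul_le (by omega)).1 hi
  have hlog : Nat.log 2 n ≠ 0 := (Nat.log_pos one_lt_two (by omega)).ne'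
  have h3 : 2 ^ ((i + 1) * (5 * w)) ≤ w * (j + 2) :=
    ((Nat.pow_le_pow_right (by norm_num) hi1).trans (Nat.pow_log_le_self 2 hlog)).trans hj
  have h4 : w * (2 ^ (w * (i + 2)) * 2 ^ (w * (i + 1)) * 2) ≤ 2 ^ ((i + 1) * (5 * w)) := by
    calc w * (2 ^ (w * (i + 2)) * 2 ^ (w * (i + 1)) * 2)
        ≤ 2 ^ w * (2 ^ (w * (i + 2)) * 2 ^ (w * (i + 1)) * 2 ^ 1) := by
          rw [pow_one]
          exact Nat.mul_le_mul_right _ Nat.lt_two_pow_self.le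
      _ = 2 ^ (w + (w * (i + 2) + w * (i + 1) + 1)) := by simp only [pow_add]
      _ ≤ _ := Nat.pow_le_pow_right (by norm_num) (by nlinarith)
  have h5 := Nat.le_of_mul_le_mul_left (h4.trans h3) hw
  have h6 : i + 1 < 2 ^ (w * (i + 1)) :=
    Nat.lt_two_pow_self.trans_le (Nat.pow_le_pow_right (by norm_num) (by nlinarith))
  have h7 : 1 ≤ 2 ^ (w * (i + 2)) := Nat.one_le_two_pow
  have h8 : 2 ^ (w * (i + 2)) + i ≤ j := by nlinarith
  exact ⟨by omega, by omega⟩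

theorem half_mul_le_of_add_le {p g : ℕ → ℕ} (hp : Monotone p) (hg : Monotone g) {N : ℕ}
    (h : ∀ n, N ≤ n → p n + g n ≤ p (n + 1)) {n : ℕ} (hn : 2 * N + 1 ≤ n) :
    (n / 2) * g (n / 2) ≤ p n := by
  have key : ∀ i, i * g (n / 2) ≤ p (n / 2 + i) := by
    intro i
    induction i with
    | zero => simp
    | succ i ih =>
      have h1 := h (n / 2 + i) (by omega)
      have h2 := hg (Nat.le_add_right (n / 2) i)
      rw [← add_assoc, add_mul, one_mul]
      omega
  exact (key _).trans (hp (by omega))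

end GrowingCase

theorem cast_clog_le {n : ℕ} (hn : 1 ≤ n) : (Nat.clog 2 n : ℝ) ≤ 2 * Real.log n + 1 := by
  have hn' : (1 : ℝ) ≤ n := by exact_mod_cast hn
  have h1 : (Nat.clog 2 n : ℝ) ≤ Nat.log 2 n + 1 := by
    exact_mod_cast Nat.clog_le_of_le_pow (Nat.lt_pow_succ_log_self one_lt_two n).le
  have h2 := Real.natLog_le_logb n 2
  have h3 : Real.logb 2 n ≤ 2 * Real.log n := by
    rw [Real.logb, div_le_iff₀ (Real.log_pos one_lt_two)]
    nlinarith [Real.log_two_gt_d9, Real.log_nonneg hn']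
  push_cast at h2
  linarith

theorem log_le_cast_log_add_one (n : ℕ) : Real.log n ≤ Nat.log 2 n + 1 := by
  rcases Nat.eq_zero_or_pos n with rfl | hn
  · simp
  have h0 : (0 : ℝ) < n := by exact_mod_cast hn
  have h1 : (n : ℝ) ≤ 2 ^ (Nat.log 2 n + 1) := by
    exact_mod_cast (Nat.lt_pow_succ_log_self one_lt_two n).le
  have h2 := Real.log_le_log h0 h1
  rw [Real.log_pow] at h2
  push_cast at h2
  nlinarith [Real.log_two_lt_d9, Real.log_two_gt_d9, Nat.cast_nonneg (α := ℝ) (Nat.log 2 n)]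

theorem cast_div_ge (a m : ℕ) (hm : 1 ≤ m) : (a : ℝ) / m - 1 ≤ ((a / m : ℕ) : ℝ) := by
  have hm' : (0 : ℝ) < m := by exact_mod_cast hm
  rw [sub_le_iff_le_add, div_le_iff₀ hm']
  have h1 := Nat.div_add_mod a m
  have h2 := Nat.mod_lt a hm
  have : a ≤ (a / m + 1) * m := by nlinarith
  exact_mod_cast this

theorem quarter_le_cast_half {n : ℕ} (hn : 2 ≤ n) : (n : ℝ) / 4 ≤ ((n / 2 : ℕ) : ℝ) := by
  have : n ≤ 4 * (n / 2) := by omega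
  have : (n : ℝ) ≤ 4 * ((n / 2 : ℕ) : ℝ) := by exact_mod_cast this
  linarith

theorem eventually_complexity_le_log {p : ℕ → ℕ} {C : ℕ}
    (h : ∀ n, p n ≤ C * (n + 1) * (Nat.clog 2 n + 2)) :
    ∃ B : ℝ, ∀ᶠ n in atTop, (p n : ℝ) ≤ B * classFun 3 n := by
  refine ⟨C * 10, ?_⟩
  filter_upwards [eventually_le_log 1, eventually_ge_atTop 1] with n h1 hn
  have hn' : (1 : ℝ) ≤ n := by exact_mod_cast hn
  have h2 := cast_clog_le hn
  have h3 : (p n : ℝ) ≤ C * (n + 1) * (Nat.clog 2 n + 2) := by exact_mod_cast h n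
  change (p n : ℝ) ≤ C * 10 * (n * Real.log n)
  calc (p n : ℝ) ≤ _ := h3
    _ ≤ C * (2 * n) * (5 * Real.log n) := by
      gcongr
      · linarith
      · linarith
    _ = _ := by ring

theorem eventually_complexity_le_log_log {p : ℕ → ℕ} {C e : ℕ}
    (h : ∀ n, p n ≤ C * (n + 1) * (1 + e * Nat.clog 2 (Nat.clog 2 n + 1))) :
    ∃ B : ℝ, ∀ᶠ n in atTop, (p n : ℝ) ≤ B * classFun 2 n := by
  refine ⟨C * 2 * (1 + e * 6), ?_⟩
  filter_upwards [eventually_le_log 1, eventually_le_log_log 1, eventually_ge_atTop 1]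
    with n h1 hll hn
  have hn' : (1 : ℝ) ≤ n := by exact_mod_cast hn
  have h2 := cast_clog_le hn
  have h4 := cast_clog_le (n := Nat.clog 2 n + 1) (by omega)
  have h5 : Real.log ((Nat.clog 2 n + 1 : ℕ) : ℝ) ≤ 2 * Real.log 2 + Real.log (Real.log n) := by
    have : ((Nat.clog 2 n + 1 : ℕ) : ℝ) ≤ 2 ^ 2 * Real.log n := by push_cast; linarith
    have h6 := Real.log_le_log (by positivity) this
    rw [Real.log_mul (by norm_num) (by linarith), Real.log_pow] at h6
    exact_mod_cast h6
  have h6 : (Nat.clog 2 (Nat.clog 2 n + 1) : ℝ) ≤ 6 * Real.log (Real.log n) := by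
    have := Real.log_two_lt_d9
    linarith
  have h3 : (p n : ℝ) ≤ C * (n + 1) * (1 + e * Nat.clog 2 (Nat.clog 2 n + 1)) := by
    exact_mod_cast h n
  change (p n : ℝ) ≤ C * 2 * (1 + e * 6) * (n * Real.log (Real.log n))
  calc (p n : ℝ) ≤ _ := h3
    _ ≤ C * (2 * n) * (Real.log (Real.log n) + e * (6 * Real.log (Real.log n))) := by
      gcongr
      · linarith
    _ = _ := by ring

theorem eventually_log_le_complexity {p : ℕ → ℕ} (hp : Monotone p) {m N : ℕ} (hm : 1 ≤ m)
    (h : ∀ n, N ≤ n → p n + Nat.log 2 n / m ≤ p (n + 1)) :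
    ∃ B : ℝ, ∀ᶠ n in atTop, classFun 3 n ≤ B * p n := by
  refine ⟨8 * m, ?_⟩
  filter_upwards [eventually_le_log (2 * (2 + m)), eventually_ge_atTop (2 * N + 2)] with n h1 hn
  have hm' : (1 : ℝ) ≤ m := by exact_mod_cast hm
  have hm0 : (0 : ℝ) < m := by linarith
  have hg : Monotone fun n => Nat.log 2 n / m := fun a b hab =>
    Nat.div_le_div_right (Nat.log_mono_right hab)
  have h2 := half_mul_le_of_add_le hp hg h (n := n) (by omega)
  have h3 : ((n / 2 : ℕ) : ℝ) * ((Nat.log 2 (n / 2) / m : ℕ) : ℝ) ≤ p n := by exact_mod_cast h2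
  have h4 := cast_div_ge (Nat.log 2 (n / 2)) m hm
  have h5 : Nat.log 2 n ≤ Nat.log 2 (n / 2) + 1 := by rw [Nat.log_div_base]; omega
  have h5' : (Nat.log 2 n : ℝ) ≤ Nat.log 2 (n / 2) + 1 := by exact_mod_cast h5
  have h6 := log_le_cast_log_add_one n
  have h7 : Real.log n / (2 * m) ≤ ((Nat.log 2 (n / 2) / m : ℕ) : ℝ) := by
    refine le_trans ?_ h4
    rw [le_sub_iff_add_le, le_div_iff₀ hm0, add_mul]
    have : Real.log n / (2 * m) * m = Real.log n / 2 := by field_simp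
    rw [this]
    linarith
  have h8 := quarter_le_cast_half (n := n) (by omega)
  change (n : ℝ) * Real.log n ≤ 8 * m * p n
  have h9 : 0 ≤ Real.log n := by linarith
  calc (n : ℝ) * Real.log n = 8 * m * (n / 4 * (Real.log n / (2 * m))) := by field_simp; ring
    _ ≤ 8 * m * (((n / 2 : ℕ) : ℝ) * ((Nat.log 2 (n / 2) / m : ℕ) : ℝ)) := by gcongr
    _ ≤ _ := by gcongr

theorem eventually_log_log_le_complexity {p : ℕ → ℕ} (hp : Monotone p) {m N : ℕ} (hm : 1 ≤ m)
    (h : ∀ n, N ≤ n → p n + Nat.log 2 (Nat.log 2 n) / m ≤ p (n + 1)) :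
    ∃ B : ℝ, ∀ᶠ n in atTop, classFun 2 n ≤ B * p n := by
  refine ⟨8 * m, ?_⟩
  filter_upwards [eventually_le_log 4, eventually_le_log_log (2 * (3 + m)),
    eventually_ge_atTop (2 * N + 2)] with n h0 h1 hn
  have hm' : (1 : ℝ) ≤ m := by exact_mod_cast hm
  have hm0 : (0 : ℝ) < m := by linarith
  have hg : Monotone fun n => Nat.log 2 (Nat.log 2 n) / m := fun a b hab =>
    Nat.div_le_div_right (Nat.log_mono_right (Nat.log_mono_right hab))
  have h2 := half_mul_le_of_add_le hp hg h (n := n) (by omega)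
  have h3 : ((n / 2 : ℕ) : ℝ) * ((Nat.log 2 (Nat.log 2 (n / 2)) / m : ℕ) : ℝ) ≤ p n := by
    exact_mod_cast h2
  have h4 := cast_div_ge (Nat.log 2 (Nat.log 2 (n / 2))) m hm
  have h5 : Nat.log 2 n ≤ Nat.log 2 (n / 2) + 1 := by rw [Nat.log_div_base]; omega
  have h5' : (Nat.log 2 n : ℝ) ≤ Nat.log 2 (n / 2) + 1 := by exact_mod_cast h5
  have h6 := log_le_cast_log_add_one n
  have h10 : Real.log (Real.log n) ≤ Real.log 2 + Real.log (Nat.log 2 (n / 2) : ℕ) := by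
    rw [← Real.log_mul (by norm_num)]
    · exact Real.log_le_log (by linarith) (by linarith)
    · intro hz
      rw [hz] at h5'
      linarith
  have h11 := log_le_cast_log_add_one (Nat.log 2 (n / 2))
  have h7 : Real.log (Real.log n) / (2 * m) ≤
      ((Nat.log 2 (Nat.log 2 (n / 2)) / m : ℕ) : ℝ) := by
    refine le_trans ?_ h4
    rw [le_sub_iff_add_le, le_div_iff₀ hm0, add_mul]
    have : Real.log (Real.log n) / (2 * m) * m = Real.log (Real.log n) / 2 := by field_simp
    rw [this]
    have := Real.log_two_lt_d9
    linarith
  have h8 := quarter_le_cast_half (n := n) (by omega)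
  change (n : ℝ) * Real.log (Real.log n) ≤ 8 * m * p n
  have h9 : 0 ≤ Real.log (Real.log n) := by linarith
  calc (n : ℝ) * Real.log (Real.log n) = 8 * m * (n / 4 * (Real.log (Real.log n) / (2 * m))) := by
        field_simp; ring
    _ ≤ 8 * m * (((n / 2 : ℕ) : ℝ) * ((Nat.log 2 (Nat.log 2 (n / 2)) / m : ℕ) : ℝ)) := by gcongr
    _ ≤ _ := by gcongr

/-- The classification for morphisms all of whose letters grow. -/
theorem FixedBy.exists_isTheta_of_grows [Finite A] {φ : A → List A} {α : ℕ → A} {D : ℕ → ℕ}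
    (h : FixedBy φ α D) (hD : ∀ j, 1 ≤ j → j < D j) (hne : ∀ t, φ t ≠ [])
    (hsurj : Function.Surjective α) (hgr : ∀ t, Grows φ t) :
    ∃ i, (fun n => (complexity α n : ℝ)) =Θ[atTop] classFun i := by
  obtain ⟨N, hN⟩ : ∃ N, ∀ t, 2 ≤ (img φ N t).length := by
    choose k hk using fun t => hgr t 2
    obtain ⟨N, hN⟩ := (Set.finite_range k).bddAbove
    exact ⟨N, fun t => (hk t).trans (length_img_mono hne t (hN ⟨t, rfl⟩))⟩
  obtain ⟨p, hNp, hp1, -, halph, e, e', hee⟩ := exists_idempotent_power (φ := φ)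
    (G := fun _ => True)
    (fun t _ => ⟨(φ t).head (hne t), List.head_mem _, trivial⟩) (fun t ht => absurd trivial ht)
    (M := 0) (fun t ht => absurd trivial ht) N
  have h' := h.iterate p
  have hD' := self_lt_iterate hD hp1
  have h2 : ∀ t, 2 ≤ (img φ p t).length := fun t => (hN t).trans (length_img_mono hne t hNp)
  have hne' : ∀ t, img φ p t ≠ [] := img_ne_nil hne p
  have hnil : ∀ v : List A, (∀ s ∈ v, ¬True) → v = [] := fun v hv =>
    List.eq_nil_iff_forall_not_mem.2 fun s hs => hv s hs trivial
  have hst : ∀ n K, (∀ t, n ≤ (img (img φ p) K t).length) → StableFrom (img φ p) n (K + 1) := by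
    refine fun n K hK => stableFrom_succ hne' (e := e) (e' := e') (fun t => ?_) (fun t => ?_) hK
    · obtain ⟨⟨-, h3, v, z, hv, hvn⟩, -⟩ := hee t trivial
      rw [hnil v hvn] at hv
      exact ⟨h3, z, hv⟩
    · obtain ⟨-, -, h3, v, z, hv, hvn⟩ := hee t trivial
      rw [hnil v hvn] at hv
      exact ⟨h3, z, hv⟩
  rcases growth_trichotomy hne' (fun t s => (halph t s).1) with
    ⟨B, hB⟩ | ⟨F, hF, hS, ⟨B, d, hB⟩, c, hc⟩ | ⟨F, hF, hS, q, c, hq, hc⟩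
  · rcases complexity_bounded_or_gt α with ⟨C, hC⟩ | hlow
    · exact ⟨0, isTheta_one_of_bounded hC (complexity_pos α)⟩
    · obtain ⟨C, hC⟩ := h'.exists_complexity_le_clog_clog hD' h2 hst (B := B) (e := 0)
        (by simpa using hB)
      refine ⟨1, isTheta_classFun_iff.2 ⟨⟨C * 2, ?_⟩, 1, ?_⟩⟩
      · filter_upwards [eventually_ge_atTop 1] with n hn
        change (complexity α n : ℝ) ≤ C * 2 * (n : ℝ)
        have h3 := hC n
        have h4 : complexity α n ≤ C * 2 * n := by
          rw [zero_mul, add_zero, mul_one] at h3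
          nlinarith
        exact_mod_cast h4
      · refine Eventually.of_forall fun n => ?_
        change (n : ℝ) ≤ 1 * (complexity α n : ℝ)
        rw [one_mul]
        exact_mod_cast (Nat.le_succ n).trans (hlow n)
  · obtain ⟨C, hC⟩ := h'.exists_complexity_le_clog_clog hD' h2 hst hB
    obtain ⟨m, M, hm, hM⟩ := h'.exists_complexity_add_log_log_le hD' h2 hsurj hF hS hc
    exact ⟨2, isTheta_classFun_iff.2 ⟨eventually_complexity_le_log_log hC,
      eventually_log_log_le_complexity (complexity_mono α) hm hM⟩⟩
  · obtain ⟨C, hC⟩ := h'.exists_complexity_le_clog hD' h2 hst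
    obtain ⟨m, M, hm, hM⟩ := h'.exists_complexity_add_log_le hD' h2 hsurj hF hS hq hc
    exact ⟨3, isTheta_classFun_iff.2 ⟨eventually_complexity_le_log hC,
      eventually_log_le_complexity (complexity_mono α) hm hM⟩⟩

/-- Pansiot: the complexity of a pure morphic sequence belongs to exactly one of the five
classes Θ(1), Θ(n), Θ(n log log n), Θ(n log n), Θ(n²). -/
theorem pansiot_classification {A : Type*} [Fintype A] (φ : A → List A) (a : A) (α : ℕ → A)
    (hpro : Prolongable φ a) (hfix : IsFixedSeq φ a α) :
    ∃! i : Fin 5, (fun n => (complexity α n : ℝ)) =Θ[atTop] classFun i := by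
  obtain ⟨D, h, hD⟩ := IsFixedSeq.exists_fixedBy hpro hfix
  obtain ⟨i, hi⟩ := FixedBy.exists_isTheta_of_growing
    (fun B _ ψ β E h hE hne hsurj hgr => h.exists_isTheta_of_grows hE hne hsurj hgr) h hD
  exact ⟨i, hi, fun j hj => classFun_unique hj hi⟩
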